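/- (Green–Tao theorem) Let E be a subset of the set 𝒫 of prime numbers with positive relative upper density, i.e. limsup_{N→∞} |E ∩ [1,N]| / |𝒫 ∩ [1,N]| > 0. Then for every k ≥ 3, E contains a non-trivial k-term arithmetic progression: there exist x ∈ E and an integer d ≠ 0 with x + jd ∈ E for all j = 0,1,…,k−1. -/

import Mathlib

open Filter

/-- The relative upper density of a set `E` of primes:
`limsup_{N→∞} |E ∩ [1,N]| / |𝒫 ∩ [1,N]|`. -/
noncomputable def relUpperDensity (E : Set ℕ) : ℝ :=
  limsup (fun N : ℕ =>
    (Nat.card ↥(E ∩ Set.Icc 1 N) : ℝ) /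
      (Nat.card ↥({p : ℕ | p.Prime} ∩ Set.Icc 1 N) : ℝ)) atTop

section

open Filter
open scoped BigOperators

namespace GT

set_option linter.unusedSectionVars false
set_option linter.unusedSimpArgs false
set_option linter.unusedVariables false
set_option linter.deprecated false

/-! ## Part 1: density Hales-Jewett -/

/-- evaluate a variable word -/
def ev {ι κ α : Type} (V : ι → α ⊕ κ) (z : κ → α) : ι → α := fun i => Sum.elim id z (V i)

/-- every wildcard is used -/
def Proper {ι κ α : Type} (V : ι → α ⊕ κ) : Prop := ∀ j, ∃ i, V i = Sum.inr j

/-- indicator -/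
noncomputable def ind {X : Type} (A : Set X) : X → ℝ := A.indicator 1

lemma ind_of_mem {X : Type} {A : Set X} {x : X} (h : x ∈ A) : ind A x = 1 := by
  simp [ind, h]

lemma ind_of_not_mem {X : Type} {A : Set X} {x : X} (h : x ∉ A) : ind A x = 0 := by
  simp [ind, h]

lemma ind_nonneg {X : Type} (A : Set X) (x : X) : 0 ≤ ind A x := by
  by_cases h : x ∈ A
  · rw [ind_of_mem h]; norm_num
  · rw [ind_of_not_mem h]

lemma ind_le_one {X : Type} (A : Set X) (x : X) : ind A x ≤ 1 := by
  by_cases h : x ∈ A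
  · rw [ind_of_mem h]
  · rw [ind_of_not_mem h]; norm_num

/-- expectation over a finite type -/
noncomputable def av {X : Type} [Fintype X] (f : X → ℝ) : ℝ := (∑ x, f x) / (Fintype.card X : ℝ)

section av
variable {X Y : Type} [Fintype X] [Fintype Y]

lemma av_add (f g : X → ℝ) : av (fun x => f x + g x) = av f + av g := by
  simp [av, Finset.sum_add_distrib, add_div]

lemma av_sub (f g : X → ℝ) : av (fun x => f x - g x) = av f - av g := by
  simp [av, Finset.sum_sub_distrib, sub_div]

lemma av_neg (f : X → ℝ) : av (fun x => - f x) = - av f := by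
  simp [av, neg_div]

lemma av_mul_left (c : ℝ) (f : X → ℝ) : av (fun x => c * f x) = c * av f := by
  simp [av, ← Finset.mul_sum, mul_div_assoc]

lemma av_mul_right (c : ℝ) (f : X → ℝ) : av (fun x => f x * c) = av f * c := by
  simp [av, ← Finset.sum_mul, div_mul_eq_mul_div]

lemma av_const [Nonempty X] (c : ℝ) : av (fun _ : X => c) = c := by
  simp [av]

lemma av_sum {I : Type} (s : Finset I) (f : I → X → ℝ) :
    av (fun x => ∑ i ∈ s, f i x) = ∑ i ∈ s, av (f i) := by
  simp only [av]
  rw [Finset.sum_comm, Finset.sum_div]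

lemma av_mono {f g : X → ℝ} (h : ∀ x, f x ≤ g x) : av f ≤ av g := by
  unfold av
  gcongr
  exact h _

lemma av_nonneg {f : X → ℝ} (h : ∀ x, 0 ≤ f x) : 0 ≤ av f :=
  div_nonneg (Finset.sum_nonneg fun x _ => h x) (by positivity)

lemma av_le_of_le {f : X → ℝ} {c : ℝ} (hc : 0 ≤ c) (h : ∀ x, f x ≤ c) : av f ≤ c := by
  rcases isEmpty_or_nonempty X with hX | hX
  · simp [av, hc]
  · calc av f ≤ av (fun _ : X => c) := av_mono h
      _ = c := av_const c

lemma le_av_of_le [Nonempty X] {f : X → ℝ} {c : ℝ} (h : ∀ x, c ≤ f x) : c ≤ av f := by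
  calc c = av (fun _ : X => c) := (av_const c).symm
    _ ≤ av f := av_mono h

lemma abs_av_le (f : X → ℝ) : |av f| ≤ av (fun x => |f x|) := by
  unfold av
  rw [abs_div, Nat.abs_cast]
  gcongr
  exact Finset.abs_sum_le_sum_abs _ _

lemma av_comm (f : X → Y → ℝ) : av (fun x => av (f x)) = av (fun y => av (fun x => f x y)) := by
  simp only [av]
  rw [← Finset.sum_div, ← Finset.sum_div, Finset.sum_comm, div_div, div_div, mul_comm]

lemma av_prod (f : X × Y → ℝ) : av f = av (fun x => av (fun y => f (x, y))) := by
  simp only [av, Fintype.sum_prod_type, Fintype.card_prod, Nat.cast_mul]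
  rw [← Finset.sum_div, div_div, mul_comm]

lemma av_equiv (e : X ≃ Y) (f : Y → ℝ) : av f = av (fun x => f (e x)) := by
  simp only [av]
  rw [Equiv.sum_comp e f, Fintype.card_congr e]

lemma exists_of_av_lt [Nonempty X] {f : X → ℝ} {c : ℝ} (h : c < av f) : ∃ x, c < f x := by
  by_contra hcon
  push Not at hcon
  have : av f ≤ c := by
    calc av f ≤ av (fun _ : X => c) := av_mono hcon
      _ = c := av_const c
  linarith

lemma av_pos_exists {f : X → ℝ} (h : 0 < av f) : ∃ x, 0 < f x := by
  by_contra hcon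
  push Not at hcon
  have : av f ≤ 0 := av_le_of_le le_rfl hcon
  linarith

lemma av_markov [Nonempty X] {f : X → ℝ} {δ : ℝ} (h1 : ∀ x, f x ≤ 1)
    (hδ : 0 ≤ δ) (h : δ ≤ av f) : δ / 2 ≤ av (ind {x | δ / 2 ≤ f x}) := by
  have : av f ≤ av (fun x => ind {x | δ / 2 ≤ f x} x + δ / 2) := by
    apply av_mono
    intro x
    by_cases hx : δ / 2 ≤ f x
    · rw [ind_of_mem (by exact hx)]; linarith [h1 x]
    · rw [ind_of_not_mem (by exact hx)]; push Not at hx; linarith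
  rw [av_add, av_const] at this
  linarith

/-- pigeonhole -/
lemma av_pigeon {I : Type} [Fintype I] {G : Set X} {S : I → Set X} {c : ℝ}
    (hc : 0 < c) (h : c ≤ av (ind G)) (hS : ∀ x ∈ G, ∃ i, x ∈ S i) :
    ∃ i, c / Fintype.card I ≤ av (ind (S i)) := by
  by_contra hcon
  push Not at hcon
  have hne : Nonempty I := by
    obtain ⟨x, hx⟩ := av_pos_exists (lt_of_lt_of_le hc h)
    have : x ∈ G := by
      by_contra hh; rw [ind_of_not_mem hh] at hx; exact lt_irrefl _ hx
    exact ⟨(hS x this).choose⟩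
  have h1 : av (ind G) ≤ av (fun x => ∑ i, ind (S i) x) := by
    apply av_mono
    intro x
    by_cases hx : x ∈ G
    · rw [ind_of_mem hx]
      obtain ⟨i, hi⟩ := hS x hx
      rw [← ind_of_mem hi]
      exact Finset.single_le_sum (f := fun i => ind (S i) x) (fun j _ => ind_nonneg _ _)
        (Finset.mem_univ i)
    · rw [ind_of_not_mem hx]; exact Finset.sum_nonneg (fun j _ => ind_nonneg _ _)
  rw [av_sum] at h1
  have h2 : ∑ i, av (ind (S i)) < ∑ i : I, c / Fintype.card I :=
    Finset.sum_lt_sum_of_nonempty Finset.univ_nonempty (fun i _ => hcon i)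
  rw [Finset.sum_const, Finset.card_univ, nsmul_eq_mul, mul_div_cancel₀] at h2
  · linarith
  · simp

end av

/-- glueing -/
def glue {ι α : Type} (p : ι → Prop) [DecidablePred p] (u : {i // p i} → α) (c : {i // ¬ p i} → α) :
    ι → α := fun i => if h : p i then u ⟨i, h⟩ else c ⟨i, h⟩

lemma av_glue {ι α : Type} [Fintype ι] [DecidableEq ι] [Fintype α] (p : ι → Prop) [DecidablePred p]
    (f : (ι → α) → ℝ) :
    av f = av (fun c : {i // ¬ p i} → α => av (fun u : {i // p i} → α => f (glue p u c))) := by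
  rw [av_equiv (Equiv.piEquivPiSubtypeProd p (fun _ => α)).symm f, av_prod, av_comm]
  rfl

/-- The density Hales-Jewett property of an alphabet. -/
def DHJ (α : Type) [Fintype α] : Prop := ∀ δ : ℝ, 0 < δ → ∃ n0 : ℕ, ∀ (ι : Type) [Fintype ι]
  [DecidableEq ι], n0 ≤ Fintype.card ι → ∀ A : Set (ι → α), δ ≤ av (ind A) →
  ∃ V : ι → α ⊕ Unit, Proper V ∧ ∀ z, ev V z ∈ A

/-- The multidimensional density Hales-Jewett property of an alphabet. -/
def MDHJ (α : Type) [Fintype α] : Prop := ∀ m : ℕ, ∀ δ : ℝ, 0 < δ → ∃ n0 : ℕ,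
  ∀ (ι : Type) [Fintype ι]
  [DecidableEq ι], n0 ≤ Fintype.card ι → ∀ A : Set (ι → α), δ ≤ av (ind A) →
  ∃ V : ι → α ⊕ Fin m, Proper V ∧ ∀ z, ev V z ∈ A

lemma exists_mem_of_av_ind_pos {X : Type} [Fintype X] {A : Set X} (h : 0 < av (ind A)) :
    ∃ x, x ∈ A := by
  obtain ⟨x, hx⟩ := av_pos_exists h
  refine ⟨x, ?_⟩
  by_contra hh; rw [ind_of_not_mem hh] at hx; exact lt_irrefl _ hx

lemma exists_block {ι : Type} [Fintype ι] (J : Finset ι) {M : ℕ} (h : M ≤ J.card) :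
    ∃ B : Finset ι, B ⊆ J ∧ B.card = M := by
  obtain ⟨B, h1, h2⟩ := Finset.exists_subset_card_eq h
  exact ⟨B, h1, h2⟩

lemma exists_split (ι : Type) [Fintype ι] {M n' : ℕ} (h : M + n' ≤ Fintype.card ι) :
    ∃ (p : ι → Prop) (_ : DecidablePred p), Fintype.card {i // p i} = M ∧
      n' ≤ Fintype.card {i // ¬ p i} := by
  classical
  obtain ⟨B, -, hB⟩ := exists_block (Finset.univ : Finset ι) (M := M)
    (by rw [Finset.card_univ]; omega)
  refine ⟨fun i => i ∈ B, inferInstance, ?_, ?_⟩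
  · rw [Fintype.card_subtype]; simp [hB]
  · rw [Fintype.card_subtype_compl]
    simp only [Fintype.card_subtype, Finset.filter_univ_mem]
    omega

lemma mdhj_of_dhj {α : Type} [Fintype α] [Nonempty α] (h : DHJ α) : MDHJ α := by
  intro m
  induction m with
  | zero =>
    intro δ hδ
    refine ⟨0, ?_⟩
    intro ι _ _ _ A hA
    obtain ⟨x, hx⟩ := exists_mem_of_av_ind_pos (lt_of_lt_of_le hδ hA)
    refine ⟨fun i => Sum.inl (x i), fun j => j.elim0, fun z => ?_⟩
    exact hx
  | succ m ih =>
    intro δ hδ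
    obtain ⟨M, hM⟩ := h (δ / 2) (by positivity)
    let Λ : ℝ := ((Fintype.card (α ⊕ Unit)) ^ M : ℕ)
    have hΛ : 0 < Λ := by
      simp only [Λ]; simp only [Fintype.card_sum, Fintype.card_unit]; positivity
    obtain ⟨n', hn'⟩ := ih (δ / 2 / Λ) (by positivity)
    refine ⟨M + n', ?_⟩
    intro ι _ _ hι A hA
    obtain ⟨p, _, hcB, hcB'⟩ := exists_split ι (M := M) (n' := n') hι
    rw [av_glue p] at hA
    have h1 : ∀ c : {i // ¬ p i} → α,
        av (fun u : {i // p i} → α => ind A (glue p u c)) ≤ 1 := by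
      intro c
      apply av_le_of_le zero_le_one
      intro u
      exact ind_le_one _ _
    have hG := av_markov h1 hδ.le hA
    set G := {c : {i // ¬ p i} → α | δ / 2 ≤
      av (fun u : {i // p i} → α => ind A (glue p u c))}
    obtain ⟨L, hL⟩ := av_pigeon (I := {i // p i} → α ⊕ Unit)
      (S := fun L => {c | Proper L ∧ ∀ z, glue p (ev L z) c ∈ A})
      (by positivity) hG (by
        intro c hc
        obtain ⟨L, hL, hL'⟩ := hM {i // p i} (by rw [hcB])
          {u | glue p u c ∈ A} hc
        exact ⟨L, hL, hL'⟩)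
    have hcard : (Fintype.card ({i // p i} → α ⊕ Unit) : ℝ) = Λ := by
      rw [Fintype.card_fun, hcB]
    rw [hcard] at hL
    obtain ⟨V', hV', hV''⟩ := hn' {i // ¬ p i} hcB' _ hL
    have hLp : Proper L := (hV'' (fun _ => Classical.arbitrary α)).1
    refine ⟨fun i => if hi : p i then Sum.map id (fun _ => 0) (L ⟨i, hi⟩)
      else Sum.map id Fin.succ (V' ⟨i, hi⟩), ?_, ?_⟩
    · intro j
      refine Fin.cases ?_ (fun j => ?_) j
      · obtain ⟨i, hi⟩ := hLp ()
        refine ⟨i.1, ?_⟩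
        simp [i.2, hi]
      · obtain ⟨i, hi⟩ := hV' j
        refine ⟨i.1, ?_⟩
        simp [i.2, hi]
    · intro z
      have := (hV'' (fun j => z j.succ)).2 (fun _ => z 0)
      convert this using 1
      funext i
      by_cases hi : p i
      · simp only [ev, glue, hi, dite_true]
        cases L ⟨i, hi⟩ <;> simp
      · simp only [ev, glue, hi, dite_false]
        cases V' ⟨i, hi⟩ <;> simp

end GT

end

section

open Filter
open scoped BigOperators

namespace GT

set_option linter.unusedSectionVars false
set_option linter.unusedSimpArgs false
set_option linter.unusedVariables false
set_option linter.deprecated false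

/-- product-weighted sums -/
noncomputable def wt {ι S : Type} [Fintype ι] (μ : S → ℝ) (v : ι → S) : ℝ := ∏ i, μ (v i)

/-- weighted expectation for i.i.d. coordinates -/
noncomputable def EW {ι S : Type} [Fintype ι] [DecidableEq ι] [Fintype S] (μ : S → ℝ)
    (g : (ι → S) → ℝ) : ℝ := ∑ v, wt μ v * g v

section EW
variable {ι S T : Type} [Fintype ι] [DecidableEq ι] [Fintype S] [Fintype T] [DecidableEq T]

lemma sum_prod_fun (F : ι → S → ℝ) : ∑ v : ι → S, ∏ i, F i (v i) = ∏ i, ∑ s, F i s := by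
  rw [Finset.prod_univ_sum]
  simp

lemma sum_wt (μ : S → ℝ) : ∑ v : ι → S, wt μ v = (∑ s, μ s) ^ Fintype.card ι := by
  unfold wt
  rw [sum_prod_fun (fun _ s => μ s)]
  simp

/-- pushforward weights -/
noncomputable def push (φ : S → T) (μ : S → ℝ) (t : T) : ℝ := ∑ s, if φ s = t then μ s else 0

lemma sum_push (φ : S → T) (μ : S → ℝ) : ∑ t, push φ μ t = ∑ s, μ s := by
  unfold push
  rw [Finset.sum_comm]
  simp

lemma EW_push (φ : S → T) (μ : S → ℝ) (g : (ι → T) → ℝ) :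
    EW μ (fun v => g (fun i => φ (v i))) = EW (push φ μ) g := by
  classical
  unfold EW
  have h1 : ∀ w : ι → T, wt (push φ μ) w =
      ∑ v : ι → S, ∏ i, (if φ (v i) = w i then μ (v i) else 0) := by
    intro w
    unfold wt push
    rw [sum_prod_fun (fun i s => if φ s = w i then μ s else 0)]
  have h2 : ∀ (w : ι → T) (v : ι → S), (∏ i, (if φ (v i) = w i then μ (v i) else 0)) =
      if (fun i => φ (v i)) = w then wt μ v else 0 := by
    intro w v
    split_ifs with h
    · subst h; simp [wt]
    · have : ∃ i, φ (v i) ≠ w i := by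
        by_contra hcon; push Not at hcon; exact h (funext hcon)
      obtain ⟨i, hi⟩ := this
      exact Finset.prod_eq_zero (Finset.mem_univ i) (by simp [hi])
  simp only [h1, h2, Finset.sum_mul]
  rw [Finset.sum_comm]
  simp

lemma EW_chi {μ ν : S → ℝ} (hν0 : ∀ s, 0 ≤ ν s) (hz : ∀ s, ν s = 0 → μ s = 0)
    (hμ1 : ∑ s, μ s = 1) (hν1 : ∑ s, ν s = 1) {c : ℝ} (hc : ∑ s, μ s ^ 2 / ν s ≤ c)
    {g : (ι → S) → ℝ} (hg : ∀ v, |g v| ≤ 1) :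
    (EW μ g - EW ν g) ^ 2 ≤ c ^ Fintype.card ι - 1 := by
  have hQ0 : ∀ v : ι → S, 0 ≤ wt ν v := fun v => Finset.prod_nonneg (fun i _ => hν0 _)
  have hPQ : ∀ v : ι → S, wt ν v = 0 → wt μ v = 0 := by
    intro v hv
    obtain ⟨i, _, hi⟩ := Finset.prod_eq_zero_iff.mp hv
    exact Finset.prod_eq_zero (Finset.mem_univ i) (hz _ hi)
  have e1 : EW μ g - EW ν g = ∑ v, (wt μ v - wt ν v) * g v := by
    unfold EW; rw [← Finset.sum_sub_distrib]; simp only [sub_mul]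
  have hcs := Finset.sum_sq_le_sum_mul_sum_of_sq_eq_mul (Finset.univ : Finset (ι → S))
    (r := fun v => (wt μ v - wt ν v) * g v)
    (f := fun v => (wt μ v - wt ν v) ^ 2 / wt ν v) (g := fun v => wt ν v * g v ^ 2)
    (fun v _ => div_nonneg (sq_nonneg _) (hQ0 v))
    (fun v _ => mul_nonneg (hQ0 v) (sq_nonneg _))
    (by
      intro v _
      by_cases h : wt ν v = 0
      · simp [h, hPQ v h]
      · field_simp)
  have hA : ∑ v : ι → S, wt ν v * g v ^ 2 ≤ 1 := by
    calc ∑ v : ι → S, wt ν v * g v ^ 2 ≤ ∑ v : ι → S, wt ν v := by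
          apply Finset.sum_le_sum
          intro v _
          have : g v ^ 2 ≤ 1 := by
            rw [← sq_abs]; exact pow_le_one₀ (abs_nonneg _) (hg v)
          nlinarith [hQ0 v]
      _ = 1 := by rw [sum_wt, hν1, one_pow]
  have hB : ∑ v : ι → S, (wt μ v - wt ν v) ^ 2 / wt ν v = (∑ s, μ s ^ 2 / ν s) ^ Fintype.card ι - 1 := by
    have h1 : ∀ v : ι → S, (wt μ v - wt ν v) ^ 2 / wt ν v =
        (∏ i, (μ (v i) ^ 2 / ν (v i))) - 2 * wt μ v + wt ν v := by
      intro v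
      have : (∏ i, (μ (v i) ^ 2 / ν (v i))) = wt μ v ^ 2 / wt ν v := by
        unfold wt; rw [Finset.prod_div_distrib, Finset.prod_pow]
      rw [this]
      by_cases h : wt ν v = 0
      · simp [h, hPQ v h]
      · field_simp; ring
    simp only [h1]
    rw [Finset.sum_add_distrib, Finset.sum_sub_distrib, ← Finset.mul_sum, sum_wt, sum_wt, hμ1, hν1,
      sum_prod_fun (fun _ s => μ s ^ 2 / ν s)]
    simp; ring
  rw [hB] at hcs
  rw [e1]
  have hB0 : 0 ≤ (∑ s, μ s ^ 2 / ν s) ^ Fintype.card ι - 1 := by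
    rw [← hB]; exact Finset.sum_nonneg (fun v _ => div_nonneg (sq_nonneg _) (hQ0 v))
  have h3 : (∑ s, μ s ^ 2 / ν s) ^ Fintype.card ι ≤ c ^ Fintype.card ι := by
    apply pow_le_pow_left₀ _ hc
    exact Finset.sum_nonneg (fun s _ => div_nonneg (sq_nonneg _) (hν0 s))
  calc (∑ v, (wt μ v - wt ν v) * g v) ^ 2 ≤ _ := hcs
    _ ≤ ((∑ s, μ s ^ 2 / ν s) ^ Fintype.card ι - 1) * 1 := by gcongr
    _ ≤ _ := by linarith

end EW

section corr
variable {O : Type} [Fintype O] [DecidableEq O] [Nonempty O]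

/-- law of the letters of the random subspace -/
noncomputable def muV (O : Type) [Fintype O] (N : ℕ) (q : ℝ) : O ⊕ Fin N → ℝ :=
  Sum.elim (fun _ => (1 - N * q) / Fintype.card O) (fun _ => q)

/-- law of the letters of the base random line -/
noncomputable def baseL (O : Type) [Fintype O] (s : ℝ) : O ⊕ Unit → ℝ :=
  Sum.elim (fun _ => (1 - s) / Fintype.card O) (fun _ => s)

/-- number of wildcards -/
def nwild {N : ℕ} (x : Fin N → O ⊕ Unit) : ℕ := (Finset.univ.filter fun j => x j = Sum.inr ()).card

lemma sum_muV (N : ℕ) (q : ℝ) : ∑ s, muV O N q s = 1 := by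
  simp only [muV, Fintype.sum_sum_type, Sum.elim_inl, Sum.elim_inr, Finset.sum_const,
    Finset.card_univ, nsmul_eq_mul, Fintype.card_fin]
  field_simp; ring

lemma sum_baseL (s : ℝ) : ∑ t, baseL O s t = 1 := by
  simp only [baseL, Fintype.sum_sum_type, Sum.elim_inl, Sum.elim_inr, Finset.sum_const,
    Finset.card_univ, nsmul_eq_mul]
  field_simp; simp

lemma nwild_le {N : ℕ} (x : Fin N → O ⊕ Unit) : nwild x ≤ N := by
  unfold nwild
  exact (Finset.card_filter_le _ _).trans (by simp)

lemma push_inr {N : ℕ} (x : Fin N → O ⊕ Unit) (q : ℝ) :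
    push (Sum.elim Sum.inl x) (muV O N q) (Sum.inr ()) = q * nwild x := by
  simp only [push, Fintype.sum_sum_type, muV, Sum.elim_inl, Sum.elim_inr, nwild]
  have h : (∑ j, if x j = Sum.inr () then q else 0) =
      q * (Finset.univ.filter fun j => x j = Sum.inr ()).card := by
    rw [← Finset.sum_filter, Finset.sum_const, nsmul_eq_mul, mul_comm]
  simp
  exact h

lemma push_inl {N : ℕ} (x : Fin N → O ⊕ Unit) (q : ℝ) (o : O) :
    push (Sum.elim Sum.inl x) (muV O N q) (Sum.inl o) = (1 - N * q) / Fintype.card O +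
      q * (Finset.univ.filter fun j => x j = Sum.inl o).card := by
  simp only [push, Fintype.sum_sum_type, muV, Sum.elim_inl, Sum.elim_inr]
  have h : (∑ j, if x j = Sum.inl o then q else 0) =
      q * (Finset.univ.filter fun j => x j = Sum.inl o).card := by
    rw [← Finset.sum_filter, Finset.sum_const, nsmul_eq_mul, mul_comm]
  simp
  exact h

lemma chi_bound {N : ℕ} (x : Fin N → O ⊕ Unit) {q : ℝ} (hq : 0 ≤ q) (hNq : N * q ≤ 1 / 2) :
    ∑ t, push (Sum.elim Sum.inl x) (muV O N q) t ^ 2 / baseL O (q * nwild x) t ≤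
      1 + 2 * (Fintype.card O) ^ 2 * N ^ 2 * q ^ 2 := by
  have hs := sum_push (Sum.elim Sum.inl x) (muV O N q)
  rw [sum_muV, Fintype.sum_sum_type] at hs
  have hb := sum_baseL (O := O) (q * nwild x)
  rw [Fintype.sum_sum_type] at hb
  rw [Fintype.sum_sum_type]
  have hk : (0 : ℝ) < Fintype.card O := by exact_mod_cast Fintype.card_pos
  have hk1 : (1 : ℝ) ≤ Fintype.card O := by exact_mod_cast Fintype.card_pos
  have hw : (nwild x : ℝ) ≤ N := by exact_mod_cast nwild_le x
  have hqw : q * nwild x ≤ 1 / 2 := by nlinarith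
  have h1 : ∀ o : O, push (Sum.elim Sum.inl x) (muV O N q) (Sum.inl o) ^ 2 /
      baseL O (q * nwild x) (Sum.inl o) ≤
      2 * push (Sum.elim Sum.inl x) (muV O N q) (Sum.inl o) - baseL O (q * nwild x) (Sum.inl o)
        + 2 * Fintype.card O * (N ^ 2 * q ^ 2) := by
    intro o
    have hβ : 1 / (2 * Fintype.card O) ≤ baseL O (q * nwild x) (Sum.inl o) := by
      simp only [baseL, Sum.elim_inl]
      rw [div_le_div_iff₀ (by positivity) hk]
      nlinarith
    have hd : |push (Sum.elim Sum.inl x) (muV O N q) (Sum.inl o) -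
        baseL O (q * nwild x) (Sum.inl o)| ≤ N * q := by
      rw [push_inl]
      simp only [baseL, Sum.elim_inl]
      set c : ℝ := ((Finset.univ.filter fun j => x j = Sum.inl o).card : ℝ)
      have hc0 : 0 ≤ c := by positivity
      have hcN : c ≤ N := by
        have : (Finset.univ.filter fun j => x j = Sum.inl o).card ≤ N :=
          (Finset.card_filter_le _ _).trans (by simp)
        simp only [c]; exact_mod_cast this
      have e : (1 - N * q) / (Fintype.card O : ℝ) + q * c - (1 - q * nwild x) / (Fintype.card O : ℝ)
          = q * c - q * (N - nwild x) / (Fintype.card O : ℝ) := by ring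
      rw [e]
      have h0 : 0 ≤ q * (N - nwild x) / (Fintype.card O : ℝ) := by
        apply div_nonneg _ hk.le
        apply mul_nonneg hq; linarith
      have h2 : q * (N - nwild x) / (Fintype.card O : ℝ) ≤ N * q := by
        rw [div_le_iff₀ hk]
        have : (0 : ℝ) ≤ nwild x := by positivity
        have : 0 ≤ (N : ℝ) * q := by positivity
        nlinarith
      have h3 : q * c ≤ N * q := by nlinarith
      have h4 : 0 ≤ q * c := by positivity
      rw [abs_le]; constructor <;> linarith
    set P := push (Sum.elim Sum.inl x) (muV O N q) (Sum.inl o)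
    set b := baseL O (q * nwild x) (Sum.inl o)
    have hb0 : 0 < b := lt_of_lt_of_le (by positivity) hβ
    have : P ^ 2 / b = 2 * P - b + (P - b) ^ 2 / b := by field_simp; ring
    rw [this]
    have h5 : (P - b) ^ 2 ≤ N ^ 2 * q ^ 2 := by
      rw [← sq_abs, ← mul_pow]; exact pow_le_pow_left₀ (abs_nonneg _) hd 2
    have h6 : (P - b) ^ 2 / b ≤ 2 * Fintype.card O * (N ^ 2 * q ^ 2) := by
      rw [div_le_iff₀ hb0]
      have : 1 ≤ 2 * Fintype.card O * b := by
        rw [div_le_iff₀ (by positivity)] at hβ; linarith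
      nlinarith [sq_nonneg ((N : ℝ) * q)]
    linarith
  have h2 : ∑ t : Unit, push (Sum.elim Sum.inl x) (muV O N q) (Sum.inr t) ^ 2 /
      baseL O (q * nwild x) (Sum.inr t) =
      ∑ t : Unit, (2 * push (Sum.elim Sum.inl x) (muV O N q) (Sum.inr t) -
        baseL O (q * nwild x) (Sum.inr t)) := by
    simp only [Finset.univ_unique, Finset.sum_singleton]
    change push (Sum.elim Sum.inl x) (muV O N q) (Sum.inr ()) ^ 2 /
      baseL O (q * nwild x) (Sum.inr ()) = 2 * push (Sum.elim Sum.inl x) (muV O N q) (Sum.inr ()) -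
        baseL O (q * nwild x) (Sum.inr ())
    rw [push_inr]
    simp only [baseL, Sum.elim_inr]
    by_cases h : q * (nwild x : ℝ) = 0
    · simp [h]
    · rw [sq, mul_div_assoc, div_self h]; ring
  have h3 := Finset.sum_le_sum (fun o (_ : o ∈ Finset.univ) => h1 o)
  rw [h2]
  simp only [Finset.sum_add_distrib, Finset.sum_sub_distrib, ← Finset.mul_sum, Finset.sum_const,
    Finset.card_univ, nsmul_eq_mul] at h3 ⊢
  nlinarith [h3]

end corr

end GT

end

section

open Filter
open scoped BigOperators

namespace GT

set_option linter.unusedSectionVars false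
set_option linter.unusedSimpArgs false
set_option linter.unusedVariables false
set_option linter.deprecated false

section EWbasic
variable {ι S : Type} [Fintype ι] [DecidableEq ι] [Fintype S]

lemma EW_mono {μ : S → ℝ} (h0 : ∀ s, 0 ≤ μ s) {f g : (ι → S) → ℝ} (h : ∀ v, f v ≤ g v) :
    EW μ f ≤ EW μ g := by
  unfold EW
  apply Finset.sum_le_sum
  intro v _
  exact mul_le_mul_of_nonneg_left (h v) (Finset.prod_nonneg fun i _ => h0 _)

lemma EW_add (μ : S → ℝ) (f g : (ι → S) → ℝ) : EW μ (fun v => f v + g v) = EW μ f + EW μ g := by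
  simp only [EW, mul_add, Finset.sum_add_distrib]

lemma EW_const {μ : S → ℝ} (h : ∑ s, μ s = 1) (c : ℝ) : EW μ (fun _ : ι → S => c) = c := by
  unfold EW
  rw [← Finset.sum_mul, sum_wt, h]; simp

lemma EW_sum {I : Type} (μ : S → ℝ) (s : Finset I) (f : I → (ι → S) → ℝ) :
    EW μ (fun v => ∑ i ∈ s, f i v) = ∑ i ∈ s, EW μ (f i) := by
  simp only [EW, Finset.mul_sum]
  rw [Finset.sum_comm]

lemma EW_av {X : Type} [Fintype X] (μ : S → ℝ) (f : X → (ι → S) → ℝ) :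
    EW μ (fun v => av (fun x => f x v)) = av (fun x => EW μ (f x)) := by
  simp only [EW, av, Finset.sum_div, Finset.mul_sum]
  rw [Finset.sum_comm]
  simp only [mul_div_assoc]

lemma EW_unif [Nonempty S] (f : (ι → S) → ℝ) : EW (fun _ : S => 1 / (Fintype.card S : ℝ)) f = av f := by
  unfold EW wt av
  simp only [Finset.prod_const, ← Finset.mul_sum, Finset.card_univ, Fintype.card_fun]
  simp; ring

end EWbasic

section
variable {O : Type} [Fintype O] [DecidableEq O] [Nonempty O]
variable {ι : Type} [Fintype ι] [DecidableEq ι]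

lemma EW_base0 (f : (ι → O) → ℝ) (o : O) :
    EW (baseL O 0) (fun L : ι → O ⊕ Unit => f (ev L (fun _ => o))) = av f := by
  have : baseL O 0 = push Sum.inl (fun _ : O => 1 / (Fintype.card O : ℝ)) := by
    funext t
    cases t <;> simp [baseL, push]
  rw [this, ← EW_push, ← EW_unif]
  rfl

lemma line_close {N : ℕ} (x : Fin N → O ⊕ Unit) {q : ℝ} (hq : 0 ≤ q) (hNq : N * q ≤ 1 / 2)
    {g : (ι → O ⊕ Unit) → ℝ} (hg : ∀ v, |g v| ≤ 1) :
    (EW (muV O N q) (fun V => g (fun i => Sum.elim Sum.inl x (V i))) -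
      EW (baseL O (q * nwild x)) g) ^ 2 ≤
      (1 + 2 * (Fintype.card O) ^ 2 * N ^ 2 * q ^ 2) ^ Fintype.card ι - 1 := by
  rw [EW_push (Sum.elim Sum.inl x)]
  have hk : (0 : ℝ) < Fintype.card O := by exact_mod_cast Fintype.card_pos
  have hw : (nwild x : ℝ) ≤ N := by exact_mod_cast nwild_le x
  have hqw : q * nwild x ≤ 1 / 2 := by nlinarith
  apply EW_chi
  · intro t
    cases t with
    | inl o => simp only [baseL, Sum.elim_inl]; apply div_nonneg _ hk.le; linarith
    | inr o => simp only [baseL, Sum.elim_inr]; positivity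
  · intro t ht
    cases t with
    | inl o =>
      simp only [baseL, Sum.elim_inl] at ht
      exfalso
      have : 0 < (1 - q * (nwild x : ℝ)) / Fintype.card O := by apply div_pos _ hk; linarith
      linarith
    | inr o =>
      simp only [baseL, Sum.elim_inr] at ht
      have := push_inr x q
      rw [ht] at this
      exact this
  · rw [sum_push, sum_muV]
  · exact sum_baseL _
  · exact chi_bound x hq hNq
  · exact hg

lemma improper_bound (N : ℕ) {q : ℝ} (hq : 0 ≤ q) (hNq : N * q ≤ 1 / 2) :
    EW (muV O N q) (ind {V : ι → O ⊕ Fin N | ¬ Proper V}) ≤ N * (1 - q) ^ Fintype.card ι := by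
  classical
  have hk : (0 : ℝ) < Fintype.card O := by exact_mod_cast Fintype.card_pos
  have h0 : ∀ s, 0 ≤ muV O N q s := by
    intro s
    cases s with
    | inl o => simp only [muV, Sum.elim_inl]; apply div_nonneg _ hk.le; linarith
    | inr o => simpa only [muV, Sum.elim_inr] using hq
  have h1 : EW (muV O N q) (ind {V : ι → O ⊕ Fin N | ¬ Proper V}) ≤
      EW (muV O N q) (fun V => ∑ j : Fin N, ∏ i : ι, if V i = Sum.inr j then (0 : ℝ) else 1) := by
    apply EW_mono h0
    intro V
    have hnn : ∀ j : Fin N, 0 ≤ ∏ i : ι, if V i = Sum.inr j then (0 : ℝ) else 1 := by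
      intro j; apply Finset.prod_nonneg; intro i _; split_ifs <;> norm_num
    by_cases hV : Proper V
    · rw [ind_of_not_mem (by simpa using hV)]
      exact Finset.sum_nonneg fun j _ => hnn j
    · rw [ind_of_mem (by exact hV)]
      unfold Proper at hV
      push Not at hV
      obtain ⟨j, hj⟩ := hV
      have : (1 : ℝ) = ∏ i : ι, if V i = Sum.inr j then (0 : ℝ) else 1 := by
        rw [Finset.prod_eq_one]; intro i _; simp [hj i]
      refine le_trans (le_of_eq this) ?_
      exact Finset.single_le_sum (f := fun j => ∏ i : ι, if V i = Sum.inr j then (0 : ℝ) else 1)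
        (fun j _ => hnn j) (Finset.mem_univ j)
  refine h1.trans (le_of_eq ?_)
  rw [EW_sum]
  have : ∀ j : Fin N, EW (muV O N q) (fun V : ι → O ⊕ Fin N =>
      ∏ i : ι, if V i = Sum.inr j then (0 : ℝ) else 1) = (1 - q) ^ Fintype.card ι := by
    intro j
    unfold EW wt
    simp only [← Finset.prod_mul_distrib]
    rw [sum_prod_fun (fun _ s => muV O N q s * if s = Sum.inr j then (0 : ℝ) else 1)]
    simp only [Finset.prod_const, Finset.card_univ]
    congr 1
    have h2 := sum_muV (O := O) N q
    have h3 : ∀ s, muV O N q s * (if s = Sum.inr j then (0 : ℝ) else 1) =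
        muV O N q s - if s = Sum.inr j then q else 0 := by
      intro s
      split_ifs with h
      · subst h; simp [muV]
      · simp
    simp only [h3, Finset.sum_sub_distrib, h2]
    simp
  simp [this]

end

lemma exists_tau (C : ℝ) (hC : 0 < C) (ε : ℝ) (hε : 0 < ε) (N : ℕ) :
    ∃ n0 : ℕ, ∀ n ≥ n0, ∃ τ : ℝ, 0 < τ ∧ (1 + C * τ ^ 2) ^ n - 1 ≤ ε ^ 2 ∧
      N * (1 - τ) ^ n ≤ ε ∧ C * τ ≤ 1 / 2 ∧ τ ≤ 1 := by
  set c := Real.log (1 + ε ^ 2) / C with hc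
  have hlog : 0 < Real.log (1 + ε ^ 2) := Real.log_pos (by nlinarith)
  have hc0 : 0 < c := by positivity
  have t1 : Tendsto (fun n : ℕ => Real.sqrt (c / n)) atTop (nhds 0) := by
    have : Tendsto (fun n : ℕ => c / (n : ℝ)) atTop (nhds 0) :=
      tendsto_const_div_atTop_nhds_zero_nat c
    have := (Real.continuous_sqrt.tendsto 0).comp this
    rw [Real.sqrt_zero] at this
    exact this
  have t2 : Tendsto (fun n : ℕ => Real.sqrt (c * n)) atTop atTop := by
    apply Real.tendsto_sqrt_atTop.comp
    exact Tendsto.const_mul_atTop hc0 tendsto_natCast_atTop_atTop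
  have t3 : Tendsto (fun n : ℕ => N * Real.exp (- Real.sqrt (c * n))) atTop (nhds 0) := by
    have := (Real.tendsto_exp_atBot.comp (tendsto_neg_atTop_atBot.comp t2)).const_mul (N : ℝ)
    simpa using this
  have e1 := t1.eventually_lt_const (u := min 1 (1 / 2 / C)) (by positivity)
  have e2 := t3.eventually_lt_const (u := ε) hε
  obtain ⟨n0, hn0⟩ := eventually_atTop.mp (e1.and (e2.and (eventually_ge_atTop 1)))
  refine ⟨n0, fun n hn => ?_⟩
  obtain ⟨h1, h2, h3⟩ := hn0 n hn
  have hn' : (0 : ℝ) < n := by exact_mod_cast h3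
  set τ := Real.sqrt (c / n) with hτ
  have hτ0 : 0 < τ := Real.sqrt_pos.mpr (by positivity)
  have hτ2 : τ ^ 2 = c / n := Real.sq_sqrt (by positivity)
  have hτ1 : τ ≤ 1 := (lt_of_lt_of_le h1 (min_le_left _ _)).le
  have hnτ : n * τ = Real.sqrt (c * n) := by
    symm
    rw [Real.sqrt_eq_iff_mul_self_eq (by positivity) (by positivity)]
    have : n * τ * (n * τ) = n ^ 2 * τ ^ 2 := by ring
    rw [this, hτ2]; field_simp
  refine ⟨τ, hτ0, ?_, ?_, ?_, hτ1⟩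
  · have : (1 + C * τ ^ 2) ^ n ≤ Real.exp (C * τ ^ 2) ^ n := by
      gcongr
      linarith [Real.add_one_le_exp (C * τ ^ 2)]
    rw [← Real.exp_nat_mul, hτ2] at this
    have e : (n : ℝ) * (C * (c / n)) = Real.log (1 + ε ^ 2) := by
      rw [hc]; field_simp
    rw [e, Real.exp_log (by positivity)] at this
    rw [hτ2]; linarith
  · refine le_trans ?_ h2.le
    gcongr
    have : (1 - τ) ^ n ≤ Real.exp (-τ) ^ n := by
      apply pow_le_pow_left₀ (by linarith)
      linarith [Real.add_one_le_exp (-τ)]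
    rw [← Real.exp_nat_mul] at this
    rw [← hnτ]
    rw [mul_neg] at this; exact this
  · have := (lt_of_lt_of_le h1 (min_le_right _ _)).le
    rw [le_div_iff₀ hC] at this; linarith

/-- word with wildcards at `none` -/
def wd {α : Type} {N : ℕ} (x : Fin N → Option α) : Fin N → Option α ⊕ Unit :=
  fun j => (x j).elim (Sum.inr ()) (fun a => Sum.inl (some a))

/-- the `a`-point of a word -/
def pt {α ι : Type} (x : ι → Option α) (a : α) : ι → Option α := fun j => some ((x j).getD a)

lemma ev_wd {α ι : Type} {N : ℕ} (x : Fin N → Option α) (V : ι → Option α ⊕ Fin N) (a : α) :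
    ev (fun i => Sum.elim Sum.inl (wd x) (V i)) (fun _ => some a) = ev V (pt x a) := by
  funext i
  simp only [ev]
  cases V i with
  | inl o => simp
  | inr j => simp only [Sum.elim_inr, wd, pt]; cases x j <;> simp

end GT

end

section

open Filter
open scoped BigOperators

namespace GT

set_option linter.unusedSectionVars false
set_option linter.unusedSimpArgs false
set_option linter.unusedVariables false
set_option linter.deprecated false

lemma muV_nonneg {O : Type} [Fintype O] (N : ℕ) {q : ℝ} (hq : 0 ≤ q) (hNq : N * q ≤ 1 / 2) (s) :
    0 ≤ muV O N q s := by
  cases s with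
  | inl o => simp only [muV, Sum.elim_inl]; apply div_nonneg _ (by positivity); linarith
  | inr o => simpa only [muV, Sum.elim_inr] using hq

lemma ind_prod_abs {X I : Type} [Fintype I] (A : Set X) (F : I → X) : |∏ a, ind A (F a)| ≤ 1 := by
  rw [Finset.abs_prod]
  apply Finset.prod_le_one
  · intro i _; exact abs_nonneg _
  · intro i _; rw [abs_of_nonneg (ind_nonneg _ _)]; exact ind_le_one _ _

theorem corr {α : Type} [Fintype α] [DecidableEq α] [Nonempty α] (h : DHJ α) (δ : ℝ) (hδ : 0 < δ) :
    ∃ θ : ℝ, 0 < θ ∧ ∀ N : ℕ, ∀ ε : ℝ, 0 < ε → ∃ n0 : ℕ, ∀ (ι : Type) [Fintype ι] [DecidableEq ι],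
      n0 ≤ Fintype.card ι → ∀ A : Set (ι → Option α), δ ≤ av (ind A) →
      ∃ P : (ι → Option α ⊕ Fin N) → ℝ, (∀ V, 0 ≤ P V) ∧ ∑ V, P V = 1 ∧
        ∑ V, P V * ind {V | ¬ Proper V} V ≤ ε ∧
        av (ind A) - ε ≤ ∑ V, P V * av (fun x => ind A (ev V x)) ∧
        θ ≤ ∑ V, P V * av (fun x : Fin N → Option α => ∏ a, ind A (ev V (pt x a))) := by
  obtain ⟨l, hl⟩ := h (δ / 4) (by positivity)
  set k : ℝ := ((Fintype.card (Option α) : ℕ) : ℝ) with hk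
  set K : ℝ := ((Fintype.card (Fin l → Option α) : ℕ) : ℝ) with hK
  have hK1 : 1 ≤ K := by
    rw [hK]; exact_mod_cast Fintype.card_pos
  have hk1 : 1 ≤ k := by
    rw [hk]; exact_mod_cast Fintype.card_pos
  refine ⟨δ / (16 * K), by positivity, ?_⟩
  intro N ε hε
  set D : ℕ := (N + 1) * (l + 1) with hD
  have hD1 : (1 : ℝ) ≤ D := by rw [hD]; exact_mod_cast Nat.succ_le_of_lt (by positivity)
  set e := min ε (δ / (16 * K)) with he
  have he0 : 0 < e := by positivity
  obtain ⟨n0, hn0⟩ := exists_tau (2 * k ^ 2 * D ^ 2) (by positivity) e he0 N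
  refine ⟨n0, ?_⟩
  intro ι _ _ hι A hA
  obtain ⟨τ, hτ0, hτ1, hτ2, hτ3, hτ4⟩ := hn0 _ hι
  have hDC : (D : ℝ) ≤ 2 * k ^ 2 * D ^ 2 := by
    have : (1 : ℝ) ≤ 2 * k ^ 2 * D := by nlinarith [mul_le_mul hk1 hk1 (by norm_num) (by positivity)]
    nlinarith
  have hNq : ∀ N' r : ℕ, N' * r ≤ D → (N' : ℝ) * (τ * r) ≤ 1 / 2 := by
    intro N' r hr
    have : ((N' * r : ℕ) : ℝ) ≤ D := by exact_mod_cast hr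
    push_cast at this
    nlinarith
  have close : ∀ (N' r : ℕ) (x : Fin N' → Option α ⊕ Unit) (g : (ι → Option α ⊕ Unit) → ℝ),
      N' * r ≤ D → (∀ v, |g v| ≤ 1) →
      |EW (muV (Option α) N' (τ * r)) (fun V => g (fun i => Sum.elim Sum.inl x (V i))) -
        EW (baseL (Option α) (τ * r * nwild x)) g| ≤ e := by
    intro N' r x g hr hg
    apply abs_le_of_sq_le_sq _ he0.le
    refine (line_close x (by positivity) (hNq N' r hr) hg).trans (le_trans ?_ hτ1)
    gcongr (?_) ^ _ - 1
    have : ((N' * r : ℕ) : ℝ) ≤ D := by exact_mod_cast hr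
    push_cast at this
    have h2 : ((N' : ℝ) * r) ^ 2 ≤ D ^ 2 := by gcongr
    have : 2 * (k : ℝ) ^ 2 * N' ^ 2 * (τ * r) ^ 2 = 2 * k ^ 2 * ((N' : ℝ) * r) ^ 2 * τ ^ 2 := by ring
    rw [← hk, this]
    gcongr
  set f := ind A with hf
  have hpt : ∀ (N' r : ℕ) (y : Fin N' → Option α), N' * r ≤ D →
      |EW (muV (Option α) N' (τ * r)) (fun V : ι → Option α ⊕ Fin N' => f (ev V y)) - av f| ≤ e := by
    intro N' r y hr
    have h1 := close N' r (fun j => Sum.inl (y j)) (fun L => f (ev L (fun _ => none))) hr (by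
      intro v; rw [abs_of_nonneg (ind_nonneg _ _)]; exact ind_le_one _ _)
    have h2 : nwild (fun j => (Sum.inl (y j) : Option α ⊕ Unit)) = 0 := by simp [nwild]
    rw [h2, Nat.cast_zero, mul_zero, EW_base0] at h1
    convert h1 using 4
    funext V
    congr 1
    funext i
    simp only [ev]
    cases V i <;> simp
  set ln : (ι → Option α ⊕ Unit) → ℝ := fun L => ∏ a, f (ev L (fun _ => some a)) with hln
  have hln1 : ∀ v, |ln v| ≤ 1 := fun v => ind_prod_abs A _
  have hln0 : ∀ v, 0 ≤ ln v := fun v => Finset.prod_nonneg fun a _ => ind_nonneg _ _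
  set F : Finset (Fin l → Option α) := Finset.univ.filter (fun z => ∃ j, z j = none) with hF
  have hFK : (F.card : ℝ) ≤ K := by
    rw [hK]; exact_mod_cast Finset.card_filter_le _ _
  have hA' : ∀ r : ℕ, r ≤ N → δ / 8 ≤ ∑ z ∈ F, EW (baseL (Option α) (τ * r * nwild (wd z))) ln := by
    intro r hr
    have hrD : l * r ≤ D := by rw [hD]; nlinarith
    have h1 : δ - e ≤ EW (muV (Option α) l (τ * r)) (fun V : ι → Option α ⊕ Fin l =>
        av (fun y : Fin l → α => f (ev V (fun j => some (y j))))) := by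
      rw [EW_av]
      apply le_av_of_le
      intro y
      have := hpt l r (fun j => some (y j)) hrD
      rw [abs_le] at this
      linarith [this.1]
    have h2 : EW (muV (Option α) l (τ * r)) (fun V : ι → Option α ⊕ Fin l =>
        av (fun y : Fin l → α => f (ev V (fun j => some (y j))))) ≤
        EW (muV (Option α) l (τ * r)) (fun V : ι → Option α ⊕ Fin l =>
          δ / 4 + ∑ z ∈ F, ln (fun i => Sum.elim Sum.inl (wd z) (V i))) := by
      apply EW_mono (muV_nonneg l (by positivity) (hNq l r hrD))
      intro V
      have hs0 : ∀ z, 0 ≤ ln (fun i => Sum.elim Sum.inl (wd z) (V i)) := fun z => hln0 _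
      by_cases hV : δ / 4 ≤ av (fun y : Fin l → α => f (ev V (fun j => some (y j))))
      · obtain ⟨L, hL, hL'⟩ := hl (Fin l) (by simp) {y | ev V (fun j => some (y j)) ∈ A} hV
        have h3 : av (fun y : Fin l → α => f (ev V (fun j => some (y j)))) ≤ 1 := by
          apply av_le_of_le zero_le_one; intro y; exact ind_le_one _ _
        set z : Fin l → Option α := fun j => Sum.elim some (fun _ => none) (L j) with hz
        have hzF : z ∈ F := by
          rw [hF, Finset.mem_filter]
          obtain ⟨j, hj⟩ := hL ()
          exact ⟨Finset.mem_univ _, j, by simp [hz, hj]⟩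
        have h4 : ln (fun i => Sum.elim Sum.inl (wd z) (V i)) = 1 := by
          simp only [hln, ev_wd]
          apply Finset.prod_eq_one
          intro a _
          rw [hf]
          apply ind_of_mem
          have := hL' (fun _ => a)
          simp only [Set.mem_setOf_eq] at this
          convert this using 2
          funext j
          simp only [pt, hz, ev]
          cases L j <;> simp
        have h5 := Finset.single_le_sum
          (f := fun z => ln (fun i => Sum.elim Sum.inl (wd z) (V i))) (fun z _ => hs0 z) hzF
        simp only [h4] at h5
        linarith
      · push Not at hV
        have := Finset.sum_nonneg (fun z (_ : z ∈ F) => hs0 z)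
        linarith
    rw [EW_add, EW_const (sum_muV _ _), EW_sum] at h2
    have h3 : ∑ z ∈ F, EW (muV (Option α) l (τ * r)) (fun V : ι → Option α ⊕ Fin l =>
        ln (fun i => Sum.elim Sum.inl (wd z) (V i))) ≤
        ∑ z ∈ F, (EW (baseL (Option α) (τ * r * nwild (wd z))) ln + e) := by
      apply Finset.sum_le_sum
      intro z _
      have := close l r (wd z) ln hrD hln1
      rw [abs_le] at this
      linarith [this.2]
    rw [Finset.sum_add_distrib, Finset.sum_const, nsmul_eq_mul] at h3
    have h4 : e ≤ δ / (16 * K) := min_le_right _ _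
    have h5 : (F.card : ℝ) * e ≤ δ / 16 := by
      calc (F.card : ℝ) * e ≤ K * (δ / (16 * K)) := by gcongr
        _ = δ / 16 := by field_simp
    have h6 : e ≤ δ / 16 := by
      refine h4.trans ?_
      gcongr; linarith
    linarith
  -- pigeonhole over z
  have hB : δ / 8 ≤ ∑ z ∈ F, av (fun x : Fin N → Option α =>
      EW (baseL (Option α) (τ * nwild (wd x) * nwild (wd z))) ln) := by
    rw [← av_sum]
    apply le_av_of_le
    intro x
    exact hA' _ (nwild_le _)
  have hpig : ∃ z ∈ F, δ / (8 * K) ≤ av (fun x : Fin N → Option α =>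
      EW (baseL (Option α) (τ * nwild (wd x) * nwild (wd z))) ln) := by
    by_contra hcon
    push Not at hcon
    have h1 : F.Nonempty := by
      by_contra hne
      rw [Finset.not_nonempty_iff_eq_empty] at hne
      rw [hne, Finset.sum_empty] at hB; linarith
    have h2 := Finset.sum_lt_sum_of_nonempty h1 hcon
    rw [Finset.sum_const, nsmul_eq_mul] at h2
    have : (F.card : ℝ) * (δ / (8 * K)) ≤ δ / 8 := by
      calc (F.card : ℝ) * (δ / (8 * K)) ≤ K * (δ / (8 * K)) := by gcongr
        _ = δ / 8 := by field_simp
    linarith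
  obtain ⟨z, hzF, hz⟩ := hpig
  set r := nwild (wd z) with hr
  have hrl : r ≤ l := nwild_le _
  have hr1 : 1 ≤ r := by
    rw [hF, Finset.mem_filter] at hzF
    obtain ⟨-, j, hj⟩ := hzF
    rw [hr]
    unfold nwild
    apply Finset.card_pos.mpr
    exact ⟨j, Finset.mem_filter.mpr ⟨Finset.mem_univ _, by simp [wd, hj]⟩⟩
  have hNr : N * r ≤ D := by rw [hD]; nlinarith
  refine ⟨wt (muV (Option α) N (τ * r)), ?_, ?_, ?_, ?_, ?_⟩
  · intro V
    exact Finset.prod_nonneg fun i _ => muV_nonneg N (by positivity) (hNq N r hNr) _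
  · rw [sum_wt, sum_muV, one_pow]
  · change EW (muV (Option α) N (τ * r)) (ind {V | ¬ Proper V}) ≤ ε
    refine (improper_bound N (by positivity) (hNq N r hNr)).trans ?_
    rcases Nat.eq_zero_or_pos N with hN | hN
    · subst hN; simp [hε.le]
    refine le_trans ?_ (hτ2.trans (min_le_left _ _))
    have h1 : (1 : ℝ) ≤ r := by exact_mod_cast hr1
    have hN1 : (1 : ℝ) ≤ N := by exact_mod_cast hN
    have h2 := hNq N r hNr
    have h3 : 0 ≤ 1 - τ * r := by
      have : 0 ≤ τ * r := by positivity
      nlinarith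
    gcongr
    nlinarith
  · change av f - ε ≤ EW (muV (Option α) N (τ * r)) (fun V => av (fun x => f (ev V x)))
    rw [EW_av]
    apply le_av_of_le
    intro y
    have := hpt N r y hNr
    rw [abs_le] at this
    linarith [this.1, min_le_left ε (δ / (16 * K))]
  · change δ / (16 * K) ≤ EW (muV (Option α) N (τ * r))
      (fun V => av (fun x : Fin N → Option α => ∏ a, f (ev V (pt x a))))
    rw [EW_av]
    have h1 : av (fun x : Fin N → Option α =>
      EW (baseL (Option α) (τ * nwild (wd x) * nwild (wd z))) ln) ≤
      av (fun x : Fin N → Option α => EW (muV (Option α) N (τ * r))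
        (fun V : ι → Option α ⊕ Fin N => ∏ a, f (ev V (pt x a))) + e) := by
      apply av_mono
      intro x
      have := close N r (wd x) ln hNr hln1
      rw [abs_le] at this
      simp only [hln, ev_wd] at this
      have e1 : τ * nwild (wd x) * nwild (wd z) = τ * r * nwild (wd x) := by rw [hr]; ring
      rw [e1]
      linarith [this.1]
    rw [av_add, av_const] at h1
    have h2 : e ≤ δ / (16 * K) := min_le_right _ _
    have h3 : δ / (8 * K) = δ / (16 * K) + δ / (16 * K) := by field_simp; norm_num
    linarith

end GT

end

section

open Filter
open scoped BigOperators

namespace GT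

set_option linter.unusedSectionVars false
set_option linter.unusedSimpArgs false
set_option linter.unusedVariables false
set_option linter.deprecated false

/-- composition of variable words -/
def cmp {ι κ κ' O : Type} (V : ι → O ⊕ κ) (W : κ → O ⊕ κ') : ι → O ⊕ κ' :=
  fun i => Sum.elim Sum.inl W (V i)

lemma ev_cmp {ι κ κ' O : Type} (V : ι → O ⊕ κ) (W : κ → O ⊕ κ') (z : κ' → O) :
    ev (cmp V W) z = ev V (ev W z) := by
  funext i
  simp only [ev, cmp]
  cases V i <;> simp [ev]

lemma proper_cmp {ι κ κ' O : Type} {V : ι → O ⊕ κ} {W : κ → O ⊕ κ'} (hV : Proper V) (hW : Proper W) :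
    Proper (cmp V W) := by
  intro j
  obtain ⟨i, hi⟩ := hW j
  obtain ⟨i', hi'⟩ := hV i
  exact ⟨i', by simp [cmp, hi', hi]⟩

lemma ev_injective {ι κ O : Type} {V : ι → O ⊕ κ} (hV : Proper V) : Function.Injective (ev V) := by
  intro z z' h
  funext j
  obtain ⟨i, hi⟩ := hV j
  have := congrFun h i
  simpa [ev, hi] using this

/-- insensitivity between `none` and `some a` on the coordinates in `J` -/
def Ins {ι α : Type} (a : α) (J : Set ι) (D : Set (ι → Option α)) : Prop :=
  ∀ x y : ι → Option α, (∀ i, i ∉ J → x i = y i) → (∀ i, i ∈ J → (x i).getD a = (y i).getD a) →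
    (x ∈ D ↔ y ∈ D)

section mix
variable {α : Type} [Fintype α] [DecidableEq α] [Nonempty α]
variable {ι : Type} [Fintype ι] [DecidableEq ι]

/-- mixing -/
def mixd (x : ι → Option α) (y : ι → α) : ι → Option α :=
  fun i => if x i = none then none else some (y i)

lemma av_mixd (f : (ι → Option α) → ℝ) :
    av (fun x : ι → Option α => av (fun y : ι → α => f (mixd x y))) = av f := by
  rw [← av_prod (fun p : (ι → Option α) × (ι → α) => f (mixd p.1 p.2)),
    av_equiv (Equiv.arrowProdEquivProdArrow ι (fun _ => Option α) (fun _ => α)), ← EW_unif]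
  change EW _ (fun v : ι → Option α × α =>
    f (fun i => (fun s : Option α × α => if s.1 = none then none else some s.2) (v i))) = _
  rw [EW_push (fun s : Option α × α => if s.1 = none then none else some s.2), ← EW_unif]
  congr 1
  funext t
  have hc : (0 : ℝ) < Fintype.card α := by exact_mod_cast Fintype.card_pos
  unfold push
  rw [Fintype.sum_prod_type, Fintype.sum_option]
  cases t with
  | none => simp
  | some a => simp

lemma few_some (n' : ℕ) :
    av (ind {x : ι → Option α | (Finset.univ.filter (fun i => x i ≠ none)).card < n'}) ≤
      2 ^ n' * (((Fintype.card α : ℝ) + 2) / (2 * ((Fintype.card α : ℝ) + 1))) ^ Fintype.card ι := by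
  have h1 : av (ind {x : ι → Option α | (Finset.univ.filter (fun i => x i ≠ none)).card < n'}) ≤
      av (fun x : ι → Option α => 2 ^ n' * ∏ i, if x i = none then (1 : ℝ) else 1 / 2) := by
    apply av_mono
    intro x
    have hp : (∏ i, if x i = none then (1 : ℝ) else 1 / 2) =
        (1 / 2) ^ (Finset.univ.filter (fun i => x i ≠ none)).card := by
      rw [Finset.prod_ite]; simp
    rw [hp]
    by_cases hx : (Finset.univ.filter (fun i => x i ≠ none)).card < n'
    · rw [ind_of_mem (by exact hx)]
      have : (1 : ℝ) = 2 ^ n' * (1 / 2) ^ n' := by rw [← mul_pow]; norm_num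
      refine le_trans (le_of_eq this) ?_
      gcongr 2 ^ n' * ?_
      exact pow_le_pow_of_le_one (by norm_num) (by norm_num) hx.le
    · rw [ind_of_not_mem (by exact hx)]; positivity
  refine h1.trans (le_of_eq ?_)
  rw [av_mul_left, ← EW_unif]
  congr 1
  unfold EW wt
  simp only [← Finset.prod_mul_distrib]
  rw [sum_prod_fun (fun _ s => 1 / (Fintype.card (Option α) : ℝ) * if s = none then (1 : ℝ) else 1 / 2)]
  simp only [Finset.prod_const, Finset.card_univ, Fintype.sum_option]
  congr 1
  simp
  field_simp
  ring

lemma no_none : av (ind {x : ι → Option α | ∀ i, x i ≠ none}) ≤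
      ((Fintype.card α : ℝ) / ((Fintype.card α : ℝ) + 1)) ^ Fintype.card ι := by
  have h1 : av (ind {x : ι → Option α | ∀ i, x i ≠ none}) ≤
      av (fun x : ι → Option α => ∏ i, if x i = none then (0 : ℝ) else 1) := by
    apply av_mono
    intro x
    by_cases hx : ∀ i, x i ≠ none
    · rw [ind_of_mem (by exact hx), Finset.prod_eq_one]; intro i _; simp [hx i]
    · rw [ind_of_not_mem (by exact hx)]
      apply Finset.prod_nonneg; intro i _; split_ifs <;> norm_num
  refine h1.trans (le_of_eq ?_)
  rw [← EW_unif]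
  unfold EW wt
  simp only [← Finset.prod_mul_distrib]
  rw [sum_prod_fun (fun _ s => 1 / (Fintype.card (Option α) : ℝ) * if s = none then (0 : ℝ) else 1)]
  simp only [Finset.prod_const, Finset.card_univ, Fintype.sum_option]
  congr 1
  simp
  field_simp

end mix

lemma av_mixd_sub {α : Type} [Fintype α] [DecidableEq α] [Nonempty α]
    {ι : Type} [Fintype ι] [DecidableEq ι] (f : (ι → Option α) → ℝ) (x : ι → Option α) :
    av (fun y : ι → α => f (mixd x y)) = av (fun u : {i // x i ≠ none} → α =>
      f (fun i => if h : x i ≠ none then some (u ⟨i, h⟩) else none)) := by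
  rw [av_glue (fun i => x i ≠ none)]
  have : ∀ (c : {i // ¬ (x i ≠ none)} → α) (u : {i // x i ≠ none} → α),
      f (mixd x (glue (fun i => x i ≠ none) u c)) =
      f (fun i => if h : x i ≠ none then some (u ⟨i, h⟩) else none) := by
    intro c u
    congr 1
    funext i
    simp only [mixd, glue]
    by_cases h : x i = none <;> simp [h]
  simp only [this]
  rw [av_const]

theorem ins_mdhj {α : Type} [Fintype α] [DecidableEq α] [Nonempty α] (h : MDHJ α) (m : ℕ) (ε : ℝ)
    (hε : 0 < ε) : ∃ n0 : ℕ, ∀ (ι : Type) [Fintype ι] [DecidableEq ι], n0 ≤ Fintype.card ι →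
      ∀ (a : α) (D : Set (ι → Option α)), Ins a Set.univ D → ε ≤ av (ind D) →
      ∃ V : ι → Option α ⊕ Fin m, Proper V ∧ ∀ z, ev V z ∈ D := by
  obtain ⟨n', hn'⟩ := h m (ε / 2) (by positivity)
  set ρ : ℝ := ((Fintype.card α : ℝ) + 2) / (2 * ((Fintype.card α : ℝ) + 1)) with hρ
  have hc : (0 : ℝ) < Fintype.card α := by exact_mod_cast Fintype.card_pos
  have hρ0 : 0 ≤ ρ := by positivity
  have hρ1 : ρ < 1 := by rw [hρ, div_lt_one (by positivity)]; linarith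
  have t : Tendsto (fun n : ℕ => 2 ^ n' * ρ ^ n) atTop (nhds 0) := by
    have := (tendsto_pow_atTop_nhds_zero_of_lt_one hρ0 hρ1).const_mul ((2 : ℝ) ^ n')
    simpa using this
  obtain ⟨n0, hn0⟩ := eventually_atTop.mp (t.eventually_lt_const (u := ε / 2) (by positivity))
  refine ⟨n0, ?_⟩
  intro ι _ _ hι a D hD hDε
  have h1 := (few_some (α := α) (ι := ι) n').trans_lt (hn0 _ hι)
  rw [← av_mixd] at hDε
  have h2 := av_markov (f := fun x : ι → Option α => av (fun y : ι → α => ind D (mixd x y)))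
    (fun x => av_le_of_le zero_le_one (fun y => ind_le_one _ _)) hε.le hDε
  have hex : ∃ x : ι → Option α, ε / 2 ≤ av (fun y : ι → α => ind D (mixd x y)) ∧
      n' ≤ (Finset.univ.filter (fun i => x i ≠ none)).card := by
    by_contra hcon
    push Not at hcon
    have : av (ind {x : ι → Option α | ε / 2 ≤ av (fun y : ι → α => ind D (mixd x y))}) ≤
        av (ind {x : ι → Option α | (Finset.univ.filter (fun i => x i ≠ none)).card < n'}) := by
      apply av_mono
      intro x
      by_cases hx : ε / 2 ≤ av (fun y : ι → α => ind D (mixd x y))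
      · rw [ind_of_mem (by exact hx), ind_of_mem (by exact hcon x hx)]
      · rw [ind_of_not_mem (by exact hx)]; exact ind_nonneg _ _
    linarith
  obtain ⟨x, hx1, hx2⟩ := hex
  rw [av_mixd_sub] at hx1
  obtain ⟨V, hV, hV'⟩ := hn' {i // x i ≠ none} (by rw [Fintype.card_subtype]; exact hx2)
    {u | (fun i => if h : x i ≠ none then some (u ⟨i, h⟩) else none) ∈ D} hx1
  refine ⟨fun i => if h : x i ≠ none then Sum.map some id (V ⟨i, h⟩) else Sum.inl none, ?_, ?_⟩
  · intro j
    obtain ⟨i, hi⟩ := hV j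
    refine ⟨i.1, ?_⟩
    simp [i.2, hi]
  · intro z
    have := hV' (fun j => (z j).getD a)
    simp only [Set.mem_setOf_eq] at this
    refine (hD _ _ (fun i hi => absurd (Set.mem_univ i) hi) (fun i _ => ?_)).mp this
    simp only [ev]
    by_cases hi : x i = none
    · simp [hi]
    · simp only [ne_eq, hi, not_false_eq_true, dite_true]
      cases V ⟨i, hi⟩ <;> simp

end GT

end

section

open Filter
open scoped BigOperators

namespace GT

set_option linter.unusedSectionVars false
set_option linter.unusedSimpArgs false
set_option linter.unusedVariables false
set_option linter.deprecated false

lemma sum_ind_range {Z U : Type} [Fintype Z] [Fintype U] {e : Z → U} (he : Function.Injective e)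
    (G : U → ℝ) : ∑ u, G u * ind (Set.range e) u = ∑ z, G (e z) := by
  classical
  have h1 : ∀ u, G u * ind (Set.range e) u = if u ∈ Finset.univ.image e then G u else 0 := by
    intro u
    by_cases hu : u ∈ Set.range e
    · rw [ind_of_mem hu, if_pos (by simpa using hu), mul_one]
    · rw [ind_of_not_mem hu, if_neg (by simpa using hu), mul_zero]
  simp only [h1]
  rw [← Finset.sum_filter, Finset.filter_mem_eq_inter, Finset.univ_inter,
    Finset.sum_image (fun _ _ _ _ h => he h)]

lemma av_sum_div {X : Type} [Fintype X] (f : X → ℝ) : av f = (∑ x, f x) / Fintype.card X := rfl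

lemma glue_res {ι α : Type} (p : ι → Prop) [DecidablePred p] (x : ι → α) :
    glue p (fun i : {i // p i} => x i) (fun i : {i // ¬ p i} => x i) = x := by
  funext i; simp only [glue]; split_ifs <;> rfl

lemma res_glue1 {ι α : Type} (p : ι → Prop) [DecidablePred p] (u : {i // p i} → α)
    (c : {i // ¬ p i} → α) : (fun i : {i // p i} => glue p u c i) = u := by
  funext i; simp [glue, i.2]

lemma res_glue2 {ι α : Type} (p : ι → Prop) [DecidablePred p] (u : {i // p i} → α)
    (c : {i // ¬ p i} → α) : (fun i : {i // ¬ p i} => glue p u c i) = c := by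
  funext i; simp [glue, i.2]

lemma exists_split_in {ι : Type} [Fintype ι] [DecidableEq ι] (J : Finset ι) {M n' : ℕ}
    (h : M + n' ≤ J.card) :
    ∃ (p : ι → Prop) (_ : DecidablePred p), Fintype.card {i // p i} = M ∧ (∀ i, p i → i ∈ J) ∧
      n' ≤ (J.filter (fun i => ¬ p i)).card := by
  obtain ⟨B, hBJ, hB⟩ := exists_block J (M := M) (by omega)
  refine ⟨fun i => i ∈ B, inferInstance, ?_, fun i hi => hBJ hi, ?_⟩
  · rw [Fintype.card_subtype]; simp [hB]
  · have : J.filter (fun i => i ∉ B) = J \ B := by ext; simp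
    rw [this, Finset.card_sdiff_of_subset hBJ]
    omega

theorem single {α : Type} [Fintype α] [DecidableEq α] [Nonempty α] (h : MDHJ α) (m : ℕ) (ε : ℝ)
    (hε : 0 < ε) : ∃ n0 : ℕ, ∀ (ι : Type) [Fintype ι] [DecidableEq ι], n0 ≤ Fintype.card ι →
      ∀ (a : α) (D : Set (ι → Option α)), Ins a Set.univ D →
      ∀ F : (ι → Option α) → ℝ, (∀ x, F x ≤ 1) →
      (∀ V : ι → Option α ⊕ Fin m, Proper V → av (fun z => F (ev V z)) ≤ 0) →
      av (fun x => F x * ind D x) ≤ 2 * ε := by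
  obtain ⟨n1, hn1⟩ := ins_mdhj h m ε hε
  set kk : ℝ := (((Fintype.card (Option α)) ^ n1 : ℕ) : ℝ) with hkk
  have hkk0 : 0 < kk := by
    rw [hkk]; exact_mod_cast Nat.pow_pos Fintype.card_pos
  set ε' : ℝ := ε / kk with hε'
  have hε'0 : 0 < ε' := by positivity
  obtain ⟨T0, hT0⟩ := exists_nat_gt (1 / ε')
  refine ⟨T0 * n1, ?_⟩
  intro ι _ _ hι a D hD F hF1 hFV
  have claim : ∀ T : ℕ, ∀ J : Finset ι, ∀ D : Set (ι → Option α), T * n1 ≤ J.card →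
      Ins a (J : Set ι) D → av (ind D) ≤ 2 * ε + T * ε' → av (fun x => F x * ind D x) ≤ 2 * ε := by
    intro T
    induction T with
    | zero =>
      intro J D _ _ hd
      simp only [Nat.cast_zero, zero_mul, add_zero] at hd
      refine le_trans (av_mono (g := ind D) ?_) hd
      intro x
      nlinarith [ind_nonneg D x, hF1 x]
    | succ T ih =>
      intro J D hJ hI hd
      by_cases hsmall : av (ind D) ≤ 2 * ε
      · refine le_trans (av_mono (g := ind D) ?_) hsmall
        intro x
        nlinarith [ind_nonneg D x, hF1 x]
      push Not at hsmall
      obtain ⟨p, _, hpc, hpJ, hJ'⟩ := exists_split_in J (M := n1) (n' := T * n1) (by linarith)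
      have hch : ∀ S : Set ({i // p i} → Option α), ∃ V : {i // p i} → Option α ⊕ Fin m,
          Ins a Set.univ S → ε ≤ av (ind S) → Proper V ∧ ∀ z, ev V z ∈ S := by
        intro S
        by_cases hS : Ins a Set.univ S ∧ ε ≤ av (ind S)
        · obtain ⟨V, hV⟩ := hn1 {i // p i} (by rw [hpc]) a S hS.1 hS.2
          exact ⟨V, fun _ _ => hV⟩
        · exact ⟨fun _ => Sum.inl none, fun h1 h2 => absurd ⟨h1, h2⟩ hS⟩
      choose Vc hVc using hch
      set sl : ({i // ¬ p i} → Option α) → Set ({i // p i} → Option α) :=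
        fun c => {u | glue p u c ∈ D} with hsl
      have hslI : ∀ c, Ins a Set.univ (sl c) := by
        intro c x y _ hxy
        refine hI _ _ ?_ ?_
        · intro i hi
          have : ¬ p i := fun h => hi (hpJ i h)
          simp [glue, this]
        · intro i hi
          by_cases hpi : p i
          · simpa [glue, hpi] using hxy ⟨i, hpi⟩ (Set.mem_univ _)
          · simp [glue, hpi]
      set R : Set (ι → Option α) := {x | ε ≤ av (ind (sl (fun i => x i))) ∧
        (fun i : {i // p i} => x i) ∈ Set.range (ev (Vc (sl (fun i => x i))))} with hR
      have hRg : ∀ u c, glue p u c ∈ R ↔ (ε ≤ av (ind (sl c)) ∧ u ∈ Set.range (ev (Vc (sl c)))) := by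
        intro u c
        rw [hR, Set.mem_setOf_eq, res_glue1, res_glue2]
      have hRD : R ⊆ D := by
        intro x hx
        rw [← glue_res p x, hRg] at hx
        obtain ⟨h1, z, hz⟩ := hx
        have := (hVc _ (hslI _) h1).2 z
        rw [hz] at this
        have h2 : glue p (fun i : {i // p i} => x i) (fun i : {i // ¬ p i} => x i) ∈ D := this
        rwa [glue_res] at h2
      have hindD : ∀ x, ind D x = ind (D \ R) x + ind R x := by
        intro x
        by_cases hxR : x ∈ R
        · rw [ind_of_mem (hRD hxR), ind_of_mem hxR, ind_of_not_mem (fun h => h.2 hxR)]; norm_num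
        · by_cases hxD : x ∈ D
          · rw [ind_of_mem hxD, ind_of_not_mem hxR, ind_of_mem (show x ∈ D \ R from ⟨hxD, hxR⟩)]; norm_num
          · rw [ind_of_not_mem hxD, ind_of_not_mem hxR, ind_of_not_mem (fun h => hxD h.1)]; norm_num
      have hFR : av (fun x => F x * ind R x) ≤ 0 := by
        rw [av_glue p]
        apply av_le_of_le le_rfl
        intro c
        by_cases hc : ε ≤ av (ind (sl c))
        · obtain ⟨hp, hz⟩ := hVc _ (hslI c) hc
          have e1 : ∀ u, ind R (glue p u c) = ind (Set.range (ev (Vc (sl c)))) u := by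
            intro u
            by_cases hu : u ∈ Set.range (ev (Vc (sl c)))
            · rw [ind_of_mem hu, ind_of_mem ((hRg u c).mpr ⟨hc, hu⟩)]
            · rw [ind_of_not_mem hu, ind_of_not_mem (fun h => hu ((hRg u c).mp h).2)]
          simp only [e1]
          rw [av_sum_div, sum_ind_range (ev_injective hp) (fun u => F (glue p u c))]
          apply div_nonpos_of_nonpos_of_nonneg _ (by positivity)
          have h1 := hFV (fun i => if hi : p i then Vc (sl c) ⟨i, hi⟩ else Sum.inl (c ⟨i, hi⟩)) (by
            intro j
            obtain ⟨i, hi⟩ := hp j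
            exact ⟨i.1, by simp [i.2, hi]⟩)
          have e2 : ∀ z, ev (fun i => if hi : p i then Vc (sl c) ⟨i, hi⟩ else Sum.inl (c ⟨i, hi⟩)) z =
              glue p (ev (Vc (sl c)) z) c := by
            intro z; funext i
            by_cases hi : p i <;> simp [ev, glue, hi]
          simp only [e2] at h1
          rw [av_sum_div] at h1
          have hcz : (0 : ℝ) < Fintype.card (Fin m → Option α) := by exact_mod_cast Fintype.card_pos
          by_contra hcon
          push Not at hcon
          have := div_pos hcon hcz
          linarith
        · have e1 : ∀ u, ind R (glue p u c) = 0 := by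
            intro u
            exact ind_of_not_mem (fun h => hc ((hRg u c).mp h).1)
          simp [e1, av]
      have hRε : ε' ≤ av (ind R) := by
        have hs2 := hsmall.le
        rw [av_glue p] at hs2 ⊢
        have hmk := av_markov (f := fun c => av (fun u => ind D (glue p u c)))
          (fun c => av_le_of_le zero_le_one (fun u => ind_le_one _ _)) (by positivity) hs2
        have e0 : 2 * ε / 2 = ε := by ring
        rw [e0] at hmk
        have : av (fun c => ind {c | ε ≤ av (fun u => ind D (glue p u c))} c * (1 / kk)) ≤
            av (fun c => av (fun u => ind R (glue p u c))) := by
          apply av_mono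
          intro c
          by_cases hc : ε ≤ av (fun u => ind D (glue p u c))
          · rw [ind_of_mem (by exact hc), one_mul]
            have hc' : ε ≤ av (ind (sl c)) := hc
            have hcard : (Fintype.card ({i // p i} → Option α) : ℝ) = kk := by
              rw [Fintype.card_fun, hpc]
            rw [av_sum_div, hcard]
            gcongr
            set u0 := ev (Vc (sl c)) (fun _ => none)
            have : ind R (glue p u0 c) = 1 := ind_of_mem ((hRg u0 c).mpr ⟨hc', ⟨_, rfl⟩⟩)
            rw [← this]
            exact Finset.single_le_sum (f := fun u => ind R (glue p u c))
              (fun u _ => ind_nonneg _ _) (Finset.mem_univ u0)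
          · rw [ind_of_not_mem (by exact hc), zero_mul]
            exact av_nonneg (fun u => ind_nonneg _ _)
        rw [av_mul_right] at this
        have h3 : ε * (1 / kk) ≤ av (ind {c | ε ≤ av (fun u => ind D (glue p u c))}) * (1 / kk) := by
          gcongr
        rw [hε', div_eq_mul_one_div]
        linarith
      have hdens : av (ind D) = av (ind (D \ R)) + av (ind R) := by
        rw [← av_add]; congr 1; funext x; exact hindD x
      have hFD : av (fun x => F x * ind D x) =
          av (fun x => F x * ind (D \ R) x) + av (fun x => F x * ind R x) := by
        rw [← av_add]; congr 1; funext x; rw [hindD x]; ring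
      rw [hFD]
      have := ih (J.filter (fun i => ¬ p i)) (D \ R) hJ' ?_ ?_
      · linarith
      · intro x y h1 h2
        have hxp : ∀ i, p i → x i = y i := fun i hi => h1 i (by simp [hi])
        have hxyJ : ∀ i, i ∈ J → (x i).getD a = (y i).getD a := by
          intro i hi
          by_cases hpi : p i
          · rw [hxp i hpi]
          · exact h2 i (by simp [hi, hpi])
        have hnJ : ∀ i, i ∉ J → x i = y i := fun i hi => h1 i (by simp [hi])
        have hD1 : x ∈ D ↔ y ∈ D := hI x y (fun i hi => hnJ i hi) (fun i hi => hxyJ i hi)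
        have hsl1 : sl (fun i => x i) = sl (fun i => y i) := by
          ext u
          refine hI _ _ ?_ ?_
          · intro i hi
            by_cases hpi : p i
            · simp [glue, hpi]
            · simpa [glue, hpi] using hnJ i hi
          · intro i hi
            by_cases hpi : p i
            · simp [glue, hpi]
            · simpa [glue, hpi] using hxyJ i hi
        have hres : (fun i : {i // p i} => x i) = (fun i : {i // p i} => y i) := by
          funext i; exact hxp i i.2
        have hR1 : x ∈ R ↔ y ∈ R := by
          rw [hR, Set.mem_setOf_eq, Set.mem_setOf_eq, hsl1, hres]
        rw [Set.mem_diff, Set.mem_diff, hD1, hR1]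
      · push_cast at hd
        linarith
  refine claim T0 Finset.univ D (by rw [Finset.card_univ]; exact hι) (by simpa using hD) ?_
  have h1 : av (ind D) ≤ 1 := av_le_of_le zero_le_one (fun x => ind_le_one _ _)
  rw [div_lt_iff₀ hε'0] at hT0
  linarith

theorem multi {α : Type} [Fintype α] [DecidableEq α] [Nonempty α] (h : MDHJ α) (s : Finset α) :
    ∀ (m : ℕ) (ε : ℝ), 0 < ε → ∃ n0 : ℕ, ∀ (ι : Type) [Fintype ι] [DecidableEq ι],
      n0 ≤ Fintype.card ι →
      ∀ (D : α → Set (ι → Option α)), (∀ a ∈ s, Ins a Set.univ (D a)) →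
      ∀ F : (ι → Option α) → ℝ, (∀ x, F x ≤ 1) →
      (∀ V : ι → Option α ⊕ Fin m, Proper V → av (fun z => F (ev V z)) ≤ 0) →
      av (fun x => F x * ∏ a ∈ s, ind (D a) x) ≤ ε := by
  induction s using Finset.induction_on with
  | empty =>
    intro m ε hε
    obtain ⟨n0, hn0⟩ := single h m (ε / 2) (by positivity)
    refine ⟨n0, ?_⟩
    intro ι _ _ hι D hD F hF hV
    have := hn0 ι hι (Classical.arbitrary α) Set.univ (fun _ _ _ _ => by simp) F hF hV
    simp [ind] at this ⊢
    linarith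
  | insert a s has ih =>
    intro m ε hε
    obtain ⟨m', hm'⟩ := ih m (ε / 2) (by positivity)
    obtain ⟨n0, hn0⟩ := single h m' (ε / 4) (by positivity)
    refine ⟨n0, ?_⟩
    intro ι _ _ hι D hD F hF hV
    have hP0 : ∀ x, 0 ≤ ∏ b ∈ s, ind (D b) x := fun x => Finset.prod_nonneg fun b _ => ind_nonneg _ _
    have hP1 : ∀ x, ∏ b ∈ s, ind (D b) x ≤ 1 := fun x =>
      Finset.prod_le_one (fun b _ => ind_nonneg _ _) (fun b _ => ind_le_one _ _)
    have h1 := hn0 ι hι a (D a) (hD a (Finset.mem_insert_self _ _))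
      (fun x => F x * ∏ b ∈ s, ind (D b) x - ε / 2) (by
        intro x
        have h1 := hP0 x
        have h2 := hP1 x
        have h3 := hF x
        nlinarith) (by
        intro V hVp
        rw [av_sub, av_const]
        have := hm' (Fin m') (by simp) (fun b => {z | ev V z ∈ D b}) (by
          intro b hb x y _ hxy
          refine hD b (Finset.mem_insert_of_mem hb) _ _ (fun i hi => absurd (Set.mem_univ i) hi) ?_
          intro i _
          simp only [ev]
          cases V i with
          | inl o => simp
          | inr j => simpa using hxy j (Set.mem_univ j)) (fun z => F (ev V z)) (fun z => hF _) (by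
          intro W hW
          have := hV (cmp V W) (proper_cmp hVp hW)
          simpa only [ev_cmp] using this)
        have h2 : av (fun z => F (ev V z) * ∏ b ∈ s, ind (D b) (ev V z)) ≤ ε / 2 := this
        linarith)
    simp only [sub_mul] at h1
    rw [av_sub, av_mul_left] at h1
    have h2 : av (ind (D a)) ≤ 1 := av_le_of_le zero_le_one (fun x => ind_le_one _ _)
    have h3 : av (fun x => F x * ∏ b ∈ insert a s, ind (D b) x) =
        av (fun x => F x * (∏ b ∈ s, ind (D b) x) * ind (D a) x) := by
      congr 1; funext x; rw [Finset.prod_insert has]; ring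
    rw [h3]
    nlinarith

end GT

end

section

open Filter
open scoped BigOperators

namespace GT

set_option linter.unusedSectionVars false
set_option linter.unusedSimpArgs false
set_option linter.unusedVariables false
set_option linter.deprecated false

/-- DHJ at a fixed density -/
def Pd (O : Type) [Fintype O] (δ : ℝ) : Prop := ∃ n0 : ℕ, ∀ (ι : Type) [Fintype ι]
  [DecidableEq ι], n0 ≤ Fintype.card ι → ∀ A : Set (ι → O), δ ≤ av (ind A) →
  ∃ V : ι → O ⊕ Unit, Proper V ∧ ∀ z, ev V z ∈ A

lemma Pd_mono {O : Type} [Fintype O] {δ δ' : ℝ} (h : δ ≤ δ') (hP : Pd O δ) : Pd O δ' := by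
  obtain ⟨n0, hn0⟩ := hP
  exact ⟨n0, fun ι _ _ hι A hA => hn0 ι hι A (h.trans hA)⟩

set_option maxHeartbeats 2000000 in
theorem pd_step {α : Type} [Fintype α] [DecidableEq α] [Nonempty α] (h : DHJ α) (δ : ℝ) (hδ : 0 < δ)
    (hup : ∀ η : ℝ, 0 < η → Pd (Option α) (δ + η)) : ∃ η : ℝ, 0 < η ∧ η < δ ∧ Pd (Option α) (δ - η) := by
  obtain ⟨θ0, hθ0, hcorr⟩ := corr h (δ / 2) (by positivity)
  set θ := min θ0 1 with hθ
  have hθp : 0 < θ := by positivity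
  have hθ1 : θ ≤ 1 := min_le_right _ _
  set Q : ℝ := (2 : ℝ) ^ Fintype.card α with hQ
  have hQ0 : 0 < Q := by positivity
  set η : ℝ := min (θ / 4) (min (δ / 2) (δ * θ ^ 2 / 400)) with hη
  have hηp : 0 < η := by positivity
  have hη1 : η ≤ θ / 4 := min_le_left _ _
  have hη2 : η ≤ δ / 2 := (min_le_right _ _).trans (min_le_left _ _)
  have hη3 : η ≤ δ * θ ^ 2 / 400 := (min_le_right _ _).trans (min_le_right _ _)
  obtain ⟨m0, hm0⟩ := hup η hηp
  have hmulti := multi (mdhj_of_dhj h) (Finset.univ : Finset α) m0 (δ * θ / (16 * Q)) (by positivity)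
  obtain ⟨N1, hN1⟩ := hmulti
  have hc : (0 : ℝ) < Fintype.card α := by exact_mod_cast Fintype.card_pos
  have t : Tendsto (fun n : ℕ => ((Fintype.card α : ℝ) / ((Fintype.card α : ℝ) + 1)) ^ n) atTop
      (nhds 0) := by
    apply tendsto_pow_atTop_nhds_zero_of_lt_one (by positivity)
    rw [div_lt_one (by positivity)]; linarith
  obtain ⟨N2, hN2⟩ := eventually_atTop.mp
    (t.eventually_lt_const (u := δ * θ / 16) (by positivity))
  set N := max m0 (max N1 N2) with hN
  obtain ⟨n0, hn0⟩ := hcorr N η hηp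
  refine ⟨η, hηp, by linarith, n0, ?_⟩
  intro ι _ _ hι A hA
  by_contra hfree
  obtain ⟨P, hP0, hP1, hPimp, hPA, hPD⟩ := hn0 ι hι A (by linarith)
  have hle : ∀ V : ι → Option α ⊕ Fin N, Proper V → av (fun x => ind A (ev V x)) < δ + η := by
    intro V hV
    by_contra hcon
    push Not at hcon
    obtain ⟨L, hL, hL'⟩ := hm0 (Fin N) (by simp [hN]) {x | ev V x ∈ A} hcon
    exact hfree ⟨cmp V L, proper_cmp hV hL, fun z => by rw [ev_cmp]; exact hL' z⟩
  set dD : (ι → Option α ⊕ Fin N) → ℝ := fun V =>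
    av (fun x : Fin N → Option α => ∏ a, ind A (ev V (pt x a))) with hdD
  set dA : (ι → Option α ⊕ Fin N) → ℝ := fun V => av (fun x => ind A (ev V x)) with hdA
  set lam : ℝ := θ / (16 * η) with hlam
  have hlam0 : 0 < lam := by positivity
  have hlamη : lam * η = θ / 16 := by rw [hlam]; field_simp
  have hexV : ∃ V, θ / 2 ≤ dD V + lam * (dA V - (δ + η)) - (1 + lam) * ind {V | ¬ Proper V} V := by
    by_contra hcon
    push Not at hcon
    have h1 : ∑ V, P V * (dD V + lam * (dA V - (δ + η)) - (1 + lam) * ind {V | ¬ Proper V} V)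
        ≤ ∑ V, P V * (θ / 2) := by
      apply Finset.sum_le_sum
      intro V _
      exact mul_le_mul_of_nonneg_left (hcon V).le (hP0 V)
    rw [← Finset.sum_mul, hP1, one_mul] at h1
    have e1 : ∑ V, P V * (dD V + lam * (dA V - (δ + η)) - (1 + lam) * ind {V | ¬ Proper V} V) =
        ∑ V, P V * dD V + lam * (∑ V, P V * dA V - (δ + η) * ∑ V, P V) -
          (1 + lam) * ∑ V, P V * ind {V | ¬ Proper V} V := by
      simp only [Finset.mul_sum, ← Finset.sum_sub_distrib, ← Finset.sum_add_distrib]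
      apply Finset.sum_congr rfl
      intro V _; ring
    rw [e1, hP1, mul_one] at h1
    have h2 : θ ≤ θ0 := min_le_left _ _
    have h3 : lam * (-(3 * η)) ≤ lam * (∑ V, P V * dA V - (δ + η)) := by
      apply mul_le_mul_of_nonneg_left _ hlam0.le
      linarith
    have h4 : (1 + lam) * ∑ V, P V * ind {V | ¬ Proper V} V ≤ (1 + lam) * η := by
      apply mul_le_mul_of_nonneg_left hPimp; linarith
    have h5 : lam * (-(3 * η)) = - (3 * θ / 16) := by rw [← mul_one (lam * _)]; linarith
    have h6 : (1 + lam) * η = η + θ / 16 := by rw [add_mul, hlamη, one_mul]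
    have h7 : ∑ V, P V * dD V ≥ θ0 := hPD
    -- strictness
    have hneq : η + θ / 16 + 3 * θ / 16 ≤ θ / 2 := by linarith
    have hcon' : ∃ V, P V ≠ 0 := by
      by_contra hz; push Not at hz; simp [hz] at hP1
    obtain ⟨V0, hV0⟩ := hcon'
    have h8 : ∑ V, P V * (dD V + lam * (dA V - (δ + η)) - (1 + lam) * ind {V | ¬ Proper V} V)
        < ∑ V, P V * (θ / 2) := by
      apply Finset.sum_lt_sum
      · intro V _
        exact mul_le_mul_of_nonneg_left (hcon V).le (hP0 V)
      · exact ⟨V0, Finset.mem_univ _, mul_lt_mul_of_pos_left (hcon V0)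
          (lt_of_le_of_ne (hP0 V0) (Ne.symm hV0))⟩
    rw [← Finset.sum_mul, hP1, one_mul, e1, hP1, mul_one] at h8
    linarith
  obtain ⟨V, hV⟩ := hexV
  have hdD1 : dD V ≤ 1 := by
    apply av_le_of_le zero_le_one
    intro x
    exact (abs_le.mp (ind_prod_abs A _)).2
  have hdA1 : dA V ≤ 1 := av_le_of_le zero_le_one (fun x => ind_le_one _ _)
  have hproper : Proper V := by
    by_contra hcon
    rw [ind_of_mem (by exact hcon)] at hV
    nlinarith
  rw [ind_of_not_mem (by simpa using hproper), mul_zero, sub_zero] at hV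
  have hVA := hle V hproper
  have hDθ : θ / 2 ≤ dD V := by
    have : lam * (dA V - (δ + η)) ≤ 0 := mul_nonpos_of_nonneg_of_nonpos hlam0.le (by
      change dA V - (δ + η) ≤ 0
      have : dA V < δ + η := hVA
      linarith)
    linarith
  have hAV : δ - 16 * η / θ ≤ dA V := by
    have h1 : lam * (δ + η - dA V) ≤ 1 := by nlinarith
    have h2 : δ + η - dA V ≤ 16 * η / θ := by
      rw [le_div_iff₀ hθp]
      have : lam * (δ + η - dA V) * (16 * η) = θ * (δ + η - dA V) := by rw [hlam]; field_simp
      nlinarith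
    linarith
  -- pass to the subspace
  set B : Set (Fin N → Option α) := {x | ev V x ∈ A} with hB
  set Da : α → Set (Fin N → Option α) := fun a => {x | pt x a ∈ B} with hDa
  have hIns : ∀ a, Ins a Set.univ (Da a) := by
    intro a x y _ hxy
    have : pt x a = pt y a := by
      funext i; simp only [pt]; rw [hxy i (Set.mem_univ i)]
    simp only [hDa, Set.mem_setOf_eq, this]
  have hInsC : ∀ a, Ins a Set.univ (Da a)ᶜ := by
    intro a x y h1 h2
    rw [Set.mem_compl_iff, Set.mem_compl_iff, hIns a x y h1 h2]
  set F : (Fin N → Option α) → ℝ := fun x => ind B x - (δ + η) with hF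
  have hF1 : ∀ x, F x ≤ 1 := by
    intro x; simp only [hF]; linarith [ind_le_one B x]
  have hFV : ∀ W : Fin N → Option α ⊕ Fin m0, Proper W → av (fun z => F (ev W z)) ≤ 0 := by
    intro W hW
    simp only [hF]
    rw [av_sub, av_const]
    by_contra hcon
    push Not at hcon
    obtain ⟨L, hL, hL'⟩ := hm0 (Fin m0) (by simp) {x | ev W x ∈ B} (by
      change δ + η ≤ av (fun x => ind B (ev W x))
      linarith)
    exact hfree ⟨cmp V (cmp W L), proper_cmp hproper (proper_cmp hW hL), fun z => by
      rw [ev_cmp, ev_cmp]; exact hL' z⟩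
  have hT : ∀ T : Finset α, av (fun x => F x * ∏ a, ind (if a ∈ T then (Da a)ᶜ else Da a) x) ≤
      δ * θ / (16 * Q) := by
    intro T
    apply hN1 (Fin N) (by simp [hN]) (fun a => if a ∈ T then (Da a)ᶜ else Da a) _ F hF1 hFV
    intro a _
    by_cases ha : a ∈ T
    · simpa [ha] using hInsC a
    · simpa [ha] using hIns a
  classical
  set D : Set (Fin N → Option α) := {x | ∀ a, x ∈ Da a} with hD
  have hsum : ∀ x, ∑ T ∈ (Finset.univ : Finset (Finset α)).erase ∅,
      ∏ a, ind (if a ∈ T then (Da a)ᶜ else Da a) x = 1 - ind D x := by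
    intro x
    have h1 : ∀ T : Finset α, ∏ a, ind (if a ∈ T then (Da a)ᶜ else Da a) x =
        if T = Finset.univ.filter (fun a => x ∉ Da a) then 1 else 0 := by
      intro T
      split_ifs with hTx
      · apply Finset.prod_eq_one
        intro a _
        apply ind_of_mem
        by_cases ha : x ∈ Da a
        · rw [if_neg]; exact ha
          rw [hTx]; simp [ha]
        · rw [if_pos]; exact ha
          rw [hTx]; simp [ha]
      · have : ∃ a, ¬ (a ∈ T ↔ x ∉ Da a) := by
          by_contra hcon; push Not at hcon
          apply hTx; ext a; simp [hcon a]
        obtain ⟨a, ha⟩ := this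
        apply Finset.prod_eq_zero (Finset.mem_univ a)
        apply ind_of_not_mem
        by_cases haT : a ∈ T
        · rw [if_pos haT]; intro hx; exact ha ⟨fun _ => hx, fun _ => haT⟩
        · rw [if_neg haT]; intro hx; exact ha ⟨fun h => absurd h haT, fun h => absurd hx h⟩
    simp only [h1]
    rw [Finset.sum_ite_eq']
    by_cases hx : x ∈ D
    · rw [ind_of_mem hx, if_neg]
      · norm_num
      · have : Finset.univ.filter (fun a => x ∉ Da a) = ∅ := by
          ext a; simp; exact hx a
        simp [this]
    · rw [ind_of_not_mem hx, if_pos]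
      · norm_num
      · rw [Finset.mem_erase]
        refine ⟨?_, Finset.mem_univ _⟩
        intro he
        apply hx
        intro a
        by_contra ha
        have : a ∈ Finset.univ.filter (fun a => x ∉ Da a) := by simp [ha]
        rw [he] at this
        simp at this
  have hupper : av (fun x => F x * (1 - ind D x)) ≤ δ * θ / 16 := by
    simp only [← hsum, Finset.mul_sum]
    rw [av_sum]
    calc _ ≤ ∑ T ∈ (Finset.univ : Finset (Finset α)).erase ∅, δ * θ / (16 * Q) :=
          Finset.sum_le_sum fun T _ => hT T
      _ ≤ ∑ T ∈ (Finset.univ : Finset (Finset α)), δ * θ / (16 * Q) := by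
          apply Finset.sum_le_sum_of_subset_of_nonneg (Finset.erase_subset _ _)
          intros; positivity
      _ = δ * θ / 16 := by
          rw [Finset.sum_const, Finset.card_univ, Fintype.card_finset, nsmul_eq_mul]
          push_cast
          rw [← hQ]; field_simp
  have hDd : av (ind D) = dD V := by
    simp only [hdD]
    congr 1
    funext x
    by_cases hx : x ∈ D
    · rw [ind_of_mem hx]; symm
      apply Finset.prod_eq_one
      intro a _
      exact ind_of_mem (hx a)
    · rw [ind_of_not_mem hx]; symm
      have : ∃ a, x ∉ Da a := by by_contra hcon; push Not at hcon; exact hx hcon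
      obtain ⟨a, ha⟩ := this
      exact Finset.prod_eq_zero (Finset.mem_univ a) (ind_of_not_mem ha)
  have hBd : av (ind B) = dA V := rfl
  have hBD : ∀ x, x ∈ B → x ∈ D → ∀ i, x i ≠ none := by
    intro x hxB hxD i hi
    apply hfree
    refine ⟨cmp V (wd x), proper_cmp hproper (fun j => ⟨i, by simp [wd, hi]⟩), ?_⟩
    intro z
    rw [ev_cmp]
    cases hz : z () with
    | none =>
      have : ev (wd x) z = x := by
        funext j
        simp only [ev, wd]
        cases hj : x j with
        | none => simpa using hz
        | some b => simp
      rw [this]; exact hxB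
    | some a =>
      have : ev (wd x) z = pt x a := by
        funext j
        simp only [ev, wd, pt]
        cases hj : x j with
        | none => simpa using hz
        | some b => simp
      rw [this]; exact hxD a
  have hlow : av (ind B) - av (ind {x : Fin N → Option α | ∀ i, x i ≠ none}) -
      (δ + η) * (1 - av (ind D)) ≤ av (fun x => F x * (1 - ind D x)) := by
    have h1 : av (fun x => ind B x - ind {x : Fin N → Option α | ∀ i, x i ≠ none} x -
        (δ + η) * (1 - ind D x)) ≤ av (fun x => F x * (1 - ind D x)) := by
      apply av_mono
      intro x
      simp only [hF]
      have hnn := ind_nonneg {x : Fin N → Option α | ∀ i, x i ≠ none} x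
      by_cases hxD : x ∈ D
      · rw [ind_of_mem hxD]
        by_cases hxB : x ∈ B
        · have : x ∈ {x : Fin N → Option α | ∀ i, x i ≠ none} := hBD x hxB hxD
          rw [ind_of_mem hxB, ind_of_mem this]; norm_num
        · rw [ind_of_not_mem hxB]; linarith
      · rw [ind_of_not_mem hxD]; linarith
    rw [av_sub, av_sub, av_mul_left, av_sub, av_const] at h1
    exact h1
  have hnone := (no_none (α := α) (ι := Fin N)).trans_lt (hN2 _ (by simp [hN]))
  rw [hBd, hDd] at hlow
  have hηθ : 16 * η / θ ≤ δ * θ / 25 := by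
    rw [div_le_iff₀ hθp]; nlinarith
  have hηδ : η ≤ δ * θ / 400 := by nlinarith [mul_pos hδ hθp]
  have h9 : (δ + η) * (1 - dD V) ≤ (δ + η) * (1 - θ / 2) := by
    apply mul_le_mul_of_nonneg_left _ (by positivity); linarith
  nlinarith [mul_pos hδ hθp, mul_pos hηp hθp]

theorem dhj_step {α : Type} [Fintype α] [Nonempty α] (h : DHJ α) : DHJ (Option α) := by
  classical
  by_contra hcon
  have : ∃ δ1 : ℝ, 0 < δ1 ∧ ¬ Pd (Option α) δ1 := by
    by_contra hc
    push Not at hc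
    exact hcon hc
  obtain ⟨δ1, hδ1, hn⟩ := this
  set S : Set ℝ := {δ | Pd (Option α) δ} with hS
  have hlb : ∀ δ ∈ S, δ1 ≤ δ := by
    intro δ hδ
    by_contra hc
    push Not at hc
    exact hn (Pd_mono hc.le hδ)
  have h2 : (2 : ℝ) ∈ S := by
    refine ⟨0, fun ι _ _ _ A hA => ?_⟩
    have : av (ind A) ≤ 1 := av_le_of_le zero_le_one (fun x => ind_le_one _ _)
    linarith
  have hbdd : BddBelow S := ⟨δ1, hlb⟩
  have hge : δ1 ≤ sInf S := le_csInf ⟨2, h2⟩ hlb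
  obtain ⟨η, hη, -, hP⟩ := pd_step h (sInf S) (by linarith) (by
    intro η hη
    obtain ⟨δ, hδ, hlt⟩ := exists_lt_of_csInf_lt ⟨2, h2⟩ (show sInf S < sInf S + η by linarith)
    exact Pd_mono hlt.le hδ)
  have := csInf_le hbdd (show sInf S - η ∈ S from hP)
  linarith

lemma dhj_one {α : Type} [Fintype α] [Subsingleton α] : DHJ α := by
  intro δ hδ
  refine ⟨1, ?_⟩
  intro ι _ _ hι A hA
  obtain ⟨x, hx⟩ := exists_mem_of_av_ind_pos (lt_of_lt_of_le hδ hA)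
  have hne : Nonempty ι := Fintype.card_pos_iff.mp (by omega)
  refine ⟨fun _ => Sum.inr (), fun j => ⟨hne.some, rfl⟩, fun z => ?_⟩
  rwa [Subsingleton.elim (ev _ z) x]

lemma dhj_equiv {α β : Type} [Fintype α] [Fintype β] (e : α ≃ β) (h : DHJ α) : DHJ β := by
  intro δ hδ
  obtain ⟨n0, hn0⟩ := h δ hδ
  refine ⟨n0, fun ι _ _ hι A hA => ?_⟩
  obtain ⟨V, hV, hV'⟩ := hn0 ι hι {x | (fun i => e (x i)) ∈ A} (by
    refine hA.trans (le_of_eq ?_)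
    rw [av_equiv (Equiv.piCongrRight (fun _ : ι => e)) (ind A)]
    rfl)
  refine ⟨fun i => Sum.map e id (V i), ?_, ?_⟩
  · intro j
    obtain ⟨i, hi⟩ := hV j
    exact ⟨i, by simp [hi]⟩
  · intro z
    have := hV' (fun j => e.symm (z j))
    simp only [Set.mem_setOf_eq] at this
    convert this using 1
    funext i
    simp only [ev]
    cases V i <;> simp

/-- The density Hales-Jewett theorem. -/
theorem dhj_fin (k : ℕ) : DHJ (Fin (k + 1)) := by
  induction k with
  | zero =>
    haveI : Subsingleton (Fin (0 + 1)) := inferInstanceAs (Subsingleton (Fin 1))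
    exact dhj_one
  | succ k ih => exact dhj_equiv (finSuccEquiv (k + 1)).symm (dhj_step ih)

end GT

end

section

open Filter
open scoped BigOperators

namespace GT

set_option linter.unusedSectionVars false
set_option linter.unusedSimpArgs false
set_option linter.unusedVariables false
set_option linter.deprecated false

/-! ## Part 2: Szemeredi's theorem in averaged form -/

theorem varn (κ : ℕ) (δ : ℝ) (hδ : 0 < δ) : ∃ c : ℝ, 0 < c ∧ ∃ L : ℕ, 1 ≤ L ∧
    ∀ (G : Type) [CommRing G] [Fintype G] (g : G → ℝ), (∀ x, 0 ≤ g x) → (∀ x, g x ≤ 1) →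
    δ ≤ av g → ∀ t : G, ∃ i : ℕ, 1 ≤ i ∧ i ≤ L ∧
      c ≤ av (fun n => ∏ j : Fin (κ + 1), g (n + ((j : ℕ) * i : ℕ) * t)) := by
  obtain ⟨n0, hn0⟩ := dhj_fin κ (δ / 4) (by positivity)
  set L := max n0 1 with hL
  have hL1 : 1 ≤ L := le_max_right _ _
  set c0 : ℝ := δ / 4 / (Fintype.card (Fin L × Fin ((κ + 1) * L + 1)) : ℝ) with hc0
  have hcard : (0 : ℝ) < (Fintype.card (Fin L × Fin ((κ + 1) * L + 1)) : ℝ) := by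
    have : 0 < Fintype.card (Fin L × Fin ((κ + 1) * L + 1)) := by
      simp only [Fintype.card_prod, Fintype.card_fin]
      exact Nat.mul_pos hL1 (by omega)
    exact_mod_cast this
  refine ⟨c0 * (δ / 2) ^ (κ + 1), by positivity, L, hL1, ?_⟩
  intro G _ _ g hg0 hg1 hav t
  set A : Set G := {x | δ / 2 ≤ g x} with hA
  have hAd : δ / 2 ≤ av (ind A) := av_markov hg1 hδ.le hav
  set F : G → ℝ := fun a => av (fun w : Fin L → Fin (κ + 1) =>
    ind A (a + ((∑ i, (w i : ℕ) : ℕ) : G) * t)) with hF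
  have hFav : δ / 2 ≤ av F := by
    simp only [hF]
    rw [av_comm]
    apply le_av_of_le
    intro w
    refine hAd.trans (le_of_eq ?_)
    exact av_equiv (Equiv.addRight (((∑ i, (w i : ℕ) : ℕ) : G) * t)) (ind A)
  have hF1 : ∀ a, F a ≤ 1 := fun a => av_le_of_le zero_le_one (fun w => ind_le_one _ _)
  have hgood := av_markov hF1 (by positivity) hFav
  set S : Fin L × Fin ((κ + 1) * L + 1) → Set G := fun p =>
    {a | ∀ j : Fin (κ + 1), (a + ((p.2 : ℕ) : G) * t) + ((j : ℕ) * ((p.1 : ℕ) + 1) : ℕ) * t ∈ A} with hS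
  obtain ⟨p, hp⟩ := av_pigeon (I := Fin L × Fin ((κ + 1) * L + 1)) (S := S) (c := δ / 4)
    (by positivity) (by convert hgood using 1; ring) (by
    intro a ha
    obtain ⟨V, hV, hV'⟩ := hn0 (Fin L) (by simp [hL]) {w | a + ((∑ i, (w i : ℕ) : ℕ) : G) * t ∈ A} (by
      have : δ / 2 / 2 ≤ F a := ha
      refine le_trans (by linarith) this)
    set nw : ℕ := ∑ i, Sum.elim (fun _ => 0) (fun _ => 1) (V i) with hnw
    set bs : ℕ := ∑ i, Sum.elim (fun b : Fin (κ + 1) => (b : ℕ)) (fun _ => 0) (V i) with hbs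
    have h1 : 1 ≤ nw := by
      obtain ⟨i, hi⟩ := hV ()
      calc 1 = Sum.elim (fun _ => 0) (fun _ => 1) (V i) := by rw [hi]; rfl
        _ ≤ nw := Finset.single_le_sum (f := fun i => Sum.elim (fun _ => 0) (fun _ => 1) (V i))
            (fun _ _ => Nat.zero_le _) (Finset.mem_univ i)
    have h2 : nw ≤ L := by
      calc nw ≤ ∑ i : Fin L, 1 := by
            apply Finset.sum_le_sum; intro i _
            cases V i <;> simp
        _ = L := by simp
    have h3 : bs ≤ (κ + 1) * L := by
      calc bs ≤ ∑ i : Fin L, (κ + 1) := by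
            apply Finset.sum_le_sum; intro i _
            cases V i with
            | inl b => simp only [Sum.elim_inl]; exact b.2.le
            | inr _ => simp
        _ = (κ + 1) * L := by simp [mul_comm]
    refine ⟨(⟨nw - 1, by omega⟩, ⟨bs, by omega⟩), ?_⟩
    intro j
    have := hV' (fun _ => j)
    have e : (∑ i, ((ev V (fun _ => j) i : Fin (κ + 1)) : ℕ)) = bs + j * nw := by
      rw [hbs, hnw, Finset.mul_sum, ← Finset.sum_add_distrib]
      apply Finset.sum_congr rfl
      intro i _
      simp only [ev]
      cases V i <;> simp
    simp only [Set.mem_setOf_eq, e] at this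
    have h4 : nw - 1 + 1 = nw := by omega
    simp only [h4]
    convert this using 1
    push_cast; ring)
  refine ⟨(p.1 : ℕ) + 1, by omega, by have := p.1.2; omega, ?_⟩
  have h1 : av (ind (S p)) * (δ / 2) ^ (κ + 1) ≤
      av (fun n => ∏ j : Fin (κ + 1), g (n + ((j : ℕ) * ((p.1 : ℕ) + 1) : ℕ) * t)) := by
    rw [← av_mul_right, av_equiv (Equiv.addRight (((p.2 : ℕ) : G) * t))
      (fun n => ∏ j : Fin (κ + 1), g (n + ((j : ℕ) * ((p.1 : ℕ) + 1) : ℕ) * t))]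
    apply av_mono
    intro a
    by_cases ha : a ∈ S p
    · rw [ind_of_mem ha, one_mul]
      calc (δ / 2) ^ (κ + 1) = ∏ j : Fin (κ + 1), (δ / 2) := by
            rw [Finset.prod_const, Finset.card_univ, Fintype.card_fin]
        _ ≤ _ := by
          apply Finset.prod_le_prod
          · intros; positivity
          · intro j _
            exact ha j
    · rw [ind_of_not_mem ha, zero_mul]
      exact Finset.prod_nonneg fun j _ => hg0 _
  refine le_trans ?_ h1
  gcongr

/-- the linear forms -/
def psi {κ M : ℕ} (j : Fin (κ + 1)) (x : Fin (κ + 1) → Fin M) : ℤ :=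
  ∑ i : Fin (κ + 1), (((i : ℕ) : ℤ) - ((j : ℕ) : ℤ)) * (((x i : ℕ) : ℤ) + 1)

theorem szem (κ : ℕ) (δ : ℝ) (hδ : 0 < δ) : ∃ c : ℝ, 0 < c ∧ ∃ M0 : ℕ, 1 ≤ M0 ∧
    ∀ (G : Type) [CommRing G] [Fintype G] (g : G → ℝ), (∀ x, 0 ≤ g x) → (∀ x, g x ≤ 1) →
    δ ≤ av g → ∀ M : ℕ, M0 ≤ M →
      c ≤ av (fun n : G => av (fun x : Fin (κ + 1) → Fin M =>
        ∏ j : Fin (κ + 1), g (n + ((psi j x : ℤ) : G)))) := by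
  obtain ⟨c, hc, L, hL, hv⟩ := varn κ δ hδ
  set K := κ + 1 with hK
  have hKr : (0 : ℝ) < K := by rw [hK]; positivity
  have hLr : (0 : ℝ) < L := by exact_mod_cast hL
  refine ⟨(1 / (4 * L * K)) ^ K * (K * c / L), by positivity, 2 * L * K, by
    have : 0 < L * K := Nat.mul_pos hL (by omega)
    nlinarith, ?_⟩
  intro G _ _ g hg0 hg1 hav M hM
  set Φ : ℕ → ℝ := fun s => av (fun n => ∏ j : Fin (κ + 1), g (n + ((j : ℕ) : G) * (-(s : G)))) with hΦ
  have hΦ0 : ∀ s, 0 ≤ Φ s := fun s => av_nonneg fun n => Finset.prod_nonneg fun j _ => hg0 _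
  have hred : ∀ x : Fin (κ + 1) → Fin M, av (fun n : G => ∏ j : Fin (κ + 1), g (n + ((psi j x : ℤ) : G)))
      = Φ (∑ i, ((x i : ℕ) + 1)) := by
    intro x
    simp only [hΦ]
    rw [av_equiv (Equiv.addRight (((∑ i : Fin (κ + 1), ((i : ℕ) : ℤ) * (((x i : ℕ) : ℤ) + 1) : ℤ) : G)))
      (fun n => ∏ j : Fin (κ + 1), g (n + ((j : ℕ) : G) * (-((∑ i, ((x i : ℕ) + 1) : ℕ) : G))))]
    congr 1
    funext n
    apply Finset.prod_congr rfl
    intro j _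
    congr 1
    simp only [psi, Equiv.coe_addRight, sub_mul, Finset.sum_sub_distrib, ← Finset.mul_sum]
    push_cast
    ring
  rw [av_comm]
  simp only [hred]
  have hLK : 0 < 2 * L * K := by have : 0 < L * K := Nat.mul_pos hL (by omega)
                                 nlinarith
  set h := M / (2 * L * K) with hh
  have hh1 : 1 ≤ h := (Nat.one_le_div_iff hLK).mpr hM
  have hhM : 2 * L * K * h ≤ M := Nat.mul_div_le M _
  have hhM' : M < 2 * L * K * (h + 1) := Nat.lt_mul_div_succ M hLK
  have key : ∀ i ∈ Finset.Icc 1 L, ∑ u : Fin (h * K), ∑ y : Fin κ → Fin h, Φ (i * (h * K + 1 + u)) ≤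
      ∑ x : Fin (κ + 1) → Fin M, Φ (∑ i, ((x i : ℕ) + 1)) := by
    intro i hi
    rw [Finset.mem_Icc] at hi
    have hb : ∀ y : Fin κ → Fin h, ∑ a, ((y a : ℕ) + 1) ≤ κ * h := by
      intro y
      calc ∑ a, ((y a : ℕ) + 1) ≤ ∑ a : Fin κ, h := Finset.sum_le_sum fun a _ => (y a).2
        _ = κ * h := by simp
    have hlt : ∀ y : Fin κ → Fin h, ∀ u : Fin (h * K),
        ∑ a, ((y a : ℕ) + 1) + 1 ≤ i * (h * K + 1 + u) := by
      intro y u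
      have := hb y
      have h2 : h * K + 1 + u ≤ i * (h * K + 1 + u) := Nat.le_mul_of_pos_left _ hi.1
      have h3 : h * K = κ * h + h := by rw [hK]; ring
      omega
    have hle : ∀ u : Fin (h * K), i * (h * K + 1 + u) ≤ M := by
      intro u
      have h1 : h * K + 1 + u ≤ 2 * (h * K) := by have := u.2; omega
      calc i * (h * K + 1 + u) ≤ L * (2 * (h * K)) := Nat.mul_le_mul hi.2 h1
        _ = 2 * L * K * h := by ring
        _ ≤ M := hhM
    have hhM2 : h ≤ M := le_trans (Nat.le_mul_of_pos_left _ hLK) hhM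
    rw [← Fintype.sum_prod_type' (f := fun (u : Fin (h * K)) (y : Fin κ → Fin h) => Φ (i * (h * K + 1 + u)))]
    set e : Fin (h * K) × (Fin κ → Fin h) → (Fin (κ + 1) → Fin M) := fun p =>
      Fin.cons ⟨i * (h * K + 1 + p.1) - (∑ a, ((p.2 a : ℕ) + 1)) - 1, by
        have := hlt p.2 p.1; have := hle p.1; omega⟩ (fun a => Fin.castLE hhM2 (p.2 a)) with he
    have hsum : ∀ p, ∑ a, ((e p a : ℕ) + 1) = i * (h * K + 1 + p.1) := by
      intro p
      rw [Fin.sum_univ_succ]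
      simp only [he, Fin.cons_zero, Fin.cons_succ, Fin.val_castLE]
      have := hlt p.2 p.1
      omega
    have hinj : Function.Injective e := by
      intro p q hpq
      have h1 := hsum p
      rw [hpq, hsum q] at h1
      have h2 : (q.1 : ℕ) = p.1 := by
        have := Nat.eq_of_mul_eq_mul_left (by omega) h1
        omega
      have h3 : p.2 = q.2 := by
        funext a
        have := congrFun hpq a.succ
        simp only [he, Fin.cons_succ] at this
        have h5 := congrArg (fun z : Fin M => (z : ℕ)) this
        simp only [Fin.val_castLE] at h5
        exact Fin.ext h5
      exact Prod.ext (Fin.ext h2.symm) h3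
    calc ∑ p : Fin (h * K) × (Fin κ → Fin h), Φ (i * (h * K + 1 + p.1)) =
        ∑ p : Fin (h * K) × (Fin κ → Fin h), Φ (∑ a, ((e p a : ℕ) + 1)) := by simp only [hsum]
      _ = ∑ x ∈ Finset.univ.map ⟨e, hinj⟩, Φ (∑ a, ((x a : ℕ) + 1)) := by rw [Finset.sum_map]; rfl
      _ ≤ _ := Finset.sum_le_sum_of_subset_of_nonneg (Finset.subset_univ _) (fun x _ _ => hΦ0 _)
  have h1 := Finset.sum_le_sum key
  rw [Finset.sum_const, Nat.card_Icc, Finset.sum_comm] at h1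
  have h2 : ∀ u : Fin (h * K), (h : ℝ) ^ κ * c ≤ ∑ i ∈ Finset.Icc 1 L, ∑ y : Fin κ → Fin h, Φ (i * (h * K + 1 + u)) := by
    intro u
    obtain ⟨i, hi1, hi2, hi⟩ := hv G g hg0 hg1 hav (-((h * K + 1 + u : ℕ) : G))
    have h3 : c ≤ Φ (i * (h * K + 1 + u)) := by
      refine hi.trans (le_of_eq ?_)
      simp only [hΦ]
      congr 1
      funext n
      apply Finset.prod_congr rfl
      intro j _
      congr 1
      push_cast
      ring
    have h4 : (h : ℝ) ^ κ * c ≤ ∑ y : Fin κ → Fin h, Φ (i * (h * K + 1 + u)) := by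
      rw [Finset.sum_const, Finset.card_univ, nsmul_eq_mul]
      simp only [Fintype.card_pi, Fintype.card_fin, Finset.prod_const, Finset.card_univ]
      push_cast
      gcongr
    refine h4.trans (Finset.single_le_sum (f := fun i => ∑ y : Fin κ → Fin h, Φ (i * (h * K + 1 + u))) ?_ (Finset.mem_Icc.mpr ⟨hi1, hi2⟩))
    intro i _
    exact Finset.sum_nonneg fun _ _ => hΦ0 _
  have h3 := (Finset.sum_le_sum fun u (_ : u ∈ Finset.univ) => h2 u).trans h1
  rw [Finset.sum_const, Finset.card_univ, Fintype.card_fin, nsmul_eq_mul, nsmul_eq_mul] at h3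
  simp only [av, Fintype.card_pi, Fintype.card_fin, Finset.prod_const, Finset.card_univ]
  have hMr : (0 : ℝ) < M := by exact_mod_cast (by omega : 0 < M)
  rw [le_div_iff₀ (by push_cast; positivity)]
  have h4 : (1 / (4 * L * K) : ℝ) * M ≤ h := by
    rw [one_div_mul_eq_div, div_le_iff₀ (by positivity)]
    have : M ≤ 2 * L * K * (h + 1) := hhM'.le
    have h5 : M ≤ h * (4 * L * K) := by nlinarith
    exact_mod_cast h5
  have h5 : ((1 / (4 * L * K) : ℝ) * M) ^ K ≤ (h : ℝ) ^ K := by gcongr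
  have h6 : (h : ℝ) ^ K * (K * c) ≤ L * ∑ x : Fin (κ + 1) → Fin M, Φ (∑ i, ((x i : ℕ) + 1)) := by
    refine le_trans (le_of_eq ?_) (h3.trans (le_of_eq ?_))
    · rw [hK, pow_succ]; push_cast; ring
    · simp
  calc _ = ((1 / (4 * L * K) : ℝ) * M) ^ K * (K * c) / L := by push_cast; rw [mul_pow]; ring
    _ ≤ (h : ℝ) ^ K * (K * c) / L := by gcongr
    _ ≤ _ := by rw [div_le_iff₀ hLr]; linarith

end GT

end

section

open Filter
open scoped BigOperators

namespace GT

set_option linter.unusedSectionVars false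
set_option linter.unusedSimpArgs false
set_option linter.unusedVariables false
set_option linter.deprecated false

/-! ## Part 3: transference -/

lemma av_cs {X : Type} [Fintype X] (f g : X → ℝ) :
    (av (fun x => f x * g x)) ^ 2 ≤ av (fun x => f x ^ 2) * av (fun x => g x ^ 2) := by
  simp only [av]
  rw [div_pow, div_mul_div_comm, ← sq]
  gcongr
  exact Finset.sum_mul_sq_le_sq_mul_sq _ _ _

lemma av_cs' {X : Type} [Fintype X] {A B P : X → ℝ} (h : ∀ x, |A x| ≤ B x) :
    (av (fun x => A x * P x)) ^ 2 ≤ av B * av (fun x => B x * P x ^ 2) := by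
  have hB : ∀ x, 0 ≤ B x := fun x => (abs_nonneg _).trans (h x)
  have h1 : |av (fun x => A x * P x)| ≤ av (fun x => √(B x) * (√(B x) * |P x|)) := by
    refine (abs_av_le _).trans (av_mono fun x => ?_)
    rw [← mul_assoc, Real.mul_self_sqrt (hB x), abs_mul]
    exact mul_le_mul_of_nonneg_right (h x) (abs_nonneg _)
  calc (av (fun x => A x * P x)) ^ 2 = |av (fun x => A x * P x)| ^ 2 := (sq_abs _).symm
    _ ≤ (av (fun x => √(B x) * (√(B x) * |P x|))) ^ 2 := by gcongr
    _ ≤ _ := av_cs _ _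
    _ = _ := by
      congr 2 <;> funext x
      · rw [Real.sq_sqrt (hB x)]
      · rw [mul_pow, Real.sq_sqrt (hB x), sq_abs]

section upd
variable {Ω X ι : Type} [Fintype Ω] [Fintype X] [Fintype ι] [DecidableEq ι] [Nonempty X]

lemma av_upd (i : ι) (f : (ι → X) → ℝ) :
    av (fun x => av (fun z => f (Function.update x i z))) = av f := by
  rw [av_equiv (Equiv.funSplitAt i X).symm, av_equiv (Equiv.funSplitAt i X).symm f, av_prod, av_prod]
  have : ∀ (a : X) (r : {j // j ≠ i} → X) (z : X),
      Function.update ((Equiv.funSplitAt i X).symm (a, r)) i z = (Equiv.funSplitAt i X).symm (z, r) := by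
    intro a r z
    funext j
    by_cases hj : j = i
    · subst hj; simp [Equiv.funSplitAt, Equiv.piSplitAt]
    · simp [Equiv.funSplitAt, Equiv.piSplitAt, hj]
  simp only [this]
  rw [av_const, av_comm]

/-- average over base point and two tuples -/
noncomputable def EE (F : Ω → (ι → X) → (ι → X) → ℝ) : ℝ :=
  av (fun p : Ω × (ι → X) × (ι → X) => F p.1 p.2.1 p.2.2)

/-- average over base point and one tuple -/
noncomputable def E2 (F : Ω → (ι → X) → ℝ) : ℝ :=
  av (fun p : Ω × (ι → X) => F p.1 p.2)

lemma EE_eq (F : Ω → (ι → X) → (ι → X) → ℝ) :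
    EE F = av (fun n => av (fun x => av (fun y => F n x y))) := by
  rw [EE, av_prod]
  congr 1; funext n
  rw [av_prod]

lemma E2_eq (F : Ω → (ι → X) → ℝ) : E2 F = av (fun n => av (fun x => F n x)) := by
  rw [E2, av_prod]

lemma EE_of_E2 (F : Ω → (ι → X) → ℝ) : EE (fun n x _ => F n x) = E2 F := by
  rw [EE_eq, E2_eq]
  simp only [av_const]

lemma EE_updx (i : ι) (F : Ω → (ι → X) → (ι → X) → ℝ) :
    EE (fun n x y => av (fun z => F n (Function.update x i z) y)) = EE F := by
  rw [EE_eq, EE_eq]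
  congr 1; funext n
  rw [av_comm, av_comm (f := fun x y => F n x y)]
  congr 1; funext y
  exact av_upd i (fun x => F n x y)

lemma EE_updy (i : ι) (F : Ω → (ι → X) → (ι → X) → ℝ) :
    EE (fun n x y => av (fun z => F n x (Function.update y i z))) = EE F := by
  rw [EE_eq, EE_eq]
  congr 1; funext n
  congr 1; funext x
  exact av_upd i (fun y => F n x y)

/-- independence of one coordinate -/
def Idp (i : ι) (F : Ω → (ι → X) → ℝ) : Prop := ∀ n x z, F n (Function.update x i z) = F n x

/-- the doubling product -/
def Dp (s : Finset ι) (F : Ω → (ι → X) → ℝ) (n : Ω) (x y : ι → X) : ℝ :=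
  ∏ t ∈ s.powerset, F n (t.piecewise y x)

lemma Dp_insert {s : Finset ι} {i : ι} (hi : i ∉ s) (F : Ω → (ι → X) → ℝ) (n : Ω) (x y : ι → X) :
    Dp (insert i s) F n x y = Dp s F n x y * Dp s F n (Function.update x i (y i)) y := by
  unfold Dp
  rw [Finset.prod_powerset_insert hi]
  congr 1
  apply Finset.prod_congr rfl
  intro t ht
  congr 1
  have hit : i ∉ t := fun h => hi (Finset.mem_powerset.mp ht h)
  rw [Finset.piecewise_insert, Finset.update_piecewise_of_notMem _ _ _ hit]

lemma Dp_x {s : Finset ι} {i : ι} (hi : i ∉ s) {F : Ω → (ι → X) → ℝ} (hF : Idp i F) (n : Ω)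
    (x y : ι → X) (z : X) : Dp s F n (Function.update x i z) y = Dp s F n x y := by
  unfold Dp
  apply Finset.prod_congr rfl
  intro t ht
  have hit : i ∉ t := fun h => hi (Finset.mem_powerset.mp ht h)
  rw [← Finset.update_piecewise_of_notMem _ _ _ hit, hF]

lemma Dp_y {s : Finset ι} {i : ι} (hi : i ∉ s) (F : Ω → (ι → X) → ℝ) (n : Ω)
    (x y : ι → X) (z : X) : Dp s F n x (Function.update y i z) = Dp s F n x y := by
  unfold Dp
  apply Finset.prod_congr rfl
  intro t ht
  have hit : i ∉ t := fun h => hi (Finset.mem_powerset.mp ht h)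
  congr 1
  funext j
  by_cases hj : j ∈ t
  · have : j ≠ i := fun h => hit (h ▸ hj)
    simp [hj, this]
  · simp [hj]

lemma Dp_abs {s : Finset ι} {F H : Ω → (ι → X) → ℝ} (h : ∀ n x, |F n x| ≤ H n x) (n : Ω)
    (x y : ι → X) : |Dp s F n x y| ≤ Dp s H n x y := by
  unfold Dp
  rw [Finset.abs_prod]
  exact Finset.prod_le_prod (fun _ _ => abs_nonneg _) (fun t _ => h _ _)

/-- Gowers-Cauchy-Schwarz integrals -/
noncomputable def Tg (I : Finset ι) (h : Ω → (ι → X) → ℝ) (a μ : ι → Ω → (ι → X) → ℝ)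
    (s : Finset ι) : ℝ :=
  EE (fun n x y => Dp s h n x y * (∏ i ∈ s, Dp (s.erase i) (μ i) n x y) *
    ∏ i ∈ I \ s, Dp s (a i) n x y)

lemma Tg_step {I s : Finset ι} {i : ι} (hi : i ∈ I) (his : i ∉ s) (h : Ω → (ι → X) → ℝ)
    (a μ : ι → Ω → (ι → X) → ℝ) (ha : Idp i (a i)) (hμ : Idp i (μ i))
    (hle : ∀ n x, |a i n x| ≤ μ i n x) :
    (Tg I h a μ s) ^ 2 ≤ EE (fun n x y => Dp s (μ i) n x y) * Tg I h a μ (insert i s) := by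
  set P : Ω → (ι → X) → (ι → X) → ℝ := fun n x y =>
    Dp s h n x y * (∏ i ∈ s, Dp (s.erase i) (μ i) n x y) *
    ∏ i ∈ I \ insert i s, Dp s (a i) n x y with hP
  have hPy : ∀ n x y z, P n x (Function.update y i z) = P n x y := by
    intro n x y z
    simp only [hP, Dp_y his]
    congr 2
    apply Finset.prod_congr rfl
    intro j hj
    exact Dp_y (fun hh => his (Finset.mem_of_mem_erase hh)) _ _ _ _ _
  have e1 : Tg I h a μ s = EE (fun n x y => Dp s (a i) n x y *
      av (fun z => P n (Function.update x i z) y)) := by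
    have : Tg I h a μ s = EE (fun n x y => Dp s (a i) n x y * P n x y) := by
      unfold Tg
      congr 1; funext n x y
      have : I \ s = insert i (I \ insert i s) := by
        ext j; simp only [Finset.mem_sdiff, Finset.mem_insert]
        by_cases hj : j = i
        · subst hj; simp [hi, his]
        · simp [hj]
      rw [this, Finset.prod_insert (by simp)]
      simp only [hP]; ring
    rw [this, ← EE_updx i]
    congr 1; funext n x y
    simp only [Dp_x his ha]
    rw [av_mul_left]
  have e2 : EE (fun n x y => Dp s (μ i) n x y *
      (av (fun z => P n (Function.update x i z) y)) ^ 2) = Tg I h a μ (insert i s) := by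
    have h1 : EE (fun n x y => Dp s (μ i) n x y * (av (fun z => P n (Function.update x i z) y)) ^ 2)
      = EE (fun n x y => av (fun z => Dp s (μ i) n (Function.update x i z) y *
        P n (Function.update x i z) y * av (fun z' => P n (Function.update (Function.update x i z) i z') y))) := by
      congr 1; funext n x y
      simp only [Dp_x his hμ, Function.update_idem]
      rw [av_mul_right, av_mul_left]; ring
    rw [h1, EE_updx i (fun n x y => Dp s (μ i) n x y * P n x y *
      av (fun z' => P n (Function.update x i z') y))]
    have h2 : EE (fun n x y => Dp s (μ i) n x y * P n x y *
      av (fun z' => P n (Function.update x i z') y)) =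
      EE (fun n x y => av (fun z' => Dp s (μ i) n x (Function.update y i z') *
        P n x (Function.update y i z') *
        P n (Function.update x i ((Function.update y i z') i)) (Function.update y i z'))) := by
      congr 1; funext n x y
      simp only [Dp_y his, hPy, Function.update_self]
      rw [av_mul_left]
    rw [h2, EE_updy i (fun n x y => Dp s (μ i) n x y * P n x y * P n (Function.update x i (y i)) y)]
    unfold Tg
    congr 1; funext n x y
    rw [Finset.prod_insert his, Finset.erase_insert his, Dp_insert his]
    have h3 : ∏ j ∈ s, Dp ((insert i s).erase j) (μ j) n x y =
        (∏ j ∈ s, Dp (s.erase j) (μ j) n x y) *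
        ∏ j ∈ s, Dp (s.erase j) (μ j) n (Function.update x i (y i)) y := by
      rw [← Finset.prod_mul_distrib]
      apply Finset.prod_congr rfl
      intro j hj
      rw [Finset.erase_insert_of_ne (fun hh => his (by rw [hh]; exact hj))]
      exact Dp_insert (fun hh => his (Finset.mem_of_mem_erase hh)) _ _ _ _
    have h4 : ∏ j ∈ I \ insert i s, Dp (insert i s) (a j) n x y =
        (∏ j ∈ I \ insert i s, Dp s (a j) n x y) *
        ∏ j ∈ I \ insert i s, Dp s (a j) n (Function.update x i (y i)) y := by
      rw [← Finset.prod_mul_distrib]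
      exact Finset.prod_congr rfl fun j hj => Dp_insert his _ _ _ _
    rw [h3, h4]
    simp only [hP]
    ring
  rw [← e2, e1]
  exact av_cs' (fun p => Dp_abs hle _ _ _)

/-- the generalized Cauchy-Schwarz inequality -/
theorem gcs (I : Finset ι) (h : Ω → (ι → X) → ℝ) (a μ : ι → Ω → (ι → X) → ℝ)
    (ha : ∀ i ∈ I, Idp i (a i)) (hμ : ∀ i ∈ I, Idp i (μ i))
    (hle : ∀ i ∈ I, ∀ n x, |a i n x| ≤ μ i n x)
    (h2 : ∀ s ⊆ I, ∀ i ∈ I, i ∉ s → EE (fun n x y => Dp s (μ i) n x y) ≤ 2)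
    {ε : ℝ} (hε : 0 ≤ ε)
    (hT : |EE (fun n x y => Dp I h n x y * ∏ i ∈ I, Dp (I.erase i) (μ i) n x y)| ≤
      (ε / 2) ^ (2 ^ I.card)) :
    |E2 (fun n x => h n x * ∏ i ∈ I, a i n x)| ≤ ε := by
  have key : ∀ s ⊆ I, |Tg I h a μ ∅| ^ (2 ^ s.card) ≤ 2 ^ (2 ^ s.card - 1) * |Tg I h a μ s| := by
    intro s
    induction s using Finset.induction_on with
    | empty => intro _; simp
    | insert i s his ih =>
      intro hs
      have hsI : s ⊆ I := (Finset.subset_insert i s).trans hs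
      have hiI : i ∈ I := hs (Finset.mem_insert_self i s)
      have h1 := ih hsI
      have h3 := Tg_step hiI his h a μ (ha i hiI) (hμ i hiI) (hle i hiI)
      rw [Finset.card_insert_of_notMem his]
      have hpos : 0 ≤ EE (fun n x y => Dp s (μ i) n x y) := by
        apply av_nonneg; intro p
        exact (abs_nonneg _).trans (Dp_abs (hle i hiI) _ _ _)
      have h4 : (Tg I h a μ s) ^ 2 ≤ 2 * |Tg I h a μ (insert i s)| := by
        refine h3.trans ?_
        refine (mul_le_mul_of_nonneg_left (le_abs_self _) hpos).trans ?_
        exact mul_le_mul_of_nonneg_right (h2 s hsI i hiI his) (abs_nonneg _)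
      have e : 2 ^ (s.card + 1) - 1 = (2 ^ s.card - 1) * 2 + 1 := by
        have : 1 ≤ 2 ^ s.card := Nat.one_le_two_pow
        rw [pow_succ]; omega
      calc |Tg I h a μ ∅| ^ (2 ^ (s.card + 1)) = (|Tg I h a μ ∅| ^ (2 ^ s.card)) ^ 2 := by
            rw [← pow_mul, pow_succ]
        _ ≤ (2 ^ (2 ^ s.card - 1) * |Tg I h a μ s|) ^ 2 := by gcongr
        _ = 2 ^ ((2 ^ s.card - 1) * 2) * (Tg I h a μ s) ^ 2 := by rw [mul_pow, sq_abs, ← pow_mul]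
        _ ≤ 2 ^ ((2 ^ s.card - 1) * 2) * (2 * |Tg I h a μ (insert i s)|) := by gcongr
        _ = _ := by rw [e, pow_succ]; ring
  have h3 := key I (Finset.Subset.refl I)
  have e1 : Tg I h a μ ∅ = E2 (fun n x => h n x * ∏ i ∈ I, a i n x) := by
    rw [← EE_of_E2]
    unfold Tg
    congr 1; funext n x y
    simp [Dp]
  have e2 : Tg I h a μ I = EE (fun n x y => Dp I h n x y * ∏ i ∈ I, Dp (I.erase i) (μ i) n x y) := by
    unfold Tg
    congr 1; funext n x y
    simp
  rw [e1, e2] at h3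
  have hp : 0 < 2 ^ I.card := by positivity
  have h4 : |E2 (fun n x => h n x * ∏ i ∈ I, a i n x)| ^ (2 ^ I.card) ≤ ε ^ (2 ^ I.card) := by
    refine h3.trans ?_
    calc (2 : ℝ) ^ (2 ^ I.card - 1) * _ ≤ 2 ^ (2 ^ I.card) * (ε / 2) ^ (2 ^ I.card) := by
          gcongr
          · norm_num
          · exact Nat.sub_le _ _
      _ = ε ^ (2 ^ I.card) := by rw [← mul_pow]; congr 1; ring
  exact (pow_le_pow_iff_left₀ (abs_nonneg _) hε hp.ne').mp h4

end upd
end GT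

end

section

open Filter
open scoped BigOperators

namespace GT

set_option linter.unusedSectionVars false
set_option linter.unusedSimpArgs false
set_option linter.unusedVariables false
set_option linter.deprecated false

section cnt
variable {Ω X ι : Type} [Fintype Ω] [Fintype X] [Fintype ι] [DecidableEq ι] [Nonempty X] [Nonempty Ω]

/-- linear forms condition, abstract version -/
def LF (ν : ι → Ω → (ι → X) → ℝ) (ε : ℝ) : Prop :=
  ∀ S : ι → Finset (Finset ι), (∀ i, ∀ t ∈ S i, i ∉ t) →
    |EE (fun n x y => ∏ i, ∏ t ∈ S i, ν i n (t.piecewise y x)) - 1| ≤ ε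

lemma EE_merge (j : ι) (F : Ω × X → (ι → X) → (ι → X) → ℝ)
    (hF : ∀ p x y z, F p x (Function.update y j z) = F p x y) :
    EE F = EE (fun n x y => F (n, y j) x y) := by
  rw [EE_eq, av_prod, EE_eq]
  congr 1; funext n
  rw [av_comm]
  congr 1; funext x
  rw [← av_upd j (fun y => F (n, y j) x y), av_comm]
  congr 1; funext y
  congr 1; funext z
  rw [Function.update_self, hF]

lemma E2_two (j : ι) (C A B : Ω → (ι → X) → ℝ) (hC : Idp j C) :
    E2 (fun n x => C n x * av (fun z => A n (Function.update x j z)) *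
      av (fun z => B n (Function.update x j z))) =
    EE (fun n x y => C n x * A n x * B n (Function.update x j (y j))) := by
  rw [← EE_updy j, ← EE_updx j, ← EE_of_E2]
  congr 1; funext n x y
  simp only [Function.update_self, Function.update_idem, hC n x]
  simp only [av_mul_left, av_mul_right]

/-- majorant -/
noncomputable def mj (σ : Finset ι) (ν : ι → Ω → (ι → X) → ℝ) (i : ι) (n : Ω) (x : ι → X) : ℝ :=
  if i ∈ σ then ν i n x else 1

lemma mj_idp {σ : Finset ι} {ν : ι → Ω → (ι → X) → ℝ} (h : ∀ i, Idp i (ν i)) (i : ι) :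
    Idp i (mj σ ν i) := by
  intro n x z
  simp only [mj, h i n x z]

lemma mj_prod (σ : Finset ι) (ν : ι → Ω → (ι → X) → ℝ) (i : ι) (n : Ω) (x y : ι → X)
    (T : Finset (Finset ι)) : ∏ t ∈ T, mj σ ν i n (t.piecewise y x) =
    ∏ t ∈ (if i ∈ σ then T else ∅), ν i n (t.piecewise y x) := by
  by_cases h : i ∈ σ <;> simp [mj, h]

lemma idp_upd {i j : ι} (hij : i ≠ j) {F : Ω → (ι → X) → ℝ} (hF : Idp i F) (n : Ω) (x : ι → X)
    (w z : X) : F n (Function.update (Function.update x i z) j w) = F n (Function.update x j w) := by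
  rw [Function.update_comm hij, hF]

lemma pw_upd (t : Finset ι) {j : ι} (x y : ι → X) :
    Function.update (t.piecewise y x) j (y j) = (insert j t).piecewise y x := by
  rw [Finset.piecewise_insert]

lemma LF_one {ν : ι → Ω → (ι → X) → ℝ} {ε : ℝ} (h : LF ν ε) (σ : Finset ι) (i : ι)
    (T : Finset (Finset ι)) (hT : ∀ t ∈ T, i ∉ t) :
    |EE (fun n x y => ∏ t ∈ T, mj σ ν i n (t.piecewise y x)) - 1| ≤ ε := by
  have := h (fun i' => if i' = i then (if i ∈ σ then T else ∅) else ∅) (by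
    intro i' t ht
    split_ifs at ht with h1 h2
    · rw [h1]; exact hT t ht
    · simp at ht
    · simp at ht)
  convert this using 4
  funext n x y
  rw [mj_prod, Finset.prod_eq_single i]
  · simp
  · intro b _ hb; simp [hb]
  · simp

lemma weak (j : ι) (σ σ' : Finset ι) (ν : ι → Ω → (ι → X) → ℝ) (hν : ∀ i, Idp i (ν i))
    (hν0 : ∀ i n x, 0 ≤ ν i n x) {ε ε' : ℝ} (hε : 0 ≤ ε) (h1 : ε' ≤ 1) (hLF : LF ν ε')
    (hs : 2 ^ (2 ^ (Finset.univ.erase j).card) * ε' ≤ (ε / 2) ^ (2 ^ (Finset.univ.erase j).card))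
    (p q : ι → Ω → (ι → X) → ℝ) (hp : ∀ i, Idp i (p i)) (hq : ∀ i, Idp i (q i))
    (hp0 : ∀ i n x, 0 ≤ p i n x) (hq0 : ∀ i n x, 0 ≤ q i n x)
    (hp1 : ∀ i ≠ j, ∀ n x, p i n x ≤ mj σ ν i n x) (hq1 : ∀ i ≠ j, ∀ n x, q i n x ≤ mj σ' ν i n x) :
    |E2 (fun n x => (ν j n x - 1) * av (fun z => ∏ i ∈ Finset.univ.erase j, p i n (Function.update x j z)) *
      av (fun z => ∏ i ∈ Finset.univ.erase j, q i n (Function.update x j z)))| ≤ ε := by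
  set I := (Finset.univ : Finset ι).erase j with hI
  have hjI : j ∉ I := by simp [hI]
  have hIj : ∀ i ∈ I, i ≠ j := fun i hi => (Finset.mem_erase.mp hi).1
  rw [E2_two j (fun n x => ν j n x - 1) (fun n x => ∏ i ∈ I, p i n x) (fun n x => ∏ i ∈ I, q i n x)
    (fun n x z => by simp only [hν j n x z])]
  set h : Ω × X → (ι → X) → ℝ := fun w x => ν j w.1 x - 1 with hh
  set a : ι → Ω × X → (ι → X) → ℝ := fun i w x => p i w.1 x * q i w.1 (Function.update x j w.2) with ha
  set μ : ι → Ω × X → (ι → X) → ℝ := fun i w x =>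
    mj σ ν i w.1 x * mj σ' ν i w.1 (Function.update x j w.2) with hμ
  have e1 : EE (fun n x y => (ν j n x - 1) * (∏ i ∈ I, p i n x) *
      ∏ i ∈ I, q i n (Function.update x j (y j))) = E2 (fun w x => h w x * ∏ i ∈ I, a i w x) := by
    rw [← EE_of_E2, EE_merge j]
    · congr 1; funext n x y
      simp only [hh, ha, Finset.prod_mul_distrib]; ring
    · intros; rfl
  rw [e1]
  have hm0 : ∀ σ i n x, 0 ≤ mj σ ν i n x := by
    intro σ i n x; simp only [mj]; split_ifs
    · exact hν0 _ _ _
    · exact zero_le_one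
  set Q : Finset ι → ι → Finset (Finset ι) := fun s i =>
    (insert j s).powerset.filter (fun t => if j ∈ t then i ∈ σ' else i ∈ σ) with hQ
  have hDμ : ∀ s ⊆ I, ∀ i n x y, Dp s (μ i) (n, y j) x y =
      ∏ t ∈ Q s i, ν i n (t.piecewise y x) := by
    intro s hs i n x y
    have hjs : j ∉ s := fun hh => hjI (hs hh)
    rw [hQ, Finset.prod_filter, Finset.prod_powerset_insert hjs, ← Finset.prod_mul_distrib]
    apply Finset.prod_congr rfl
    intro t ht
    have hjt : j ∉ t := fun hh => hjs (Finset.mem_powerset.mp ht hh)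
    simp only [hμ, pw_upd, mj, if_neg hjt, if_pos (Finset.mem_insert_self j t)]
  have hDμy : ∀ s ⊆ I, ∀ i (w : Ω × X) x y z, Dp s (μ i) w x (Function.update y j z) = Dp s (μ i) w x y :=
    fun s hs i w x y z => Dp_y (fun hh => hjI (hs hh)) _ _ _ _ _
  apply gcs I h a μ _ _ _ _ hε
  · -- main term
    refine le_trans ?_ hs
    rw [EE_merge j]
    swap
    · intro w x y z
      rw [Dp_y hjI]
      congr 1
      apply Finset.prod_congr rfl
      intro i _
      exact hDμy _ (Finset.erase_subset _ _) _ _ _ _ _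
    have e2 : (fun n x y => Dp I h (n, y j) x y * ∏ i ∈ I, Dp (I.erase i) (μ i) (n, y j) x y) =
        fun n x y => ∑ U ∈ I.powerset.powerset, (-1) ^ (I.powerset \ U).card *
          ∏ i, ∏ t ∈ (if i = j then U else Q (I.erase i) i),
            ν i n (t.piecewise y x) := by
      funext n x y
      have e3 : Dp I h (n, y j) x y = ∑ U ∈ I.powerset.powerset, (∏ t ∈ U, ν j n (t.piecewise y x)) *
          (-1) ^ (I.powerset \ U).card := by
        unfold Dp
        simp only [hh, sub_eq_add_neg]
        rw [Finset.prod_add]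
        apply Finset.sum_congr rfl
        intro U _
        rw [Finset.prod_const]
      rw [e3, Finset.sum_mul]
      apply Finset.sum_congr rfl
      intro U hU
      rw [← Finset.mul_prod_erase Finset.univ _ (Finset.mem_univ j), if_pos rfl, ← hI]
      have e4 : ∏ i ∈ I, Dp (I.erase i) (μ i) (n, y j) x y = ∏ i ∈ I, ∏ t ∈ (if i = j then U else
          Q (I.erase i) i), ν i n (t.piecewise y x) := by
        apply Finset.prod_congr rfl
        intro i hi
        rw [if_neg (hIj i hi), hDμ _ (Finset.erase_subset _ _)]
      rw [e4]; ring
    rw [e2]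
    have e5 : EE (fun n x y => ∑ U ∈ I.powerset.powerset, (-1) ^ (I.powerset \ U).card *
          ∏ i, ∏ t ∈ (if i = j then U else Q (I.erase i) i),
            ν i n (t.piecewise y x)) = ∑ U ∈ I.powerset.powerset, (-1) ^ (I.powerset \ U).card *
          (EE (fun (n : Ω) (x y : ι → X) => ∏ i, ∏ t ∈ (if i = j then U else Q (I.erase i) i),
            ν i n (t.piecewise y x)) - 1) := by
      have hz : ∑ U ∈ I.powerset.powerset, (-1 : ℝ) ^ (I.powerset \ U).card = 0 := by
        have := Finset.prod_add (fun _ : Finset ι => (1 : ℝ)) (fun _ => -1) I.powerset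
        simp only [Finset.prod_const, one_pow, one_mul] at this
        rw [← this]
        have : 0 < I.powerset.card := Finset.card_pos.mpr (Finset.powerset_nonempty I)
        simp
      simp only [mul_sub, mul_one, Finset.sum_sub_distrib, hz, sub_zero]
      unfold EE
      rw [av_sum]
      simp only [av_mul_left]
    rw [e5]
    refine (Finset.abs_sum_le_sum_abs _ _).trans ?_
    have : ∀ U ∈ I.powerset.powerset, |(-1) ^ (I.powerset \ U).card *
          (EE (fun (n : Ω) (x y : ι → X) => ∏ i, ∏ t ∈ (if i = j then U else Q (I.erase i) i),
            ν i n (t.piecewise y x)) - 1)| ≤ ε' := by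
      intro U hU
      rw [abs_mul, abs_pow, abs_neg, abs_one, one_pow, one_mul]
      apply hLF
      intro i t ht
      split_ifs at ht with c1
      · rw [c1]
        have := Finset.mem_powerset.mp ((Finset.mem_powerset.mp hU) ht)
        exact fun hh => hjI (this hh)
      · intro hh
        have := Finset.mem_powerset.mp (Finset.mem_filter.mp ht).1 hh
        simp [c1] at this
    refine (Finset.sum_le_sum this).trans (le_of_eq ?_)
    rw [Finset.sum_const, Finset.card_powerset, Finset.card_powerset, nsmul_eq_mul]
    push_cast; rfl
  · intro i hi w x z
    simp only [ha]
    rw [hp i, idp_upd (hIj i hi) (hq i)]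
  · intro i hi w x z
    simp only [hμ]
    rw [mj_idp hν i, idp_upd (hIj i hi) (mj_idp hν i)]
  · intro i hi w x
    simp only [ha, hμ]
    rw [abs_of_nonneg (mul_nonneg (hp0 _ _ _) (hq0 _ _ _))]
    exact mul_le_mul (hp1 i (hIj i hi) _ _) (hq1 i (hIj i hi) _ _) (hq0 _ _ _) (hm0 _ _ _ _)
  · intro s hs i hi his
    rw [EE_merge j]
    swap
    · intro w x y z; exact hDμy s hs _ _ _ _ _
    simp only [hDμ s hs]
    have := (abs_le.mp (LF_one hLF Finset.univ i (Q s i) (by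
      intro t ht hit
      have := Finset.mem_powerset.mp (Finset.mem_filter.mp ht).1 hit
      simp [hIj i hi, his] at this))).2
    simp only [mj, Finset.mem_univ, if_true] at this
    linarith

end cnt
end GT

end

section

open Filter
open scoped BigOperators

namespace GT

set_option linter.unusedSectionVars false
set_option linter.unusedSimpArgs false
set_option linter.unusedVariables false
set_option linter.deprecated false

section cnt
variable {Ω X ι : Type} [Fintype Ω] [Fintype X] [Fintype ι] [DecidableEq ι] [Nonempty X] [Nonempty Ω]

lemma E2_upd (j : ι) (F : Ω → (ι → X) → ℝ) :
    E2 (fun n x => av (fun z => F n (Function.update x j z))) = E2 F := by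
  rw [E2_eq, E2_eq]
  congr 1; funext n
  exact av_upd j (F n)

lemma E2_sub (F H : Ω → (ι → X) → ℝ) : E2 (fun n x => F n x - H n x) = E2 F - E2 H := av_sub _ _
lemma E2_add (F H : Ω → (ι → X) → ℝ) : E2 (fun n x => F n x + H n x) = E2 F + E2 H := av_add _ _
lemma E2_mono {F H : Ω → (ι → X) → ℝ} (h : ∀ n x, F n x ≤ H n x) : E2 F ≤ E2 H := av_mono fun p => h _ _
lemma E2_nonneg {F : Ω → (ι → X) → ℝ} (h : ∀ n x, 0 ≤ F n x) : 0 ≤ E2 F := av_nonneg fun p => h _ _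
lemma E2_mul (c : ℝ) (F : Ω → (ι → X) → ℝ) : E2 (fun n x => c * F n x) = c * E2 F := av_mul_left _ _
lemma E2_const (c : ℝ) : E2 (fun (_ : Ω) (_ : ι → X) => c) = c := av_const c
lemma E2_cs (F H : Ω → (ι → X) → ℝ) : (E2 (fun n x => F n x * H n x)) ^ 2 ≤
    E2 (fun n x => F n x ^ 2) * E2 (fun n x => H n x ^ 2) := av_cs _ _
lemma abs_E2 (F : Ω → (ι → X) → ℝ) : |E2 F| ≤ E2 (fun n x => |F n x|) := abs_av_le _

/-- marginal of a product -/
noncomputable def mg (j : ι) (f : ι → Ω → (ι → X) → ℝ) (n : Ω) (x : ι → X) : ℝ :=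
  av (fun z => ∏ i ∈ Finset.univ.erase j, f i n (Function.update x j z))

lemma mg_idp (j : ι) (f : ι → Ω → (ι → X) → ℝ) : Idp j (mg j f) := by
  intro n x z; simp only [mg, Function.update_idem]

lemma E2_mg (j : ι) (f : ι → Ω → (ι → X) → ℝ) (C : Ω → (ι → X) → ℝ) (hC : Idp j C) :
    E2 (fun n x => C n x * mg j f n x) =
    E2 (fun n x => C n x * ∏ i ∈ Finset.univ.erase j, f i n x) := by
  rw [← E2_upd j (fun n x => C n x * ∏ i ∈ Finset.univ.erase j, f i n x)]
  congr 1; funext n x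
  simp only [hC n x, mg]
  rw [av_mul_left]

lemma mg_nonneg (j : ι) {f : ι → Ω → (ι → X) → ℝ} (h : ∀ i n x, 0 ≤ f i n x) (n : Ω) (x : ι → X) :
    0 ≤ mg j f n x := av_nonneg fun z => Finset.prod_nonneg fun i _ => h _ _ _

lemma mg_mono (j : ι) {f g : ι → Ω → (ι → X) → ℝ} (h0 : ∀ i n x, 0 ≤ f i n x)
    (h : ∀ i ≠ j, ∀ n x, f i n x ≤ g i n x) (n : Ω) (x : ι → X) : mg j f n x ≤ mg j g n x :=
  av_mono fun z => Finset.prod_le_prod (fun i _ => h0 _ _ _)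
    (fun i hi => h i (Finset.mem_erase.mp hi).1 _ _)

lemma mg_var (j : ι) (σ : Finset ι) (ν : ι → Ω → (ι → X) → ℝ) {ε : ℝ} (hLF : LF ν ε) :
    E2 (fun n x => (mg j (mj σ ν) n x - 1) ^ 2) ≤ 3 * ε := by
  have h1 : |E2 (fun n x => mg j (mj σ ν) n x) - 1| ≤ ε := by
    have e := E2_mg j (mj σ ν) (fun (_ : Ω) (_ : ι → X) => (1 : ℝ)) (fun _ _ _ => rfl)
    simp only [one_mul] at e
    rw [e, ← EE_of_E2]
    have := hLF (fun i => if i = j then ∅ else if i ∈ σ then {∅} else ∅) (by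
      intro i t ht
      split_ifs at ht with c1 c2
      · simp at ht
      · rw [Finset.mem_singleton] at ht; simp [ht]
      · simp at ht)
    convert this using 4
    funext n x y
    rw [← Finset.mul_prod_erase Finset.univ _ (Finset.mem_univ j), if_pos rfl, Finset.prod_empty, one_mul]
    apply Finset.prod_congr rfl
    intro i hi
    rw [if_neg (Finset.mem_erase.mp hi).1]
    by_cases h : i ∈ σ <;> simp [mj, h]
  have h2 : |E2 (fun n x => mg j (mj σ ν) n x * mg j (mj σ ν) n x) - 1| ≤ ε := by
    have e := E2_two j (fun (_ : Ω) (_ : ι → X) => (1 : ℝ))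
      (fun n x => ∏ i ∈ Finset.univ.erase j, mj σ ν i n x)
      (fun n x => ∏ i ∈ Finset.univ.erase j, mj σ ν i n x) (fun _ _ _ => rfl)
    simp only [one_mul] at e
    simp only [mg]
    rw [e]
    have := hLF (fun i => if i = j then ∅ else if i ∈ σ then {∅, {j}} else ∅) (by
      intro i t ht
      split_ifs at ht with c1 c2
      · simp at ht
      · rw [Finset.mem_insert, Finset.mem_singleton] at ht
        rcases ht with ht | ht <;> simp [ht, c1]
      · simp at ht)
    convert this using 4
    funext n x y
    rw [← Finset.mul_prod_erase Finset.univ _ (Finset.mem_univ j), if_pos rfl, Finset.prod_empty, one_mul,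
      ← Finset.prod_mul_distrib]
    apply Finset.prod_congr rfl
    intro i hi
    rw [if_neg (Finset.mem_erase.mp hi).1]
    by_cases h : i ∈ σ
    · simp only [mj, h, if_true]
      rw [Finset.prod_pair (by simp [Finset.ext_iff])]
      have : ({j} : Finset ι) = insert j ∅ := by simp
      rw [this, ← pw_upd, Finset.piecewise_empty]
    · simp [mj, h]
  have e : E2 (fun n x => (mg j (mj σ ν) n x - 1) ^ 2) =
      E2 (fun n x => mg j (mj σ ν) n x * mg j (mj σ ν) n x) - 2 * E2 (fun n x => mg j (mj σ ν) n x) + 1 := by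
    rw [← E2_mul]
    conv_rhs => rw [← E2_const (Ω := Ω) (X := X) (ι := ι) 1]
    rw [← E2_sub, ← E2_add]
    congr 1; funext n x; ring
  rw [e]
  have := (abs_le.mp h1).1
  have := (abs_le.mp h2).2
  linarith

end cnt

set_option maxHeartbeats 1000000 in
/-- the relative counting lemma -/
theorem counting (ι : Type) [Fintype ι] [DecidableEq ι] (m : ℕ) : ∀ ε : ℝ, 0 < ε → ∃ ε' : ℝ, 0 < ε' ∧
    ∀ (Ω X : Type) [Fintype Ω] [Fintype X] [Nonempty Ω] [Nonempty X]
    (ν f g : ι → Ω → (ι → X) → ℝ) (σ : Finset ι), σ.card = m →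
    (∀ i, Idp i (ν i)) → (∀ i n x, 0 ≤ ν i n x) → LF ν ε' →
    (∀ i, Idp i (f i)) → (∀ i, Idp i (g i)) → (∀ i n x, 0 ≤ f i n x) →
    (∀ i ∈ σ, ∀ n x, f i n x ≤ ν i n x) → (∀ i n x, 0 ≤ g i n x) → (∀ i n x, g i n x ≤ 1) →
    (∀ i, i ∉ σ → f i = g i) →
    (∀ j ∈ σ, ∀ u : ι → Ω → (ι → X) → ℝ, (∀ i, Idp i (u i)) → (∀ i n x, |u i n x| ≤ 1) →
      |E2 (fun n x => (f j n x - g j n x) * ∏ i ∈ Finset.univ.erase j, u i n x)| ≤ ε') →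
    |E2 (fun n x => ∏ i, f i n x) - E2 (fun n x => ∏ i, g i n x)| ≤ ε := by
  induction m with
  | zero =>
    intro ε hε
    refine ⟨1, one_pos, ?_⟩
    intro Ω X _ _ _ _ ν f g σ hσ _ _ _ _ _ _ _ _ _ hfg _
    have : f = g := by
      funext i
      apply hfg; rw [Finset.card_eq_zero.mp hσ]; simp
    rw [this, sub_self, abs_zero]; exact hε.le
  | succ m ih =>
    intro ε hε
    obtain ⟨ε3, hε3, hih⟩ := ih (ε ^ 2 / 128) (by positivity)
    set ε1 := ε ^ 2 / 128 with hε1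
    have hε1p : 0 < ε1 := by positivity
    set r := Fintype.card ι - 1 with hr
    set θ := min (ε ^ 2 / 256) 1 with hθ
    have hθp : 0 < θ := by positivity
    have hθ1 : θ ≤ ε ^ 2 / 256 := min_le_left _ _
    have hθ2 : θ ≤ 1 := min_le_right _ _
    set ε4 := (ε1 / 2) ^ (2 ^ r) / 2 ^ (2 ^ r) with hε4
    have hε4p : 0 < ε4 := by positivity
    set ε' := min ε3 (min ε4 (min 1 (min (ε / 2) (θ ^ 2 / 3)))) with hε'
    have a1 : ε' ≤ ε3 := min_le_left _ _
    have a2 : ε' ≤ ε4 := (min_le_right _ _).trans (min_le_left _ _)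
    have a3 : ε' ≤ 1 := (min_le_right _ _).trans ((min_le_right _ _).trans (min_le_left _ _))
    have a4 : ε' ≤ ε / 2 := (min_le_right _ _).trans ((min_le_right _ _).trans
      ((min_le_right _ _).trans (min_le_left _ _)))
    have a5 : ε' ≤ θ ^ 2 / 3 := (min_le_right _ _).trans ((min_le_right _ _).trans
      ((min_le_right _ _).trans (min_le_right _ _)))
    refine ⟨ε', by positivity, ?_⟩
    intro Ω X _ _ _ _ ν f g σ hσ hν hν0 hLF hf hg hf0 hfν hg0 hg1 hfg hcut
    obtain ⟨j, hj⟩ : σ.Nonempty := Finset.card_pos.mp (by omega)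
    have hcard : (Finset.univ.erase j).card = r := by
      rw [Finset.card_erase_of_mem (Finset.mem_univ j), Finset.card_univ]
    have hw := fun σ σ' => weak j σ σ' ν hν hν0 hε1p.le a3 hLF (by
      rw [hcard]
      calc (2 : ℝ) ^ (2 ^ r) * ε' ≤ 2 ^ (2 ^ r) * ε4 := by gcongr
        _ = _ := by rw [hε4]; field_simp)
    have hf1 : ∀ i ≠ j, ∀ n x, f i n x ≤ mj σ ν i n x := by
      intro i _ n x
      simp only [mj]; split_ifs with h
      · exact hfν i h n x
      · rw [hfg i h]; exact hg1 _ _ _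
    have hg1' : ∀ i ≠ j, ∀ n x, g i n x ≤ mj ∅ ν i n x := by
      intro i _ n x; simp [mj, hg1 i n x]
    set f' := mg j f with hf'
    set g' := mg j g with hg'
    have w1 := hw σ σ f f hf hf hf0 hf0 hf1 hf1
    have w2 := hw σ ∅ f g hf hg hf0 hg0 hf1 hg1'
    have w3 := hw ∅ ∅ g g hg hg hg0 hg0 hg1' hg1'
    have hA : E2 (fun n x => (ν j n x - 1) * (f' n x - g' n x) ^ 2) ≤ 4 * ε1 := by
      have : E2 (fun n x => (ν j n x - 1) * (f' n x - g' n x) ^ 2) =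
          E2 (fun n x => (ν j n x - 1) * f' n x * f' n x) -
          2 * E2 (fun n x => (ν j n x - 1) * f' n x * g' n x) +
          E2 (fun n x => (ν j n x - 1) * g' n x * g' n x) := by
        rw [← E2_mul, ← E2_sub, ← E2_add]
        congr 1; funext n x; ring
      rw [this]
      have b1 := (abs_le.mp w1).2
      have b2 := (abs_le.mp w2).1
      have b3 := (abs_le.mp w3).2
      simp only [hf', hg', mg]
      linarith
    -- the induction hypothesis
    have hind : ∀ c : Ω → (ι → X) → ℝ, Idp j c → (∀ n x, 0 ≤ c n x) → (∀ n x, c n x ≤ 1) →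
        |E2 (fun n x => c n x * f' n x) - E2 (fun n x => c n x * g' n x)| ≤ ε1 := by
      intro c hc hc0 hc1
      have hup : ∀ f : ι → Ω → (ι → X) → ℝ, E2 (fun n x => c n x * mg j f n x) =
          E2 (fun n x => ∏ i, (Function.update f j c) i n x) := by
        intro f
        rw [E2_mg j f c hc]
        congr 1; funext n x
        rw [← Finset.mul_prod_erase Finset.univ _ (Finset.mem_univ j), Function.update_self]
        congr 1
        apply Finset.prod_congr rfl
        intro i hi
        rw [Function.update_of_ne (Finset.mem_erase.mp hi).1]
      rw [hup f, hup g]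
      have hupd : ∀ (f : ι → Ω → (ι → X) → ℝ) (P : ι → (Ω → (ι → X) → ℝ) → Prop), P j c → (∀ i, P i (f i)) →
          ∀ i, P i (Function.update f j c i) := by
        intro f P h1 h2 i
        by_cases hi : i = j
        · subst hi; rwa [Function.update_self]
        · rw [Function.update_of_ne hi]; exact h2 i
      apply hih Ω X ν (Function.update f j c) (Function.update g j c) (σ.erase j)
      · rw [Finset.card_erase_of_mem hj, hσ]; rfl
      · exact hν
      · exact hν0
      · intro S hS; exact (hLF S hS).trans a1
      · exact hupd f (fun i F => Idp i F) hc hf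
      · exact hupd g (fun i F => Idp i F) hc hg
      · exact hupd f (fun i F => ∀ n x, 0 ≤ F n x) hc0 hf0
      · intro i hi
        have := Finset.mem_erase.mp hi
        rw [Function.update_of_ne this.1]
        exact hfν i this.2
      · exact hupd g (fun i F => ∀ n x, 0 ≤ F n x) hc0 hg0
      · exact hupd g (fun i F => ∀ n x, F n x ≤ 1) hc1 hg1
      · intro i hi
        by_cases hij : i = j
        · subst hij; rw [Function.update_self, Function.update_self]
        · rw [Function.update_of_ne hij, Function.update_of_ne hij]
          apply hfg
          intro h; exact hi (Finset.mem_erase.mpr ⟨hij, h⟩)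
      · intro i hi u hu hu1
        have := Finset.mem_erase.mp hi
        rw [Function.update_of_ne this.1, Function.update_of_ne this.1]
        exact (hcut i this.2 u hu hu1).trans a1
    have hf'0 : ∀ n x, 0 ≤ f' n x := mg_nonneg j hf0
    have hg'0 : ∀ n x, 0 ≤ g' n x := mg_nonneg j hg0
    have hg'1 : ∀ n x, g' n x ≤ 1 := by
      intro n x
      apply av_le_of_le zero_le_one
      intro z
      exact Finset.prod_le_one (fun i _ => hg0 _ _ _) (fun i _ => hg1 _ _ _)
    have i1 := hind (fun n x => min (f' n x) 1) (by
      intro n x z; simp only [hf', mg_idp j f n x z]) (fun n x => le_min (hf'0 n x) zero_le_one)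
      (fun n x => min_le_right _ _)
    have i2 := hind g' (mg_idp j g) hg'0 hg'1
    set ν' := mg j (mj σ ν) with hν'
    have hfν' : ∀ n x, f' n x ≤ ν' n x := mg_mono j hf0 hf1
    have hvar := mg_var j σ ν hLF
    rw [← hν'] at hvar
    set e := E2 (fun n x => (ν' n x - 1) ^ 2) with he
    have heθ : e ≤ θ ^ 2 := by linarith
    have habs : E2 (fun n x => |ν' n x - 1|) ≤ θ := by
      have h1 := E2_cs (fun n x => |ν' n x - 1|) (fun (_ : Ω) (_ : ι → X) => (1 : ℝ))
      simp only [mul_one, one_pow, sq_abs] at h1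
      rw [E2_const, mul_one] at h1
      have h2 : E2 (fun n x => |ν' n x - 1|) ^ 2 ≤ θ ^ 2 := h1.trans heθ
      exact (sq_le_sq₀ (E2_nonneg fun n x => abs_nonneg _) hθp.le).mp h2
    have hB1 : E2 (fun n x => (f' n x - g' n x) * (f' n x - min (f' n x) 1)) ≤ 3 * θ := by
      have h1 : E2 (fun n x => (f' n x - g' n x) * (f' n x - min (f' n x) 1)) ≤
          E2 (fun n x => (ν' n x - 1) ^ 2 + 2 * |ν' n x - 1|) := by
        apply E2_mono
        intro n x
        have hν'0 : 0 ≤ ν' n x := (hf'0 n x).trans (hfν' n x)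
        by_cases h : f' n x ≤ 1
        · rw [min_eq_left h]; simp; positivity
        · push Not at h
          rw [min_eq_right h.le]
          have h2 := hfν' n x
          have h3 := hg'0 n x
          have h4 : |ν' n x - 1| = ν' n x - 1 := abs_of_nonneg (by linarith)
          rw [h4]
          nlinarith
      rw [E2_add, E2_mul] at h1
      nlinarith
    have hB : E2 (fun n x => (f' n x - g' n x) ^ 2) ≤ 3 * θ + 2 * ε1 := by
      have : E2 (fun n x => (f' n x - g' n x) ^ 2) =
          E2 (fun n x => (f' n x - g' n x) * (f' n x - min (f' n x) 1)) +
          (E2 (fun n x => min (f' n x) 1 * f' n x) - E2 (fun n x => min (f' n x) 1 * g' n x)) -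
          (E2 (fun n x => g' n x * f' n x) - E2 (fun n x => g' n x * g' n x)) := by
        rw [← E2_sub, ← E2_sub, ← E2_add, ← E2_sub]
        congr 1; funext n x; ring
      rw [this]
      have := (abs_le.mp i1).2
      have := (abs_le.mp i2).1
      linarith
    have hνB : E2 (fun n x => ν j n x * (f' n x - g' n x) ^ 2) ≤ ε ^ 2 / 16 := by
      have : E2 (fun n x => ν j n x * (f' n x - g' n x) ^ 2) =
          E2 (fun n x => (ν j n x - 1) * (f' n x - g' n x) ^ 2) + E2 (fun n x => (f' n x - g' n x) ^ 2) := by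
        rw [← E2_add]; congr 1; funext n x; ring
      rw [this]
      have : 0 < ε ^ 2 := by positivity
      linarith
    have hν1 : E2 (ν j) ≤ 2 := by
      have := (abs_le.mp (LF_one hLF Finset.univ j {∅} (by simp))).2
      simp only [mj, Finset.mem_univ, if_true, Finset.prod_singleton, Finset.piecewise_empty] at this
      rw [EE_of_E2 (fun n x => ν j n x)] at this
      linarith
    have hmain : |E2 (fun n x => f j n x * (f' n x - g' n x))| ≤ ε / 2 := by
      have h1 : (E2 (fun n x => f j n x * (f' n x - g' n x))) ^ 2 ≤
          E2 (ν j) * E2 (fun n x => ν j n x * (f' n x - g' n x) ^ 2) :=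
        av_cs' (fun p => by rw [abs_of_nonneg (hf0 _ _ _)]; exact hfν j hj _ _)
      have h2 : 0 ≤ E2 (fun n x => ν j n x * (f' n x - g' n x) ^ 2) :=
        E2_nonneg fun n x => mul_nonneg (hν0 _ _ _) (sq_nonneg _)
      have h3 : 0 ≤ E2 (ν j) := E2_nonneg fun n x => hν0 _ _ _
      apply abs_le_of_sq_le_sq _ (by positivity)
      nlinarith [sq_nonneg ε]
    have hsplit : E2 (fun n x => ∏ i, f i n x) - E2 (fun n x => ∏ i, g i n x) =
        E2 (fun n x => f j n x * (f' n x - g' n x)) +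
        E2 (fun n x => (f j n x - g j n x) * ∏ i ∈ Finset.univ.erase j, g i n x) := by
      have h1 : E2 (fun n x => f j n x * (f' n x - g' n x)) =
          E2 (fun n x => f j n x * ∏ i ∈ Finset.univ.erase j, f i n x) -
          E2 (fun n x => f j n x * ∏ i ∈ Finset.univ.erase j, g i n x) := by
        rw [← E2_mg j f (f j) (hf j), ← E2_mg j g (f j) (hf j), ← E2_sub]
        congr 1; funext n x; ring
      rw [h1]
      simp only [sub_mul, ← Finset.mul_prod_erase Finset.univ _ (Finset.mem_univ j)]
      rw [E2_sub]; ring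
    rw [hsplit]
    refine (abs_add_le _ _).trans ?_
    have := hcut j hj g hg (fun i n x => by rw [abs_of_nonneg (hg0 _ _ _)]; exact hg1 _ _ _)
    linarith

end GT

end

section

open Filter
open scoped BigOperators

namespace GT

set_option linter.unusedSectionVars false
set_option linter.unusedSimpArgs false
set_option linter.unusedVariables false
set_option linter.deprecated false

/-- clip to the unit interval -/
noncomputable def clip (v : ℝ) : ℝ := max 0 (min 1 v)

lemma clip_nonneg (v : ℝ) : 0 ≤ clip v := le_max_left _ _
lemma clip_le_one (v : ℝ) : clip v ≤ 1 := max_le zero_le_one (min_le_left _ _)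

lemma clip_sq {u : ℝ} (h0 : 0 ≤ u) (h1 : u ≤ 1) (v : ℝ) : (clip v - u) ^ 2 ≤ (v - u) ^ 2 := by
  unfold clip
  rcases le_total v 0 with h | h
  · rw [min_eq_right (by linarith), max_eq_left h]; nlinarith
  · rcases le_total v 1 with h' | h'
    · rw [min_eq_right h', max_eq_right h]
    · rw [min_eq_left h', max_eq_right zero_le_one]; nlinarith

/-- the dense model theorem -/
theorem dense_model (ε : ℝ) (hε : 0 < ε) : ∃ K : ℕ, ∃ ε' : ℝ, 0 < ε' ∧
    ∀ (G : Type) [Fintype G] [Nonempty G] (ν f : G → ℝ) (𝓕 : Set (G → ℝ)),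
    (∀ n, 0 ≤ ν n) → (∀ n, 0 ≤ f n) → (∀ n, f n ≤ ν n) →
    (∀ D ∈ 𝓕, ∀ n, |D n| ≤ 1) → (∀ D ∈ 𝓕, (fun n => - D n) ∈ 𝓕) →
    (∀ m ≤ K, ∀ D : Fin m → G → ℝ, (∀ l, D l ∈ 𝓕) →
      |av (fun n => (ν n - 1) * ∏ l, D l n)| ≤ ε') →
    ∃ g : G → ℝ, (∀ n, 0 ≤ g n) ∧ (∀ n, g n ≤ 1) ∧ ∀ D ∈ 𝓕, |av (fun n => (f n - g n) * D n)| ≤ ε := by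
  obtain ⟨P, hP⟩ := exists_polynomial_near_of_continuousOn (-1) 1 (fun t => max t 0)
    (by fun_prop) (ε / 24) (by positivity)
  set S : ℝ := ∑ m ∈ Finset.range (P.natDegree + 1), |P.coeff m| with hS
  have hS0 : 0 ≤ S := Finset.sum_nonneg fun _ _ => abs_nonneg _
  obtain ⟨T, hT⟩ := exists_nat_ge (2 / ε ^ 2)
  have hTp : (0 : ℝ) < T := lt_of_lt_of_le (by positivity) hT
  refine ⟨P.natDegree, min 1 (ε / (16 * (S + 1))), by positivity, ?_⟩
  intro G _ _ ν f 𝓕 hν0 hf0 hfν hF1 hFs hprod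
  by_contra hcon
  have hex : ∀ g : G → ℝ, ∃ D : G → ℝ, (∀ n, 0 ≤ g n) → (∀ n, g n ≤ 1) →
      D ∈ 𝓕 ∧ ε < av (fun n => (f n - g n) * D n) := by
    intro g
    by_contra hg
    push Not at hg
    apply hcon
    refine ⟨g, (hg (fun _ => 0)).1, (hg (fun _ => 0)).2.1, ?_⟩
    intro D hD
    rw [abs_le]
    refine ⟨?_, (hg D).2.2 hD⟩
    have := (hg (fun n => - D n)).2.2 (hFs D hD)
    simp only [mul_neg] at this
    rw [av_neg] at this
    linarith
  choose D hD using hex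
  set gs : ℕ → G → ℝ := fun t => Nat.rec (fun _ => 0) (fun _ g n => clip (g n + ε * D g n)) t with hgs
  have hgss : ∀ t n, gs (t + 1) n = clip (gs t n + ε * D (gs t) n) := fun t n => rfl
  have hg0 : ∀ t n, 0 ≤ gs t n := by
    intro t n
    cases t with
    | zero => exact le_refl _
    | succ t => rw [hgss]; exact clip_nonneg _
  have hg1 : ∀ t n, gs t n ≤ 1 := by
    intro t n
    cases t with
    | zero => exact zero_le_one
    | succ t => rw [hgss]; exact clip_le_one _
  set Ds : ℕ → G → ℝ := fun t => D (gs t) with hDs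
  have hDF : ∀ t, Ds t ∈ 𝓕 := fun t => (hD _ (hg0 t) (hg1 t)).1
  have hDe : ∀ t, ε < av (fun n => (f n - gs t n) * Ds t n) := fun t => (hD _ (hg0 t) (hg1 t)).2
  set φ : G → ℝ := fun n => ∑ t : Fin T, Ds t n with hφ
  set u : G → ℝ := fun n => if 0 < φ n then 1 else 0 with hu
  have hu0 : ∀ n, 0 ≤ u n := by intro n; simp only [hu]; split_ifs <;> norm_num
  have hu1 : ∀ n, u n ≤ 1 := by intro n; simp only [hu]; split_ifs <;> norm_num
  have hstep : ∀ t, av (fun n => (gs (t + 1) n - u n) ^ 2) ≤ av (fun n => (gs t n - u n) ^ 2) +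
      2 * ε * av (fun n => (gs t n - u n) * Ds t n) + ε ^ 2 := by
    intro t
    calc av (fun n => (gs (t + 1) n - u n) ^ 2) ≤
        av (fun n => (gs t n - u n) ^ 2 + 2 * ε * ((gs t n - u n) * Ds t n) + ε ^ 2) := by
          apply av_mono
          intro n
          rw [hgss]
          refine (clip_sq (hu0 n) (hu1 n) _).trans ?_
          have h1 : Ds t n ^ 2 ≤ 1 := by
            rw [sq_le_one_iff_abs_le_one]; exact hF1 _ (hDF t) n
          have : D (gs t) n = Ds t n := rfl
          rw [this]
          nlinarith [sq_nonneg ε]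
      _ = _ := by rw [av_add, av_add, av_mul_left, av_const]
  have htel : ∀ t : ℕ, av (fun n => (gs t n - u n) ^ 2) ≤ 1 +
      2 * ε * ∑ s : Fin t, av (fun n => (gs s n - u n) * Ds s n) + t * ε ^ 2 := by
    intro t
    induction t with
    | zero =>
      simp only [Finset.univ_eq_empty, Finset.sum_empty, mul_zero, Nat.cast_zero, zero_mul, add_zero]
      apply av_le_of_le zero_le_one
      intro n
      have : gs 0 n = 0 := rfl
      rw [this]
      nlinarith [hu0 n, hu1 n]
    | succ t ih =>
      rw [Fin.sum_univ_castSucc]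
      simp only [Fin.val_castSucc, Fin.val_last]
      have := hstep t
      push_cast
      nlinarith
  have h1 := htel T
  have h2 : 0 ≤ av (fun n => (gs T n - u n) ^ 2) := av_nonneg fun n => sq_nonneg _
  have h3 : ∑ s : Fin T, (ε : ℝ) ≤ ∑ s : Fin T, av (fun n => (f n - gs s n) * Ds s n) :=
    Finset.sum_le_sum fun s _ => (hDe s).le
  rw [Finset.sum_const, Finset.card_univ, Fintype.card_fin, nsmul_eq_mul] at h3
  have h4 : ∑ s : Fin T, av (fun n => (f n - gs s n) * Ds s n) +
      ∑ s : Fin T, av (fun n => (gs s n - u n) * Ds s n) = av (fun n => (f n - u n) * φ n) := by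
    rw [← Finset.sum_add_distrib]
    simp only [← av_add]
    rw [← av_sum]
    congr 1; funext n
    simp only [hφ, Finset.mul_sum]
    apply Finset.sum_congr rfl
    intro s _; ring
  have h5 : av (fun n => (f n - u n) * φ n) ≤ av (fun n => (ν n - 1) * max (φ n) 0) := by
    apply av_mono
    intro n
    simp only [hu]
    split_ifs with h
    · rw [max_eq_left h.le]; have := hfν n; nlinarith
    · push Not at h
      rw [max_eq_right h]; have := hf0 n; nlinarith
  have h6 : T * (ε / 4) ≤ av (fun n => (ν n - 1) * max (φ n) 0) := by
    have hT2 : 2 ≤ T * ε ^ 2 := by rwa [div_le_iff₀ (by positivity)] at hT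
    have h7 : T * ε - (1 + T * ε ^ 2) / (2 * ε) ≤ av (fun n => (ν n - 1) * max (φ n) 0) := by
      have h8 : -((1 + T * ε ^ 2) / (2 * ε)) ≤ ∑ s : Fin T, av (fun n => (gs s n - u n) * Ds s n) := by
        rw [neg_le, ← sub_nonneg, sub_neg_eq_add]
        have : 0 ≤ (1 + T * ε ^ 2 + 2 * ε * ∑ s : Fin T, av (fun n => (gs s n - u n) * Ds s n)) / (2 * ε) := by
          apply div_nonneg _ (by positivity)
          linarith
        convert this using 1
        field_simp
      linarith
    refine le_trans ?_ h7
    have : (1 + T * ε ^ 2) / (2 * ε) ≤ 3 / 4 * T * ε := by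
      rw [div_le_iff₀ (by positivity)]; nlinarith
    linarith
  -- rescale
  have hφT : ∀ n, φ n / T ∈ Set.Icc (-1 : ℝ) 1 := by
    intro n
    have : |φ n| ≤ T := by
      simp only [hφ]
      refine (Finset.abs_sum_le_sum_abs _ _).trans ?_
      calc ∑ t : Fin T, |Ds t n| ≤ ∑ t : Fin T, 1 := Finset.sum_le_sum fun t _ => hF1 _ (hDF t) n
        _ = T := by simp
    rw [Set.mem_Icc, ← abs_le, abs_div, Nat.abs_cast]
    exact div_le_one_of_le₀ this hTp.le
  have h7 : ε / 4 ≤ av (fun n => (ν n - 1) * max (φ n / T) 0) := by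
    have : av (fun n => (ν n - 1) * max (φ n / T) 0) = av (fun n => (ν n - 1) * max (φ n) 0) / T := by
      rw [div_eq_mul_inv, ← av_mul_right]
      congr 1; funext n
      have : max (φ n / T) 0 = max (φ n) 0 / T := by
        have h0 := max_div_div_right hTp.le (φ n) 0
        rw [zero_div] at h0; exact h0
      rw [this]; ring
    rw [this, le_div_iff₀ hTp]; linarith
  set ε' := min 1 (ε / (16 * (S + 1))) with hε'
  have hν2 : av ν ≤ 2 := by
    have := (abs_le.mp (hprod 0 (Nat.zero_le _) (fun _ _ => 0) (fun l => l.elim0))).2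
    simp only [Finset.univ_eq_empty, Finset.prod_empty, mul_one] at this
    rw [av_sub, av_const] at this
    have : ε' ≤ 1 := min_le_left _ _
    linarith
  have h8 : av (fun n => (ν n - 1) * max (φ n / T) 0) ≤
      av (fun n => (ν n - 1) * P.eval (φ n / T)) + ε / 8 := by
    have : av (fun n => (ν n - 1) * max (φ n / T) 0) ≤
        av (fun n => (ν n - 1) * P.eval (φ n / T) + (ν n + 1) * (ε / 24)) := by
      apply av_mono
      intro n
      have h := abs_lt.mp (hP _ (hφT n))
      have : (ν n - 1) * (max (φ n / T) 0 - P.eval (φ n / T)) ≤ (ν n + 1) * (ε / 24) := by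
        calc _ ≤ |(ν n - 1) * (max (φ n / T) 0 - P.eval (φ n / T))| := le_abs_self _
          _ = |ν n - 1| * |max (φ n / T) 0 - P.eval (φ n / T)| := abs_mul _ _
          _ ≤ _ := by
            gcongr
            · linarith [hν0 n]
            · rw [abs_le]; constructor <;> linarith [hν0 n]
            · rw [abs_le]; constructor <;> linarith
      linarith
    rw [av_add, av_mul_right, av_add, av_const] at this
    nlinarith
  have hpow : ∀ m ≤ P.natDegree, |av (fun n => (ν n - 1) * (φ n / T) ^ m)| ≤ ε' := by
    intro m hm
    have e : av (fun n => (ν n - 1) * (φ n / T) ^ m) =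
        (∑ p : Fin m → Fin T, av (fun n => (ν n - 1) * ∏ l, Ds (p l) n)) / T ^ m := by
      rw [← av_sum, div_eq_mul_inv, ← av_mul_right]
      congr 1; funext n
      rw [div_pow, ← Finset.mul_sum]
      simp only [hφ]
      rw [Fintype.sum_pow]; ring
    rw [e, abs_div, abs_of_pos (by positivity : (0 : ℝ) < (T : ℝ) ^ m), div_le_iff₀ (by positivity)]
    refine (Finset.abs_sum_le_sum_abs _ _).trans ?_
    calc _ ≤ ∑ p : Fin m → Fin T, ε' := Finset.sum_le_sum fun p _ =>
          hprod m hm (fun l => Ds (p l)) (fun l => hDF _)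
      _ = ε' * T ^ m := by simp [mul_comm]
  have h9 : av (fun n => (ν n - 1) * P.eval (φ n / T)) ≤ S * ε' := by
    have e : av (fun n => (ν n - 1) * P.eval (φ n / T)) =
        ∑ m ∈ Finset.range (P.natDegree + 1), P.coeff m * av (fun n => (ν n - 1) * (φ n / T) ^ m) := by
      simp only [← av_mul_left]
      rw [← av_sum]
      congr 1; funext n
      rw [Polynomial.eval_eq_sum_range, Finset.mul_sum]
      apply Finset.sum_congr rfl
      intro m _; ring
    rw [e, hS, Finset.sum_mul]
    apply Finset.sum_le_sum
    intro m hm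
    refine (le_abs_self _).trans ?_
    rw [abs_mul]
    exact mul_le_mul_of_nonneg_left (hpow m (by rw [Finset.mem_range] at hm; omega)) (abs_nonneg _)
  have h10 : S * ε' ≤ ε / 16 := by
    have : ε' ≤ ε / (16 * (S + 1)) := min_le_right _ _
    calc S * ε' ≤ S * (ε / (16 * (S + 1))) := by gcongr
      _ = (S / (S + 1)) * (ε / 16) := by field_simp
      _ ≤ 1 * (ε / 16) := by gcongr; exact div_le_one_of_le₀ (by linarith) (by linarith)
      _ = _ := one_mul _
  linarith

end GT

end

section

open Filter
open scoped BigOperators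

namespace GT

set_option linter.unusedSectionVars false
set_option linter.unusedSimpArgs false
set_option linter.unusedVariables false
set_option linter.deprecated false

/-- cyclic rotation -/
def rot {M : ℕ} (s : ℤ) : Fin M ≃ Fin M where
  toFun x := ⟨((((x : ℕ) : ℤ) + s) % M).toNat, by
    have := x.pos
    have h1 := Int.emod_lt_of_pos (((x : ℕ) : ℤ) + s) (by exact_mod_cast this : (0 : ℤ) < M)
    have h2 := Int.emod_nonneg (((x : ℕ) : ℤ) + s) (by omega : (M : ℤ) ≠ 0)
    omega⟩
  invFun x := ⟨((((x : ℕ) : ℤ) + -s) % M).toNat, by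
    have := x.pos
    have h1 := Int.emod_lt_of_pos (((x : ℕ) : ℤ) + -s) (by exact_mod_cast this : (0 : ℤ) < M)
    have h2 := Int.emod_nonneg (((x : ℕ) : ℤ) + -s) (by omega : (M : ℤ) ≠ 0)
    omega⟩
  left_inv x := by
    apply Fin.ext
    have := x.pos
    have h2 := Int.emod_nonneg (((x : ℕ) : ℤ) + s) (by omega : (M : ℤ) ≠ 0)
    simp only
    rw [Int.toNat_of_nonneg h2, Int.emod_add_emod, add_neg_cancel_right, Int.emod_eq_of_lt (by omega) (by
      have := x.isLt; omega)]
    simp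
  right_inv x := by
    apply Fin.ext
    have := x.pos
    have h2 := Int.emod_nonneg (((x : ℕ) : ℤ) + -s) (by omega : (M : ℤ) ≠ 0)
    simp only
    rw [Int.toNat_of_nonneg h2, Int.emod_add_emod, neg_add_cancel_right, Int.emod_eq_of_lt (by omega) (by
      have := x.isLt; omega)]
    simp

lemma rot_val {M : ℕ} (s : ℤ) (x : Fin M) (h : 0 ≤ ((x : ℕ) : ℤ) + s ∧ ((x : ℕ) : ℤ) + s < M) :
    ((rot s x : ℕ) : ℤ) = ((x : ℕ) : ℤ) + s := by
  change (((((x : ℕ) : ℤ) + s) % M).toNat : ℤ) = _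
  rw [Int.emod_eq_of_lt h.1 h.2, Int.toNat_of_nonneg h.1]

/-- wrap indicator -/
noncomputable def wr {M : ℕ} (s : ℤ) (x : Fin M) : ℝ :=
  if 0 ≤ ((x : ℕ) : ℤ) + s ∧ ((x : ℕ) : ℤ) + s < M then 0 else 1

lemma wr_nonneg {M : ℕ} (s : ℤ) (x : Fin M) : 0 ≤ wr s x := by
  unfold wr; split_ifs <;> norm_num

lemma av_wr {M : ℕ} (s : ℤ) : av (fun x : Fin M => wr s x) ≤ |(s : ℝ)| / M := by
  unfold av
  rw [Fintype.card_fin]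
  gcongr
  have : ∑ x : Fin M, wr s x = ((Finset.univ.filter fun x : Fin M =>
      ¬ (0 ≤ ((x : ℕ) : ℤ) + s ∧ ((x : ℕ) : ℤ) + s < M)).card : ℝ) := by
    rw [Finset.card_filter]; push_cast
    apply Finset.sum_congr rfl
    intro x _
    unfold wr
    split_ifs <;> simp_all
  rw [this]
  have h1 : (Finset.univ.filter fun x : Fin M =>
      ¬ (0 ≤ ((x : ℕ) : ℤ) + s ∧ ((x : ℕ) : ℤ) + s < M)).card ≤
      (Finset.Ico s 0 ∪ Finset.Ico (M : ℤ) (M + s)).card := by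
    apply Finset.card_le_card_of_injOn (fun x : Fin M => ((x : ℕ) : ℤ) + s)
    · intro x hx
      simp only [Finset.coe_filter, Finset.mem_univ, true_and, Set.mem_setOf_eq] at hx
      simp only [Finset.coe_union, Finset.coe_Ico, Set.mem_union, Set.mem_Ico]
      have := x.isLt
      omega
    · intro x _ y _ h
      simp only at h
      apply Fin.ext; omega
  have h2 := h1.trans (Finset.card_union_le _ _)
  rw [Int.card_Ico, Int.card_Ico] at h2
  have h3 : ((Finset.univ.filter fun x : Fin M =>
      ¬ (0 ≤ ((x : ℕ) : ℤ) + s ∧ ((x : ℕ) : ℤ) + s < M)).card : ℤ) ≤ |s| := by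
    rcases le_total 0 s with h | h
    · rw [abs_of_nonneg h]; omega
    · rw [abs_of_nonpos h]; omega
  exact_mod_cast h3

section
variable {κ M H : ℕ}

/-- shift vector -/
def shv (j : Fin (κ + 1)) (h : Fin κ → Fin H) : Fin (κ + 1) → ℤ :=
  j.insertNth 0 (fun a => ((κ.factorial : ℤ) / (((j.succAbove a : ℕ) : ℤ) - ((j : ℕ) : ℤ))) * (((h a : ℕ) : ℤ) + 1))

/-- rotation by the shift vector -/
def rots (s : Fin (κ + 1) → ℤ) : (Fin (κ + 1) → Fin M) ≃ (Fin (κ + 1) → Fin M) :=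
  Equiv.piCongrRight fun i => rot (s i)

lemma diff_dvd (j : Fin (κ + 1)) (a : Fin κ) :
    (((j.succAbove a : ℕ) : ℤ) - ((j : ℕ) : ℤ)) ∣ (κ.factorial : ℤ) := by
  have hne : (j.succAbove a : ℕ) ≠ (j : ℕ) := fun h => Fin.succAbove_ne j a (Fin.ext h)
  have h1 := j.isLt
  have h2 := (j.succAbove a).isLt
  rw [← Int.natAbs_dvd, Int.natCast_dvd_natCast]
  apply Nat.dvd_factorial <;> omega

lemma shv_bound (j : Fin (κ + 1)) (h : Fin κ → Fin H) (a : Fin κ) :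
    |((shv j h (j.succAbove a) : ℤ) : ℝ)| ≤ κ.factorial * H := by
  unfold shv
  rw [Fin.insertNth_apply_succAbove]
  have h1 : |(κ.factorial : ℤ) / (((j.succAbove a : ℕ) : ℤ) - ((j : ℕ) : ℤ))| ≤ (κ.factorial : ℤ) :=
    (Int.abs_ediv_le_abs _ _).trans (by simp)
  have h2 : |(((h a : ℕ) : ℤ) + 1)| ≤ (H : ℤ) := by
    have := (h a).isLt
    rw [abs_of_nonneg (by omega)]; omega
  have h3 : |((κ.factorial : ℤ) / (((j.succAbove a : ℕ) : ℤ) - ((j : ℕ) : ℤ))) * (((h a : ℕ) : ℤ) + 1)| ≤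
      (κ.factorial : ℤ) * H := by
    rw [abs_mul]
    exact mul_le_mul h1 h2 (abs_nonneg _) (by positivity)
  exact_mod_cast h3

/-- the shift form -/
def shf (h : Fin κ → Fin H) : ℤ := ∑ a, (κ.factorial : ℤ) * (((h a : ℕ) : ℤ) + 1)

lemma psi_succ (j : Fin (κ + 1)) (x : Fin (κ + 1) → Fin M) :
    psi j x = ∑ a : Fin κ, (((j.succAbove a : ℕ) : ℤ) - ((j : ℕ) : ℤ)) * (((x (j.succAbove a) : ℕ) : ℤ) + 1) := by
  unfold psi
  rw [Fin.sum_univ_succAbove _ j]; simp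

lemma psi_rots (j : Fin (κ + 1)) (h : Fin κ → Fin H) (x : Fin (κ + 1) → Fin M)
    (hx : ∀ a : Fin κ, 0 ≤ ((x (j.succAbove a) : ℕ) : ℤ) + shv j h (j.succAbove a) ∧
      ((x (j.succAbove a) : ℕ) : ℤ) + shv j h (j.succAbove a) < M) :
    psi j (rots (shv j h) x) = psi j x + shf h := by
  rw [psi_succ, psi_succ, shf, ← Finset.sum_add_distrib]
  apply Finset.sum_congr rfl
  intro a _
  have : ((rots (shv j h) x (j.succAbove a) : ℕ) : ℤ) =
      ((x (j.succAbove a) : ℕ) : ℤ) + shv j h (j.succAbove a) := rot_val _ _ (hx a)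
  rw [this]
  have h2 : (((j.succAbove a : ℕ) : ℤ) - ((j : ℕ) : ℤ)) * shv j h (j.succAbove a) =
      (κ.factorial : ℤ) * (((h a : ℕ) : ℤ) + 1) := by
    unfold shv
    rw [Fin.insertNth_apply_succAbove, ← mul_assoc, Int.mul_ediv_cancel' (diff_dvd j a)]
  rw [← h2]; ring

variable {G : Type} [CommRing G] [Fintype G]

lemma av_coord {ι X : Type} [Fintype ι] [DecidableEq ι] [Fintype X] [Nonempty X] (i : ι) (F : X → ℝ) :
    av (fun x : ι → X => F (x i)) = av F := by
  rw [← av_upd i]; simp only [Function.update_self]; rw [av_const]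

lemma prod_abs_le_one {I : Type} (s : Finset I) (f : I → ℝ) (h : ∀ i ∈ s, |f i| ≤ 1) : |∏ i ∈ s, f i| ≤ 1 := by
  rw [Finset.abs_prod]
  exact Finset.prod_le_one (fun i _ => abs_nonneg _) h

/-- shifted dual function -/
noncomputable def dsh (j : Fin (κ + 1)) (u : Fin (κ + 1) → G → (Fin (κ + 1) → Fin M) → ℝ) (n : G)
    (h : Fin κ → Fin H) (x : Fin (κ + 1) → Fin M) (a : Fin κ) : ℝ :=
  u (j.succAbove a) (n - ((psi j x : ℤ) : G)) (rots (shv j h) x)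

lemma fam_shift (hM : 0 < M) (j : Fin (κ + 1)) (u : Fin (κ + 1) → G → (Fin (κ + 1) → Fin M) → ℝ)
    (hu : ∀ i n x, |u i n x| ≤ 1) (n : G) (h : Fin κ → Fin H) :
    |av (fun x => ∏ a : Fin κ, u (j.succAbove a) (n + ((shf h : ℤ) : G) - ((psi j x : ℤ) : G)) x) -
      av (fun x => ∏ a : Fin κ, dsh j u n h x a)| ≤ 2 * κ * (κ.factorial * H / M) := by
  have : Nonempty (Fin M) := ⟨⟨0, hM⟩⟩
  rw [av_equiv (rots (M := M) (shv j h)), ← av_sub]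
  refine (abs_av_le _).trans ?_
  calc av (fun x : Fin (κ + 1) → Fin M => |∏ a : Fin κ, u (j.succAbove a) (n + ((shf h : ℤ) : G) - ((psi j (rots (shv j h) x) : ℤ) : G))
        (rots (shv j h) x) - ∏ a : Fin κ, dsh j u n h x a|)
      ≤ av (fun x : Fin (κ + 1) → Fin M => ∑ a : Fin κ, 2 * wr (shv j h (j.succAbove a)) (x (j.succAbove a))) := by
        apply av_mono
        intro x
        by_cases hx : ∀ a : Fin κ, 0 ≤ ((x (j.succAbove a) : ℕ) : ℤ) + shv j h (j.succAbove a) ∧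
          ((x (j.succAbove a) : ℕ) : ℤ) + shv j h (j.succAbove a) < M
        · rw [psi_rots j h x hx]
          have : ∀ a, u (j.succAbove a) (n + ((shf h : ℤ) : G) - ((psi j x + shf h : ℤ) : G))
              (rots (shv j h) x) = dsh j u n h x a := by
            intro a
            unfold dsh
            congr 1
            push_cast; ring
          simp only [this, sub_self, abs_zero]
          exact Finset.sum_nonneg fun a _ => mul_nonneg zero_le_two (wr_nonneg _ _)
        · push Not at hx
          obtain ⟨a, ha⟩ := hx
          have h1 : (2 : ℝ) = 2 * wr (shv j h (j.succAbove a)) (x (j.succAbove a)) := by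
            unfold wr
            rw [if_neg (by intro hc; exact absurd (ha hc.1) (not_le.mpr hc.2)), mul_one]
          have h2 := Finset.single_le_sum (f := fun a : Fin κ => 2 * wr (shv j h (j.succAbove a)) (x (j.succAbove a)))
            (fun a _ => mul_nonneg zero_le_two (wr_nonneg _ _)) (Finset.mem_univ a)
          refine le_trans ?_ h2
          rw [← h1]
          refine (abs_sub _ _).trans ?_
          have h3 := prod_abs_le_one Finset.univ (fun a : Fin κ => u (j.succAbove a) (n + ((shf h : ℤ) : G) -
            ((psi j (rots (shv j h) x) : ℤ) : G)) (rots (shv j h) x)) (fun a _ => hu _ _ _)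
          have h4 := prod_abs_le_one Finset.univ (fun a : Fin κ => dsh j u n h x a) (fun a _ => hu _ _ _)
          linarith
    _ = ∑ a : Fin κ, 2 * av (fun z : Fin M => wr (shv j h (j.succAbove a)) z) := by
        rw [av_sum]
        apply Finset.sum_congr rfl
        intro a _
        rw [av_mul_left, av_coord (j.succAbove a) (fun z => wr (shv j h (j.succAbove a)) z)]
    _ ≤ ∑ a : Fin κ, 2 * ((κ.factorial : ℝ) * H / M) := by
        apply Finset.sum_le_sum
        intro a _
        gcongr
        refine (av_wr _).trans ?_
        gcongr
        exact shv_bound j h a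
    _ = _ := by simp; ring

lemma dsh_idp (j : Fin (κ + 1)) (u : Fin (κ + 1) → G → (Fin (κ + 1) → Fin M) → ℝ)
    (hu : ∀ i, Idp i (u i)) (n : G) (h : Fin κ → Fin H) (x : Fin (κ + 1) → Fin M) (a : Fin κ) (z : Fin H) :
    dsh j u n (Function.update h a z) x a = dsh j u n h x a := by
  unfold dsh
  have : rots (shv j (Function.update h a z)) x =
      Function.update (rots (shv j h) x) (j.succAbove a)
        (rot (shv j (Function.update h a z) (j.succAbove a)) (x (j.succAbove a))) := by
    funext i
    by_cases hi : i = j.succAbove a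
    · subst hi; rw [Function.update_self]; rfl
    · rw [Function.update_of_ne hi]
      change rot (shv j (Function.update h a z) i) (x i) = rot (shv j h i) (x i)
      congr 2
      unfold shv
      rcases Fin.eq_self_or_eq_succAbove j i with hj | ⟨b, hb⟩
      · subst hj; simp
      · subst hb
        rw [Fin.insertNth_apply_succAbove, Fin.insertNth_apply_succAbove, Function.update_of_ne]
        intro hab; exact hi (by rw [hab])
  rw [this, hu]

/-- the family of dual functions -/
def Fam (κ M : ℕ) (G : Type) [CommRing G] : Set (G → ℝ) :=
  {D | ∃ j : Fin (κ + 1), ∃ c : ℝ, |c| ≤ 1 ∧ ∃ u : Fin (κ + 1) → G → (Fin (κ + 1) → Fin M) → ℝ,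
    (∀ i, Idp i (u i)) ∧ (∀ i n x, |u i n x| ≤ 1) ∧
    D = fun m => c * av (fun x => ∏ a : Fin κ, u (j.succAbove a) (m - ((psi j x : ℤ) : G)) x)}

end


lemma prod_diff_le {I : Type} (s : Finset I) (f g : I → ℝ) (hf : ∀ i ∈ s, |f i| ≤ 1) (hg : ∀ i ∈ s, |g i| ≤ 1) :
    |∏ i ∈ s, f i - ∏ i ∈ s, g i| ≤ ∑ i ∈ s, |f i - g i| := by
  classical
  induction s using Finset.induction_on with
  | empty => simp
  | insert a s ha ih =>
    rw [Finset.prod_insert ha, Finset.prod_insert ha, Finset.sum_insert ha]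
    have h1 := ih (fun i hi => hf i (Finset.mem_insert_of_mem hi)) (fun i hi => hg i (Finset.mem_insert_of_mem hi))
    have h2 := prod_abs_le_one s f (fun i hi => hf i (Finset.mem_insert_of_mem hi))
    have h3 := hg a (Finset.mem_insert_self _ _)
    calc |f a * ∏ i ∈ s, f i - g a * ∏ i ∈ s, g i|
        = |(f a - g a) * ∏ i ∈ s, f i + g a * (∏ i ∈ s, f i - ∏ i ∈ s, g i)| := by congr 1; ring
      _ ≤ |(f a - g a) * ∏ i ∈ s, f i| + |g a * (∏ i ∈ s, f i - ∏ i ∈ s, g i)| := abs_add_le _ _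
      _ ≤ |f a - g a| * 1 + 1 * ∑ i ∈ s, |f i - g i| := by
        rw [abs_mul, abs_mul]; gcongr
      _ = _ := by ring

lemma av_pi_prod {I Y : Type} [Fintype I] [DecidableEq I] [Fintype Y] (F : I → Y → ℝ) :
    ∏ l, av (F l) = av (fun y : I → Y => ∏ l, F l (y l)) := by
  simp only [av]
  rw [Finset.prod_div_distrib, Finset.prod_univ_sum, Fintype.piFinset_univ]
  simp [Fintype.card_pi]

lemma av_shift {κ H : ℕ} {G : Type} [CommRing G] [Fintype G] (hH : 0 < H) (F : G → ℝ) :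
    av F = E2 (fun (n : G) (h : Fin κ → Fin H) => F (n + ((shf h : ℤ) : G))) := by
  have : Nonempty (Fin H) := ⟨⟨0, hH⟩⟩
  rw [E2_eq, av_comm]
  have : ∀ h : Fin κ → Fin H, av (fun n => F (n + ((shf h : ℤ) : G))) = av F := by
    intro h
    exact (av_equiv (Equiv.addRight ((shf h : ℤ) : G)) F).symm
  simp only [this, av_const]

/-- second linear forms condition -/
def LF2 (κ H : ℕ) {G : Type} [CommRing G] [Fintype G] (ν : G → ℝ) (ε : ℝ) : Prop :=
  ∀ S : Finset (Finset (Fin κ)),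
    |EE (fun (n : G) (x y : Fin κ → Fin H) => ∏ t ∈ S, ν (n + ((shf (t.piecewise y x) : ℤ) : G))) - 1| ≤ ε

lemma lf2_box {κ H : ℕ} {G : Type} [CommRing G] [Fintype G] (hH : 0 < H) (ν : G → ℝ) (ε : ℝ)
    (hL : LF2 κ H ν ε) (ε1 : ℝ) (hε1 : 0 ≤ ε1) (hle : 2 ^ (2 ^ κ) * ε ≤ (ε1 / 2) ^ (2 ^ κ))
    (v : Fin κ → G → (Fin κ → Fin H) → ℝ) (hv : ∀ i, Idp i (v i)) (hv1 : ∀ i n x, |v i n x| ≤ 1) :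
    |E2 (fun n h => (ν (n + ((shf h : ℤ) : G)) - 1) * ∏ a, v a n h)| ≤ ε1 := by
  have : Nonempty (Fin H) := ⟨⟨0, hH⟩⟩
  apply gcs Finset.univ (fun (n : G) (h : Fin κ → Fin H) => ν (n + ((shf h : ℤ) : G)) - 1) v (fun _ _ _ => 1)
    (fun i _ => hv i) (fun i _ _ _ _ => rfl) (fun i _ => hv1 i) _ hε1
  · rw [Finset.card_univ, Fintype.card_fin]
    refine le_trans ?_ hle
    simp only [Dp, Finset.prod_const_one, mul_one]
    have e : (fun (n : G) (x y : Fin κ → Fin H) => ∏ t ∈ (Finset.univ : Finset (Fin κ)).powerset,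
        (ν (n + ((shf (t.piecewise y x) : ℤ) : G)) - 1)) = fun n x y =>
        ∑ S ∈ (Finset.univ : Finset (Fin κ)).powerset.powerset, (-1) ^ (S.card + 1 + (2 ^ κ + 1)) *
          (∏ t ∈ S, ν (n + ((shf (t.piecewise y x) : ℤ) : G)) - 1) := by
      funext n x y
      have h1 := Finset.prod_add (fun t => ν (n + ((shf (t.piecewise y x) : ℤ) : G))) (fun _ => (-1 : ℝ))
        (Finset.univ : Finset (Fin κ)).powerset
      have h2 := Finset.prod_add (fun t => (1 : ℝ)) (fun _ => (-1 : ℝ))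
        (Finset.univ : Finset (Fin κ)).powerset
      have h3 : ∏ i ∈ (Finset.univ : Finset (Fin κ)).powerset, ((1 : ℝ) + -1) = 0 := by
        apply Finset.prod_eq_zero (Finset.empty_mem_powerset _); norm_num
      rw [h3] at h2
      simp only [sub_eq_add_neg]
      rw [h1]
      have h4 := congrArg₂ (fun a b : ℝ => a - b) h1 h2
      rw [← sub_zero (∑ t ∈ _, _), h2, ← Finset.sum_sub_distrib]
      apply Finset.sum_congr rfl
      intro S hS
      have hc : ((Finset.univ : Finset (Fin κ)).powerset \ S).card + S.card = 2 ^ κ := by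
        rw [Finset.card_sdiff_add_card_eq_card (Finset.mem_powerset.mp hS)]; simp
      have hs : (-1 : ℝ) ^ (S.card + 1 + (2 ^ κ + 1)) =
          (-1) ^ ((Finset.univ : Finset (Fin κ)).powerset \ S).card := by
        rw [← hc]
        have : S.card + 1 + (((Finset.univ : Finset (Fin κ)).powerset \ S).card + S.card + 1) =
          ((Finset.univ : Finset (Fin κ)).powerset \ S).card + 2 * (S.card + 1) := by ring
        rw [this, pow_add, pow_mul]; norm_num
      rw [hs]
      simp only [Finset.prod_const, one_pow]
      ring
    rw [e]
    have e2 : EE (fun (n : G) (x y : Fin κ → Fin H) =>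
        ∑ S ∈ (Finset.univ : Finset (Fin κ)).powerset.powerset, (-1) ^ (S.card + 1 + (2 ^ κ + 1)) *
          (∏ t ∈ S, ν (n + ((shf (t.piecewise y x) : ℤ) : G)) - 1)) =
        ∑ S ∈ (Finset.univ : Finset (Fin κ)).powerset.powerset, (-1) ^ (S.card + 1 + (2 ^ κ + 1)) *
          (EE (fun (n : G) (x y : Fin κ → Fin H) => ∏ t ∈ S, ν (n + ((shf (t.piecewise y x) : ℤ) : G))) - 1) := by
      unfold EE
      rw [av_sum]
      apply Finset.sum_congr rfl
      intro S _
      rw [av_mul_left, av_sub, av_const]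
    rw [e2]
    refine (Finset.abs_sum_le_sum_abs _ _).trans ?_
    calc _ ≤ ∑ S ∈ (Finset.univ : Finset (Fin κ)).powerset.powerset, ε := by
          apply Finset.sum_le_sum
          intro S _
          rw [abs_mul, abs_pow, abs_neg, abs_one, one_pow, one_mul]
          exact hL S
      _ = _ := by simp
  · intro s _ i _ _
    simp only [Dp, Finset.prod_const_one]
    unfold EE
    rw [av_const]; norm_num

theorem prod_cond (κ K : ℕ) (ε : ℝ) (hε : 0 < ε) : ∃ ε2 : ℝ, 0 < ε2 ∧ ε2 ≤ 1 ∧ ∃ η : ℝ, 0 < η ∧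
    ∀ (G : Type) [CommRing G] [Fintype G] (ν : G → ℝ) (M H : ℕ), (∀ n, 0 ≤ ν n) → 0 < M → 0 < H →
    (H : ℝ) ≤ η * M → LF2 κ H ν ε2 → ∀ m ≤ K, ∀ D : Fin m → G → ℝ, (∀ l, D l ∈ Fam κ M G) →
      |av (fun n => (ν n - 1) * ∏ l, D l n)| ≤ ε := by
  set ε2 : ℝ := min 1 ((ε / 2 / 2) ^ (2 ^ κ) / 2 ^ (2 ^ κ)) with hε2
  set η : ℝ := ε / (2 * (3 * (K * (2 * κ * κ.factorial)) + 1)) with hη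
  refine ⟨ε2, by positivity, min_le_left _ _, η, by positivity, ?_⟩
  intro G _ _ ν M H hν0 hM hH hHM hL m hm D hD
  have : Nonempty (Fin H) := ⟨⟨0, hH⟩⟩
  have : Nonempty (Fin M) := ⟨⟨0, hM⟩⟩
  have hMr : (0 : ℝ) < M := by exact_mod_cast hM
  choose j c hc u hu hu1 hDe using hD
  set D' : Fin m → G → (Fin κ → Fin H) → ℝ := fun l n h =>
    c l * av (fun x => ∏ a, dsh (j l) (u l) n h x a) with hD'
  have havν : av ν ≤ 2 := by
    have h1 := (abs_le.mp (hL {∅})).2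
    simp only [Finset.prod_singleton, Finset.piecewise_empty] at h1
    rw [EE_of_E2 (fun (n : G) (x : Fin κ → Fin H) => ν (n + ((shf x : ℤ) : G))), ← av_shift hH] at h1
    have : ε2 ≤ 1 := min_le_left _ _
    linarith
  have hD1 : ∀ l n, |D l n| ≤ 1 := by
    intro l n
    rw [hDe]
    simp only [abs_mul]
    refine mul_le_one₀ (hc l) (abs_nonneg _) ((abs_av_le _).trans (av_le_of_le zero_le_one fun x => ?_))
    exact prod_abs_le_one _ _ fun a _ => hu1 _ _ _ _
  have hD1' : ∀ l n h, |D' l n h| ≤ 1 := by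
    intro l n h
    simp only [hD', abs_mul]
    refine mul_le_one₀ (hc l) (abs_nonneg _) ((abs_av_le _).trans (av_le_of_le zero_le_one fun x => ?_))
    exact prod_abs_le_one _ _ fun a _ => hu1 _ _ _ _
  have hDD : ∀ l n h, |D l (n + ((shf h : ℤ) : G)) - D' l n h| ≤ 2 * κ * (κ.factorial * H / M) := by
    intro l n h
    rw [hDe]
    simp only [hD']
    rw [← mul_sub, abs_mul]
    have := fam_shift hM (j l) (u l) (hu1 l) n h
    calc _ ≤ 1 * (2 * (κ : ℝ) * (κ.factorial * H / M)) := mul_le_mul (hc l) this (abs_nonneg _) zero_le_one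
      _ = _ := one_mul _
  rw [av_shift (κ := κ) hH]
  -- main term
  have hmain : |E2 (fun (n : G) (h : Fin κ → Fin H) => (ν (n + ((shf h : ℤ) : G)) - 1) * ∏ l, D' l n h)| ≤ ε / 2 := by
    have e : E2 (fun (n : G) (h : Fin κ → Fin H) => (ν (n + ((shf h : ℤ) : G)) - 1) * ∏ l, D' l n h) =
        (∏ l, c l) * av (fun xx : Fin m → (Fin (κ + 1) → Fin M) =>
          E2 (fun (n : G) (h : Fin κ → Fin H) => (ν (n + ((shf h : ℤ) : G)) - 1) *
            ∏ a, ∏ l, dsh (j l) (u l) n h (xx l) a)) := by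
      unfold E2
      rw [← av_comm, ← av_mul_left]
      congr 1; funext p
      simp only [hD']
      rw [Finset.prod_mul_distrib, av_pi_prod, av_mul_left]
      simp only [Finset.prod_comm (s := (Finset.univ : Finset (Fin m)))]
      ring
    rw [e, abs_mul]
    have h1 : |∏ l, c l| ≤ 1 := prod_abs_le_one _ _ fun l _ => hc l
    refine le_trans (mul_le_of_le_one_left (abs_nonneg _) h1) ?_
    refine (abs_av_le _).trans (av_le_of_le (by positivity) fun xx => ?_)
    apply lf2_box hH ν ε2 hL (ε / 2) (by positivity) _
      (fun a (n : G) (h : Fin κ → Fin H) => ∏ l, dsh (j l) (u l) n h (xx l) a)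
    · intro a n h z
      simp only [dsh_idp _ _ (hu _)]
    · intro a n h
      exact prod_abs_le_one _ _ fun l _ => hu1 _ _ _ _
    · have : ε2 ≤ (ε / 2 / 2) ^ (2 ^ κ) / 2 ^ (2 ^ κ) := min_le_right _ _
      rwa [le_div_iff₀ (by positivity), mul_comm] at this
  have herr : |E2 (fun (n : G) (h : Fin κ → Fin H) => (ν (n + ((shf h : ℤ) : G)) - 1) *
      ∏ l, D l (n + ((shf h : ℤ) : G))) -
      E2 (fun (n : G) (h : Fin κ → Fin H) => (ν (n + ((shf h : ℤ) : G)) - 1) * ∏ l, D' l n h)| ≤ ε / 2 := by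
    rw [← E2_sub]
    refine (abs_E2 _).trans ?_
    have h1 : ∀ (n : G) (h : Fin κ → Fin H), |(ν (n + ((shf h : ℤ) : G)) - 1) * ∏ l, D l (n + ((shf h : ℤ) : G)) -
        (ν (n + ((shf h : ℤ) : G)) - 1) * ∏ l, D' l n h| ≤
        (K * (2 * κ * (κ.factorial * H / M))) * (ν (n + ((shf h : ℤ) : G)) + 1) := by
      intro n h
      rw [← mul_sub, abs_mul, mul_comm]
      have a1 : |ν (n + ((shf h : ℤ) : G)) - 1| ≤ ν (n + ((shf h : ℤ) : G)) + 1 := by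
        rw [abs_le]; constructor <;> linarith [hν0 (n + ((shf h : ℤ) : G))]
      have a2 : |∏ l, D l (n + ((shf h : ℤ) : G)) - ∏ l, D' l n h| ≤ K * (2 * κ * (κ.factorial * H / M)) := by
        refine (prod_diff_le _ _ _ (fun l _ => hD1 _ _) (fun l _ => hD1' _ _ _)).trans ?_
        calc _ ≤ ∑ l : Fin m, 2 * (κ : ℝ) * (κ.factorial * H / M) := Finset.sum_le_sum fun l _ => hDD l n h
          _ = m * (2 * κ * (κ.factorial * H / M)) := by simp
          _ ≤ _ := by gcongr
      exact mul_le_mul a2 a1 (abs_nonneg _) (by positivity)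
    refine (E2_mono h1).trans ?_
    rw [E2_mul, E2_add, E2_const, ← av_shift hH]
    have h2 : (H : ℝ) / M ≤ η := by rwa [div_le_iff₀ hMr]
    have h3 : η * (2 * (3 * (K * (2 * κ * κ.factorial)) + 1)) = ε := by
      rw [hη]; field_simp
    calc _ ≤ ((K : ℝ) * (2 * κ * (κ.factorial * H / M))) * (2 + 1) := by gcongr
      _ = 3 * ((K : ℝ) * (2 * κ * κ.factorial)) * (H / M) := by ring
      _ ≤ (3 * ((K : ℝ) * (2 * κ * κ.factorial)) + 1) * η := by gcongr; linarith
      _ = ε / 2 := by linarith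
  have := abs_sub_abs_le_abs_sub (E2 (fun (n : G) (h : Fin κ → Fin H) => (ν (n + ((shf h : ℤ) : G)) - 1) *
      ∏ l, D l (n + ((shf h : ℤ) : G))))
      (E2 (fun (n : G) (h : Fin κ → Fin H) => (ν (n + ((shf h : ℤ) : G)) - 1) * ∏ l, D' l n h))
  linarith

end GT

end

section

open Filter
open scoped BigOperators

namespace GT

set_option linter.unusedSectionVars false
set_option linter.unusedSimpArgs false
set_option linter.unusedVariables false
set_option linter.deprecated false

lemma prod_erase_succAbove {κ : ℕ} (j : Fin (κ + 1)) (f : Fin (κ + 1) → ℝ) :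
    ∏ i ∈ Finset.univ.erase j, f i = ∏ a : Fin κ, f (j.succAbove a) := by
  have h := Fin.prod_univ_succAbove (fun i => if i = j then 1 else f i) j
  rw [← Finset.mul_prod_erase _ _ (Finset.mem_univ j)] at h
  simp only [if_true, one_mul, Fin.succAbove_ne, if_false] at h
  rw [← h]
  apply Finset.prod_congr rfl
  intro i hi
  rw [if_neg (Finset.ne_of_mem_erase hi)]

lemma psi_upd {κ M : ℕ} (j : Fin (κ + 1)) (x : Fin (κ + 1) → Fin M) (z : Fin M) :
    psi j (Function.update x j z) = psi j x := by
  rw [psi_succ, psi_succ]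
  apply Finset.sum_congr rfl
  intro a _
  rw [Function.update_of_ne (Fin.succAbove_ne j a)]

lemma psi_idp {κ M : ℕ} {G : Type} [CommRing G] (F : G → ℝ) (j : Fin (κ + 1)) :
    Idp j (fun (n : G) (x : Fin (κ + 1) → Fin M) => F (n + ((psi j x : ℤ) : G))) := by
  intro n x z
  simp only [psi_upd]

lemma dual_eq {κ M : ℕ} [Nonempty (Fin M)] {G : Type} [CommRing G] [Fintype G] (F : G → ℝ) (j : Fin (κ + 1))
    (u : Fin (κ + 1) → G → (Fin (κ + 1) → Fin M) → ℝ) :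
    E2 (fun (n : G) (x : Fin (κ + 1) → Fin M) => F (n + ((psi j x : ℤ) : G)) * ∏ i ∈ Finset.univ.erase j, u i n x) =
    av (fun m => F m * av (fun x => ∏ a : Fin κ, u (j.succAbove a) (m - ((psi j x : ℤ) : G)) x)) := by
  rw [E2_eq, av_comm]
  simp only [← av_mul_left]
  rw [av_comm (f := fun m x => F m * ∏ a : Fin κ, u (j.succAbove a) (m - ((psi j x : ℤ) : G)) x)]
  congr 1; funext x
  rw [av_equiv (Equiv.subRight ((psi j x : ℤ) : G))]
  simp only [Equiv.subRight_apply, sub_add_cancel, prod_erase_succAbove]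

/-- relative Szemeredi theorem -/
theorem transfer (κ : ℕ) (δ : ℝ) (hδ : 0 < δ) : ∃ ε : ℝ, 0 < ε ∧ ∃ η : ℝ, 0 < η ∧ ∃ c : ℝ, 0 < c ∧
    ∃ M0 : ℕ, 1 ≤ M0 ∧ ∀ (G : Type) [CommRing G] [Fintype G] (ν f : G → ℝ) (M H : ℕ),
    (∀ n, 0 ≤ f n) → (∀ n, f n ≤ ν n) → δ ≤ av f → M0 ≤ M → 0 < H → (H : ℝ) ≤ η * M →
    LF (fun (i : Fin (κ + 1)) (n : G) (x : Fin (κ + 1) → Fin M) => ν (n + ((psi i x : ℤ) : G))) ε →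
    LF2 κ H ν ε →
    c ≤ E2 (fun (n : G) (x : Fin (κ + 1) → Fin M) => ∏ j, f (n + ((psi j x : ℤ) : G))) := by
  obtain ⟨c, hc, M0, hM0, hsz⟩ := szem κ (δ / 2) (by positivity)
  obtain ⟨ε1, hε1, hcount⟩ := counting (Fin (κ + 1)) (κ + 1) (c / 2) (by positivity)
  obtain ⟨K, ε2, hε2, hdm⟩ := dense_model (min ε1 (δ / 2)) (by positivity)
  obtain ⟨ε3, hε3, hε31, η, hη, hpc⟩ := prod_cond κ K ε2 hε2
  refine ⟨min ε1 ε3, by positivity, η, hη, c / 2, by positivity, M0, hM0, ?_⟩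
  intro G _ _ ν f M H hf0 hfν hδf hM hH hHM hL1 hL2
  have hν0 : ∀ n, 0 ≤ ν n := fun n => (hf0 n).trans (hfν n)
  have hMp : 0 < M := by omega
  have : Nonempty (Fin M) := ⟨⟨0, hMp⟩⟩
  have hL2' : LF2 κ H ν ε3 := fun S => (hL2 S).trans (min_le_right _ _)
  obtain ⟨g, hg0, hg1, hg⟩ := hdm G ν f (Fam κ M G) hν0 hf0 hfν (by
    rintro D ⟨j, c, hc, u, hu, hu1, rfl⟩ n
    simp only [abs_mul]
    refine mul_le_one₀ hc (abs_nonneg _) ((abs_av_le _).trans (av_le_of_le zero_le_one fun x => ?_))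
    exact prod_abs_le_one _ _ fun a _ => hu1 _ _ _) (by
    rintro D ⟨j, c, hc, u, hu, hu1, rfl⟩
    refine ⟨j, -c, by rwa [abs_neg], u, hu, hu1, ?_⟩
    funext n; ring) (hpc G ν M H hν0 hMp hH hHM hL2')
  have hgav : δ / 2 ≤ av g := by
    have h1 := hg (fun _ => 1) ⟨0, 1, by simp, fun _ _ _ => 1, fun _ _ _ _ => rfl, by simp, by
      funext n; simp [av_const]⟩
    simp only [mul_one] at h1
    rw [av_sub] at h1
    have h2 := (abs_le.mp h1).2
    have h3 := min_le_right ε1 (δ / 2)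
    linarith
  have h1 := hsz G g hg0 hg1 hgav M hM
  rw [← E2_eq] at h1
  have h2 := hcount G (Fin M) (fun i n x => ν (n + ((psi i x : ℤ) : G))) (fun i n x => f (n + ((psi i x : ℤ) : G)))
    (fun i n x => g (n + ((psi i x : ℤ) : G))) Finset.univ (by simp) (fun i => psi_idp ν i) (fun i n x => hν0 _)
    (fun S hS => (hL1 S hS).trans (min_le_left _ _)) (fun i => psi_idp f i) (fun i => psi_idp g i)
    (fun i n x => hf0 _) (fun i _ n x => hfν _) (fun i n x => hg0 _) (fun i n x => hg1 _)
    (fun i hi => absurd (Finset.mem_univ i) hi) (by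
      intro j _ u hu hu1
      rw [dual_eq (fun m => f m - g m) j u]
      refine (hg _ ⟨j, 1, by simp, u, hu, hu1, ?_⟩).trans (min_le_left _ _)
      funext m; rw [one_mul])
  have h3 := (abs_le.mp h2).1
  linarith

end GT

end

section

open Filter
open scoped BigOperators

namespace GT

set_option linter.unusedSectionVars false
set_option linter.unusedSimpArgs false
set_option linter.unusedVariables false
set_option linter.deprecated false

/-- local sieve factor -/
noncomputable def hp (p : ℕ) (a : ZMod p) : ℝ := if a = 0 then -1 else 1 / ((p : ℝ) - 1)

section
variable {p : ℕ} [hpf : Fact p.Prime]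

lemma p_ge_two : (2 : ℝ) ≤ p := by exact_mod_cast hpf.out.two_le

lemma hp_abs (a : ZMod p) : |hp p a| ≤ 1 := by
  have := p_ge_two (p := p)
  unfold hp
  split_ifs
  · simp
  · rw [abs_of_nonneg (by apply div_nonneg <;> linarith), div_le_one (by linarith)]; linarith

lemma av_ite (A B : ℝ) : av (fun a : ZMod p => if a = 0 then A else B) = (A + (p - 1) * B) / p := by
  have := p_ge_two (p := p)
  unfold av
  rw [ZMod.card]
  congr 1
  have : (fun a : ZMod p => if a = 0 then A else B) = fun a => (if a = 0 then A - B else 0) + B := by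
    funext a; split_ifs <;> ring
  rw [this, Finset.sum_add_distrib]
  simp [ZMod.card]
  ring

lemma av_hp : av (hp p) = 0 := by
  have := p_ge_two (p := p)
  unfold hp
  rw [av_ite]
  have : (p : ℝ) - 1 ≠ 0 := by linarith
  field_simp; ring

lemma av_hp_sq : av (fun a => hp p a * hp p a) = 1 / ((p : ℝ) - 1) := by
  have := p_ge_two (p := p)
  have e : (fun a : ZMod p => hp p a * hp p a) = fun a => if a = 0 then 1 else (1 / ((p : ℝ) - 1)) ^ 2 := by
    funext a; unfold hp; split_ifs <;> ring
  rw [e, av_ite]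
  have : (p : ℝ) - 1 ≠ 0 := by linarith
  have : (p : ℝ) ≠ 0 := by linarith
  field_simp; ring

lemma av_hp_abs : av (fun a => |hp p a|) = 2 / p := by
  have := p_ge_two (p := p)
  have e : (fun a : ZMod p => |hp p a|) = fun a => if a = 0 then 1 else (1 / ((p : ℝ) - 1)) := by
    funext a; unfold hp; split_ifs
    · simp
    · rw [abs_of_nonneg (by apply div_nonneg <;> linarith)]
  rw [e, av_ite]
  have : (p : ℝ) - 1 ≠ 0 := by linarith
  have : (p : ℝ) ≠ 0 := by linarith
  field_simp; ring
end

/-- affine forms -/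
def zf {τ A : Type} [Fintype τ] [CommRing A] (W b : ℤ) (c : τ → ℤ) (n : A) (x : τ → A) : A :=
  (W : A) * (n + ∑ v, (c v : A) * (x v + 1)) + (b : A)

lemma zf_map {τ A B : Type} [Fintype τ] [CommRing A] [CommRing B] (f : A →+* B) (W b : ℤ) (c : τ → ℤ)
    (n : A) (x : τ → A) : f (zf W b c n x) = zf W b c (f n) (fun v => f (x v)) := by
  simp [zf, map_sum]

section
variable {p : ℕ} [hpf : Fact p.Prime] {τ I : Type} [Fintype τ] [DecidableEq τ] [Fintype I] [DecidableEq I]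

lemma av_aff {W : ZMod p} (hW : W ≠ 0) (t b : ZMod p) (F : ZMod p → ℝ) :
    av (fun n => F (W * (n + t) + b)) = av F := by
  have e := av_equiv ((Equiv.addRight t).trans ((Equiv.mulLeft₀ W hW).trans (Equiv.addRight b))) F
  rw [e]; rfl

lemma av_one_form {W b : ℤ} (hW : (W : ZMod p) ≠ 0) (c : τ → ℤ) (F : ZMod p → ℝ) :
    av (fun n : ZMod p => av (fun x : τ → ZMod p => F (zf W b c n x))) = av F := by
  rw [av_comm]
  have : ∀ x : τ → ZMod p, av (fun n => F (zf W b c n x)) = av F := fun x => av_aff hW _ _ F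
  simp only [this, av_const]

lemma av_two_form {W b : ℤ} (hW : (W : ZMod p) ≠ 0) (c c' : τ → ℤ) (v : τ)
    (hv : ((c' v - c v : ℤ) : ZMod p) ≠ 0) (F F' : ZMod p → ℝ) :
    av (fun n : ZMod p => av (fun x : τ → ZMod p => F (zf W b c n x) * F' (zf W b c' n x))) = av F * av F' := by
  rw [av_comm]
  have h1 : ∀ x : τ → ZMod p, av (fun n => F (zf W b c n x) * F' (zf W b c' n x)) =
      av (fun n => F ((W : ZMod p) * n + b) * F' (W * (n + ∑ v, ((c' v - c v : ℤ) : ZMod p) * (x v + 1)) + b)) := by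
    intro x
    rw [av_equiv (Equiv.subRight (∑ v, (c v : ZMod p) * (x v + 1)))]
    congr 1; funext n
    unfold zf
    simp only [Equiv.subRight_apply, sub_add_cancel]
    congr 4
    simp only [Int.cast_sub, sub_mul, Finset.sum_sub_distrib]; ring
  simp only [h1]
  rw [av_comm]
  have h2 : ∀ n : ZMod p, av (fun x : τ → ZMod p => F ((W : ZMod p) * n + b) *
      F' (W * (n + ∑ v, ((c' v - c v : ℤ) : ZMod p) * (x v + 1)) + b)) = F (W * n + b) * av F' := by
    intro n
    rw [av_mul_left]
    congr 1
    rw [← av_upd v]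
    have h3 : ∀ x : τ → ZMod p, av (fun z => F' (W * (n + ∑ u, ((c' u - c u : ℤ) : ZMod p) *
        ((Function.update x v z) u + 1)) + b)) = av F' := by
      intro x
      have h4 : ∀ z, F' (W * (n + ∑ u, ((c' u - c u : ℤ) : ZMod p) * ((Function.update x v z) u + 1)) + b) =
          F' (W * (((c' v - c v : ℤ) : ZMod p) * (z + 1) + (n + ∑ u ∈ Finset.univ.erase v, ((c' u - c u : ℤ) : ZMod p) *
            (x u + 1))) + b) := by
        intro z
        congr 3
        rw [← Finset.add_sum_erase _ _ (Finset.mem_univ v), Function.update_self]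
        rw [Finset.sum_congr rfl (fun u hu => by rw [Function.update_of_ne (Finset.ne_of_mem_erase hu)])]
        ring
      simp only [h4]
      rw [← av_aff hW (n + ∑ u ∈ Finset.univ.erase v, ((c' u - c u : ℤ) : ZMod p) * (x u + 1)) b F']
      have := av_aff hv 1 0 (fun y => F' (W * (y + (n + ∑ u ∈ Finset.univ.erase v, ((c' u - c u : ℤ) : ZMod p) *
            (x u + 1))) + b))
      simp only [add_zero] at this
      exact this
    simp only [h3, av_const]
  simp only [h2]
  rw [av_mul_right]
  congr 1
  have := av_aff hW 0 b F
  simpa using this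

/-- local average -/
noncomputable def eloc (p : ℕ) [Fact p.Prime] (W b : ℤ) (c : I → τ → ℤ) (T : Finset (I × Bool)) : ℝ :=
  av (fun n : ZMod p => av (fun x : τ → ZMod p => ∏ i ∈ T, hp p (zf W b (c i.1) n x)))

/-- model factor -/
noncomputable def k0 (p : ℕ) (u v : Prop) : ℝ := by
  classical
  exact if u ∧ v then 1 / ((p : ℝ) - 1) else if u ∨ v then 0 else 1

/-- model local average -/
noncomputable def emod (p : ℕ) (T : Finset (I × Bool)) : ℝ := ∏ s : I, k0 p ((s, false) ∈ T) ((s, true) ∈ T)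

lemma k0_nonneg (u v : Prop) : 0 ≤ k0 p u v := by
  have := p_ge_two (p := p)
  unfold k0
  split_ifs
  · apply div_nonneg <;> linarith
  · exact le_rfl
  · exact zero_le_one

lemma k0_le_one (u v : Prop) : k0 p u v ≤ 1 := by
  have := p_ge_two (p := p)
  unfold k0
  split_ifs
  · rw [div_le_one (by linarith)]; linarith
  · exact zero_le_one
  · exact le_rfl

lemma k0_le (u v : Prop) (h : u ∨ v) : k0 p u v ≤ 2 / p := by
  have := p_ge_two (p := p)
  unfold k0
  split_ifs
  · rw [div_le_div_iff₀ (by linarith) (by linarith)]; linarith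
  · positivity

lemma loc_close {W b : ℤ} (hW : (W : ZMod p) ≠ 0) (c : I → τ → ℤ)
    (hc : ∀ s s', s ≠ s' → ∃ v, ((c s' v - c s v : ℤ) : ZMod p) ≠ 0) (T : Finset (I × Bool)) :
    |eloc p W b c T - emod p T| ≤ 8 / (p : ℝ) ^ 2 := by
  have hp2 := p_ge_two (p := p)
  by_cases h : ∃ s s', s ≠ s' ∧ (∃ i ∈ T, i.1 = s) ∧ (∃ i ∈ T, i.1 = s')
  · obtain ⟨s, s', hne, ⟨i, hi, rfl⟩, ⟨i', hi', rfl⟩⟩ := h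
    have h1 : |eloc p W b c T| ≤ 4 / (p : ℝ) ^ 2 := by
      obtain ⟨v, hv⟩ := hc _ _ hne
      have h2 := av_two_form (b := b) hW (c i.1) (c i'.1) v hv (fun a => |hp p a|) (fun a => |hp p a|)
      rw [av_hp_abs] at h2
      have h3 : (2 : ℝ) / p * (2 / p) = 4 / (p : ℝ) ^ 2 := by ring
      rw [← h3, ← h2]
      unfold eloc
      refine (abs_av_le _).trans (av_mono fun n => (abs_av_le _).trans (av_mono fun x => ?_))
      rw [Finset.abs_prod]
      have hne' : i ≠ i' := fun h => hne (by rw [h])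
      have hsub : ({i, i'} : Finset (I × Bool)) ⊆ T := by
        intro a ha
        simp only [Finset.mem_insert, Finset.mem_singleton] at ha
        rcases ha with rfl | rfl <;> assumption
      rw [← Finset.prod_sdiff hsub, Finset.prod_pair hne']
      exact mul_le_of_le_one_left (by positivity)
        (Finset.prod_le_one (fun _ _ => abs_nonneg _) (fun _ _ => hp_abs _))
    have h2 : |emod p T| ≤ 4 / (p : ℝ) ^ 2 := by
      unfold emod
      rw [abs_of_nonneg (Finset.prod_nonneg fun s _ => k0_nonneg _ _)]
      rw [← Finset.prod_sdiff (Finset.subset_univ {i.1, i'.1}), Finset.prod_pair hne]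
      have key : ∀ j ∈ T, (j.1, false) ∈ T ∨ (j.1, true) ∈ T := by
        rintro ⟨j, b⟩ hj
        cases b
        · exact Or.inl hj
        · exact Or.inr hj
      have a1 := k0_le (p := p) _ _ (key i hi)
      have a2 := k0_le (p := p) _ _ (key i' hi')
      calc _ ≤ 1 * (2 / (p : ℝ) * (2 / p)) := by
            apply mul_le_mul (Finset.prod_le_one (fun _ _ => k0_nonneg _ _) (fun _ _ => k0_le_one _ _))
            · exact mul_le_mul a1 a2 (k0_nonneg _ _) (by positivity)
            · exact mul_nonneg (k0_nonneg _ _) (k0_nonneg _ _)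
            · exact zero_le_one
        _ = _ := by ring
    calc _ ≤ |eloc p W b c T| + |emod p T| := abs_sub _ _
      _ ≤ 4 / (p : ℝ) ^ 2 + 4 / (p : ℝ) ^ 2 := add_le_add h1 h2
      _ = _ := by ring
  · have : eloc p W b c T = emod p T := by
      rcases T.eq_empty_or_nonempty with rfl | ⟨i0, hi0⟩
      · simp [eloc, emod, k0, av_const]
      · push Not at h
        have hall : ∀ i ∈ T, i.1 = i0.1 := by
          intro i hi
          by_contra hne
          exact h i.1 i0.1 hne ⟨i, hi, rfl⟩ i0 hi0 rfl
        set s := i0.1 with hs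
        have h1 : emod p T = k0 p ((s, false) ∈ T) ((s, true) ∈ T) := by
          unfold emod
          apply Finset.prod_eq_single s
          · intro s' _ hne
            have : ∀ b, (s', b) ∉ T := fun b hb => hne (hall _ hb)
            simp [k0, this]
          · intro h; exact absurd (Finset.mem_univ s) h
        rw [h1]
        have hi0' : (s, i0.2) ∈ T := hi0
        have hmem : ∀ i, i ∈ T ↔ i.1 = s ∧ (s, i.2) ∈ T := by
          intro i
          constructor
          · intro hi; refine ⟨hall i hi, ?_⟩; rw [← hall i hi]; exact hi
          · rintro ⟨h1, h2⟩; rw [← h1] at h2; exact h2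
        unfold eloc
        by_cases hf : (s, false) ∈ T <;> by_cases ht : (s, true) ∈ T
        · have : T = {(s, false), (s, true)} := by
            ext ⟨a, b⟩
            rw [hmem]
            cases b <;> simp [hf, ht]
          rw [this]
          have hne : ((s, false) : I × Bool) ≠ (s, true) := by simp
          simp only [Finset.prod_pair hne]
          rw [av_one_form hW (c s) (fun a => hp p a * hp p a), av_hp_sq]
          simp [k0]
        · have : T = {(s, false)} := by
            ext ⟨a, b⟩
            rw [hmem]
            cases b <;> simp [hf, ht]
          rw [this]
          simp only [Finset.prod_singleton]
          rw [av_one_form hW (c s) (fun a => hp p a), av_hp]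
          simp [k0]
        · have : T = {(s, true)} := by
            ext ⟨a, b⟩
            rw [hmem]
            cases b <;> simp [hf, ht]
          rw [this]
          simp only [Finset.prod_singleton]
          rw [av_one_form hW (c s) (fun a => hp p a), av_hp]
          simp [k0]
        · exfalso
          cases hb : i0.2 <;> rw [hb] at hi0' <;> contradiction
    rw [this, sub_self, abs_zero]; positivity

lemma emod_nonneg (T : Finset (I × Bool)) : 0 ≤ emod p T := Finset.prod_nonneg fun s _ => k0_nonneg _ _

end
end GT

end

section

open Filter
open scoped BigOperators

namespace GT

set_option linter.unusedSectionVars false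
set_option linter.unusedSimpArgs false
set_option linter.unusedVariables false
set_option linter.deprecated false

/-- transpose of a relation -/
def relEquiv (α β : Type) [Fintype α] [DecidableEq α] [Fintype β] [DecidableEq β] :
    (α → Finset β) ≃ (β → Finset α) where
  toFun f b := Finset.univ.filter fun a => b ∈ f a
  invFun g a := Finset.univ.filter fun b => a ∈ g b
  left_inv f := by funext a; ext b; simp
  right_inv g := by funext b; ext a; simp

/-- slices of a finite set -/
def sliceEquiv (I : Type) [Fintype I] [DecidableEq I] : Finset (I × Bool) ≃ (I → Finset Bool) where
  toFun T s := Finset.univ.filter fun b => (s, b) ∈ T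
  invFun f := Finset.univ.filter fun i => i.2 ∈ f i.1
  left_inv T := by ext ⟨s, b⟩; simp
  right_inv f := by funext s; ext b; simp

/-- pairing up -/
def pairEquiv (I X : Type) : (I → X × X) ≃ (I × Bool → X) where
  toFun f i := if i.2 then (f i.1).2 else (f i.1).1
  invFun g s := (g (s, false), g (s, true))
  left_inv f := by funext s; simp
  right_inv g := by funext ⟨s, b⟩; cases b <;> simp

lemma prod_pert {α : Type} (s : Finset α) (a b d : α → ℝ) (hb : ∀ i ∈ s, 0 ≤ b i)
    (h : ∀ i ∈ s, |a i - b i| ≤ d i) :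
    |∏ i ∈ s, a i - ∏ i ∈ s, b i| ≤ ∏ i ∈ s, (b i + d i) - ∏ i ∈ s, b i := by
  classical
  induction s using Finset.induction_on with
  | empty => simp
  | insert i s hi ih =>
    rw [Finset.prod_insert hi, Finset.prod_insert hi, Finset.prod_insert hi]
    have h1 := ih (fun j hj => hb j (Finset.mem_insert_of_mem hj)) (fun j hj => h j (Finset.mem_insert_of_mem hj))
    have hbi := hb i (Finset.mem_insert_self _ _)
    have hdi := h i (Finset.mem_insert_self _ _)
    have hd0 : 0 ≤ d i := (abs_nonneg _).trans hdi
    have hB : 0 ≤ ∏ j ∈ s, b j := Finset.prod_nonneg fun j hj => hb j (Finset.mem_insert_of_mem hj)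
    have hA : |∏ j ∈ s, a j| ≤ ∏ j ∈ s, (b j + d j) := by
      rw [Finset.abs_prod]
      apply Finset.prod_le_prod (fun _ _ => abs_nonneg _)
      intro j hj
      have h2 := h j (Finset.mem_insert_of_mem hj)
      have h3 := abs_sub_abs_le_abs_sub (a j) (b j)
      rw [abs_of_nonneg (hb j (Finset.mem_insert_of_mem hj))] at h3
      linarith
    calc |a i * ∏ j ∈ s, a j - b i * ∏ j ∈ s, b j|
        = |(a i - b i) * ∏ j ∈ s, a j + b i * (∏ j ∈ s, a j - ∏ j ∈ s, b j)| := by congr 1; ring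
      _ ≤ |(a i - b i) * ∏ j ∈ s, a j| + |b i * (∏ j ∈ s, a j - ∏ j ∈ s, b j)| := abs_add_le _ _
      _ ≤ d i * ∏ j ∈ s, (b j + d j) + b i * (∏ j ∈ s, (b j + d j) - ∏ j ∈ s, b j) := by
        rw [abs_mul, abs_mul, abs_of_nonneg hbi]
        apply add_le_add
        · exact mul_le_mul hdi hA (abs_nonneg _) hd0
        · exact mul_le_mul_of_nonneg_left h1 hbi
      _ = _ := by ring

section
variable {Pr I : Type} [Fintype Pr] [DecidableEq Pr] [Fintype I] [DecidableEq I]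

lemma sum_pattern {β : Type} [Fintype β] [DecidableEq β] (F : Pr → Finset β → ℝ) :
    ∑ A : β → Finset Pr, ∏ p : Pr, F p (Finset.univ.filter fun i => p ∈ A i) = ∏ p : Pr, ∑ T, F p T := by
  rw [Finset.prod_univ_sum, Fintype.piFinset_univ]
  exact Fintype.sum_equiv (relEquiv β Pr) _ _ (fun A => rfl)

lemma sum_emod (p : ℕ) : ∑ T : Finset (I × Bool), emod p T = (1 + 1 / ((p : ℝ) - 1)) ^ (Fintype.card I) := by
  have h1 : ∑ T : Finset (I × Bool), emod p T = ∑ f : I → Finset Bool, ∏ s, k0 p (false ∈ f s) (true ∈ f s) := by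
    apply Fintype.sum_equiv (sliceEquiv I)
    intro T
    unfold emod
    simp [sliceEquiv]
  rw [h1, ← Fintype.piFinset_univ, ← Finset.prod_univ_sum (fun _ => Finset.univ) (fun _ S => k0 p (false ∈ S) (true ∈ S))]
  have h2 : ∑ S : Finset Bool, k0 p (false ∈ S) (true ∈ S) = 1 + 1 / ((p : ℝ) - 1) := by
    have : (Finset.univ : Finset (Finset Bool)) = {∅, {false}, {true}, {false, true}} := by decide
    rw [this, Finset.sum_insert (by decide), Finset.sum_insert (by decide), Finset.sum_insert (by decide),
      Finset.sum_singleton]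
    simp [k0]
  rw [h2]; simp

/-- the sieve mass -/
noncomputable def Vs (q : Pr → ℕ) (𝓡 : Finset (Finset Pr)) : ℝ := ∑ A ∈ 𝓡, ∏ p ∈ A, 1 / ((q p : ℝ) - 1)

lemma sum_model (q : Pr → ℕ) (𝓡 : Finset (Finset Pr)) :
    ∑ A ∈ Fintype.piFinset (fun _ : I × Bool => 𝓡), ∏ p : Pr, emod (q p) (Finset.univ.filter fun i => p ∈ A i) =
    Vs q 𝓡 ^ (Fintype.card I) := by
  set Φ : Finset Pr × Finset Pr → ℝ := fun a => ∏ p, k0 (q p) (p ∈ a.1) (p ∈ a.2) with hΦ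
  have h1 : ∑ A ∈ Fintype.piFinset (fun _ : I × Bool => 𝓡), ∏ p : Pr, emod (q p) (Finset.univ.filter fun i => p ∈ A i)
      = ∑ B ∈ Fintype.piFinset (fun _ : I => 𝓡 ×ˢ 𝓡), ∏ s, Φ (B s) := by
    symm
    apply Finset.sum_equiv (pairEquiv I (Finset Pr))
    · intro B
      simp only [Fintype.mem_piFinset, Finset.mem_product, pairEquiv, Equiv.coe_fn_mk]
      constructor
      · rintro h ⟨s, b⟩; cases b <;> simp [h s]
      · intro h s
        have h1 := h (s, false)
        have h2 := h (s, true)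
        simpa using ⟨h1, h2⟩
    · intro B _
      simp only [hΦ, emod]
      rw [Finset.prod_comm]
      apply Finset.prod_congr rfl
      intro p _
      apply Finset.prod_congr rfl
      intro s _
      congr 1
      · rw [Finset.mem_filter]; simp [pairEquiv]
      · rw [Finset.mem_filter]; simp [pairEquiv]
  rw [h1, ← Finset.prod_univ_sum (fun _ => 𝓡 ×ˢ 𝓡) (fun _ a => Φ a)]
  have h2 : ∑ a ∈ 𝓡 ×ˢ 𝓡, Φ a = Vs q 𝓡 := by
    rw [Finset.sum_product, Vs]
    apply Finset.sum_congr rfl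
    intro A hA
    rw [Finset.sum_eq_single A]
    · simp only [hΦ]
      rw [← Finset.prod_subset (Finset.subset_univ A)]
      · apply Finset.prod_congr rfl
        intro p hp; simp [k0, hp]
      · intro p _ hp; simp [k0, hp]
    · intro B _ hBA
      have : ∃ p, ¬ (p ∈ A ↔ p ∈ B) := by
        by_contra hcon
        push Not at hcon
        exact hBA (Finset.ext fun p => (hcon p).symm)
      obtain ⟨p, hp⟩ := this
      simp only [hΦ]
      apply Finset.prod_eq_zero (Finset.mem_univ p)
      unfold k0
      by_cases a : p ∈ A <;> by_cases b : p ∈ B <;> simp_all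
    · intro h; exact absurd hA h
  rw [h2]; simp

lemma sum_close (q : Pr → ℕ) (hq : ∀ p, (q p).Prime) (𝓡 : Finset (Finset Pr)) (e : Pr → Finset (I × Bool) → ℝ)
    (he : ∀ p T, |e p T - emod (q p) T| ≤ 8 / (q p : ℝ) ^ 2) :
    |∑ A ∈ Fintype.piFinset (fun _ : I × Bool => 𝓡), ∏ p : Pr, e p (Finset.univ.filter fun i => p ∈ A i) -
      Vs q 𝓡 ^ (Fintype.card I)| ≤
    (∏ p, (1 + 1 / ((q p : ℝ) - 1))) ^ (Fintype.card I) *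
      (Real.exp (∑ p, 8 * 4 ^ (Fintype.card I) / (q p : ℝ) ^ 2) - 1) := by
  set m := Fintype.card I with hm
  have h0 : ∀ p T, 0 ≤ emod (I := I) (q p) T := by
    intro p T
    have : Fact (q p).Prime := ⟨hq p⟩
    exact emod_nonneg T
  have hd : ∀ p, 0 ≤ 8 / (q p : ℝ) ^ 2 := fun p => by positivity
  rw [← sum_model, ← Finset.sum_sub_distrib]
  refine (Finset.abs_sum_le_sum_abs _ _).trans ?_
  calc _ ≤ ∑ A ∈ Fintype.piFinset (fun _ : I × Bool => 𝓡),
        (∏ p : Pr, (emod (q p) (Finset.univ.filter fun i => p ∈ A i) + 8 / (q p : ℝ) ^ 2) -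
          ∏ p : Pr, emod (q p) (Finset.univ.filter fun i => p ∈ A i)) := by
        apply Finset.sum_le_sum
        intro A _
        exact prod_pert _ _ _ _ (fun p _ => h0 _ _) (fun p _ => he _ _)
    _ ≤ ∑ A : I × Bool → Finset Pr,
        (∏ p : Pr, (emod (q p) (Finset.univ.filter fun i => p ∈ A i) + 8 / (q p : ℝ) ^ 2) -
          ∏ p : Pr, emod (q p) (Finset.univ.filter fun i => p ∈ A i)) := by
        apply Finset.sum_le_sum_of_subset_of_nonneg (Finset.subset_univ _)
        intro A _ _
        rw [sub_nonneg]
        apply Finset.prod_le_prod (fun _ _ => h0 _ _)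
        intro p _; linarith [hd p]
    _ = ∏ p : Pr, ((1 + 1 / ((q p : ℝ) - 1)) ^ m + 8 * 4 ^ m / (q p : ℝ) ^ 2) -
        ∏ p : Pr, (1 + 1 / ((q p : ℝ) - 1)) ^ m := by
        rw [Finset.sum_sub_distrib,
          sum_pattern (fun p (T : Finset (I × Bool)) => emod (q p) T + 8 / (q p : ℝ) ^ 2),
          sum_pattern (fun p (T : Finset (I × Bool)) => emod (q p) T)]
        simp only [Finset.sum_add_distrib, sum_emod]
        congr 1
        apply Finset.prod_congr rfl
        intro p _
        congr 1
        rw [Finset.sum_const, Finset.card_univ, Fintype.card_finset, Fintype.card_prod, Fintype.card_bool, nsmul_eq_mul]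
        push_cast
        rw [← hm, mul_comm m 2, pow_mul]; norm_num; ring
    _ ≤ (∏ p : Pr, (1 + 1 / ((q p : ℝ) - 1)) ^ m) * Real.exp (∑ p, 8 * 4 ^ m / (q p : ℝ) ^ 2) -
        ∏ p : Pr, (1 + 1 / ((q p : ℝ) - 1)) ^ m := by
        apply sub_le_sub_right
        rw [Real.exp_sum, ← Finset.prod_mul_distrib]
        have h1 : ∀ p, 1 ≤ (1 + 1 / ((q p : ℝ) - 1)) ^ m := by
          intro p
          apply one_le_pow₀
          have : (2 : ℝ) ≤ q p := by exact_mod_cast (hq p).two_le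
          have : 0 ≤ 1 / ((q p : ℝ) - 1) := by apply div_nonneg <;> linarith
          linarith
        apply Finset.prod_le_prod
        · intro p _
          have := h1 p
          positivity
        · intro p _
          have h2 := h1 p
          have h3 := Real.add_one_le_exp (8 * 4 ^ m / (q p : ℝ) ^ 2)
          have h4 : 0 ≤ 8 * 4 ^ m / (q p : ℝ) ^ 2 := by positivity
          nlinarith
    _ = _ := by rw [Finset.prod_pow]; ring

end
end GT

end

section

open Filter
open scoped BigOperators

namespace GT

set_option linter.unusedSectionVars false
set_option linter.unusedSimpArgs false
set_option linter.unusedVariables false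
set_option linter.deprecated false

lemma av_pi_prod_dep {I : Type} [Fintype I] [DecidableEq I] {Y : I → Type} [∀ i, Fintype (Y i)]
    (F : ∀ i, Y i → ℝ) : av (fun y : (∀ i, Y i) => ∏ l, F l (y l)) = ∏ l, av (F l) := by
  simp only [av]
  rw [Finset.prod_div_distrib, Finset.prod_univ_sum, Fintype.piFinset_univ]
  simp [Fintype.card_pi]

section
variable {Pr τ : Type} [Fintype Pr] [DecidableEq Pr] [Fintype τ] [DecidableEq τ]
variable (q : Pr → ℕ) [hq : ∀ p, Fact (q p).Prime]

lemma prod_ne (U : Finset Pr) : NeZero (∏ p ∈ U, q p) :=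
  ⟨Finset.prod_ne_zero_iff.mpr fun p _ => (hq p).out.ne_zero⟩

lemma crt_inj (hinj : Function.Injective q) (U : Finset Pr) (a a' : ZMod (∏ p ∈ U, q p))
    (h : ∀ p ∈ U, ((a.val : ℕ) : ZMod (q p)) = ((a'.val : ℕ) : ZMod (q p))) : a = a' := by
  have hne := prod_ne q U
  have h1 : ((∏ p ∈ U, q p : ℕ) : ℤ) ∣ (a.val : ℤ) - (a'.val : ℤ) := by
    push_cast
    apply Finset.prod_dvd_of_coprime
    · intro p _ p' _ hpp
      apply Nat.isCoprime_iff_coprime.mpr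
      exact (Nat.coprime_primes (hq p).out (hq p').out).mpr fun h => hpp (hinj h)
    · intro p hp
      have h2 := h p hp
      rw [← ZMod.intCast_zmod_eq_zero_iff_dvd]
      push_cast
      rw [h2, sub_self]
  have h3 : (a.val : ZMod (∏ p ∈ U, q p)) = (a'.val : ZMod (∏ p ∈ U, q p)) := by
    have := (ZMod.intCast_zmod_eq_zero_iff_dvd ((a.val : ℤ) - (a'.val : ℤ)) (∏ p ∈ U, q p)).mpr h1
    push_cast at this
    exact sub_eq_zero.mp this
  rwa [ZMod.natCast_zmod_val, ZMod.natCast_zmod_val] at h3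

lemma crt_av (hinj : Function.Injective q) (U : Finset Pr) [NeZero (∏ p ∈ U, q p)]
    (F : ∀ p, ZMod (q p) → (τ → ZMod (q p)) → ℝ) :
    av (fun w : ZMod (∏ p ∈ U, q p) × (τ → ZMod (∏ p ∈ U, q p)) =>
      ∏ p ∈ U, F p (w.1.val : ZMod (q p)) (fun v => ((w.2 v).val : ZMod (q p)))) =
    ∏ p ∈ U, av (fun n : ZMod (q p) => av (fun x : τ → ZMod (q p) => F p n x)) := by
  let E : ZMod (∏ p ∈ U, q p) × (τ → ZMod (∏ p ∈ U, q p)) → ∀ p : U, ZMod (q p) × (τ → ZMod (q p)) :=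
    fun w p => ((w.1.val : ZMod (q p)), fun v => ((w.2 v).val : ZMod (q p)))
  have hE : Function.Bijective E := by
    rw [Fintype.bijective_iff_injective_and_card]
    constructor
    · rintro ⟨a, y⟩ ⟨a', y'⟩ h
      have h1 : ∀ p : U, E (a, y) p = E (a', y') p := fun p => congrFun h p
      apply Prod.ext
      · apply crt_inj q hinj U
        intro p hp
        exact (Prod.ext_iff.mp (h1 ⟨p, hp⟩)).1
      · funext v
        apply crt_inj q hinj U
        intro p hp
        exact congrFun (Prod.ext_iff.mp (h1 ⟨p, hp⟩)).2 v
    · rw [Fintype.card_prod, Fintype.card_pi, Fintype.card_pi]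
      simp only [Fintype.card_prod, Fintype.card_pi, ZMod.card, Finset.prod_const, Finset.prod_mul_distrib,
        Finset.prod_pow]
      rw [Finset.prod_coe_sort U q]
  have e1 := av_equiv (Equiv.ofBijective E hE) (fun y => ∏ p : U, F p.1 (y p).1 (y p).2)
  rw [av_pi_prod_dep (fun (p : U) (w : ZMod (q p) × (τ → ZMod (q p))) => F p.1 w.1 w.2)] at e1
  simp only [av_prod] at e1
  rw [Finset.prod_coe_sort U (fun p => av (fun n : ZMod (q p) => av (fun x : τ → ZMod (q p) => F p n x)))] at e1
  rw [e1, av_prod]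
  congr 1; funext a
  congr 1; funext y
  rw [← Finset.prod_coe_sort U]
  rfl

lemma equidist (hinj : Function.Injective q) (U : Finset Pr) {N B : ℕ} (hN : 0 < N) (hB : 0 < B)
    (F : ∀ p, ZMod (q p) → (τ → ZMod (q p)) → ℝ) (hF : ∀ p n x, |F p n x| ≤ 1) :
    |av (fun w : Fin N × (τ → Fin B) => ∏ p ∈ U, F p ((w.1 : ℕ) : ZMod (q p)) (fun v => ((w.2 v : ℕ) : ZMod (q p)))) -
      ∏ p ∈ U, av (fun n : ZMod (q p) => av (fun x : τ → ZMod (q p) => F p n x))| ≤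
    2 * (∏ p ∈ U, (q p : ℝ)) * (1 / N + Fintype.card τ / B) := by
  have hne := prod_ne q U
  have : Nonempty (Fin N) := ⟨⟨0, hN⟩⟩
  have : Nonempty (Fin B) := ⟨⟨0, hB⟩⟩
  set Q := ∏ p ∈ U, q p with hQ
  set Φ : ℤ → (τ → ℤ) → ℝ := fun n x => ∏ p ∈ U, F p (n : ZMod (q p)) (fun v => (x v : ZMod (q p))) with hΦ
  have hΦ1 : ∀ n x, |Φ n x| ≤ 1 := fun n x => prod_abs_le_one _ _ fun p _ => hF _ _ _
  have e0 : av (fun w : Fin N × (τ → Fin B) => ∏ p ∈ U, F p ((w.1 : ℕ) : ZMod (q p)) (fun v => ((w.2 v : ℕ) : ZMod (q p)))) =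
      av (fun w : Fin N × (τ → Fin B) => Φ ((w.1 : ℕ) : ℤ) (fun v => ((w.2 v : ℕ) : ℤ))) := by
    simp only [hΦ, Int.cast_natCast]
  have e1 : ∀ w : Fin N × (τ → Fin B), av (fun r : ZMod Q × (τ → ZMod Q) =>
      Φ (((w.1 : ℕ) : ℤ) + (r.1.val : ℕ)) (fun v => ((w.2 v : ℕ) : ℤ) + ((r.2 v).val : ℕ))) =
      ∏ p ∈ U, av (fun n : ZMod (q p) => av (fun x : τ → ZMod (q p) => F p n x)) := by
    intro w
    have h1 := crt_av q hinj U (fun p (n : ZMod (q p)) (x : τ → ZMod (q p)) =>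
      F p (((w.1 : ℕ) : ZMod (q p)) + n) (fun v => ((w.2 v : ℕ) : ZMod (q p)) + x v))
    simp only [hΦ, Int.cast_add, Int.cast_natCast]
    rw [h1]
    apply Finset.prod_congr rfl
    intro p _
    rw [av_equiv (Equiv.addLeft ((w.1 : ℕ) : ZMod (q p))) (fun n => av (fun x : τ → ZMod (q p) => F p n x))]
    congr 1; funext n
    rw [av_equiv (Equiv.addLeft (fun v => ((w.2 v : ℕ) : ZMod (q p)))) (fun x : τ → ZMod (q p) => F p _ x)]
    rfl
  have e2 : ∀ r : ZMod Q × (τ → ZMod Q),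
      |av (fun w : Fin N × (τ → Fin B) => Φ ((w.1 : ℕ) : ℤ) (fun v => ((w.2 v : ℕ) : ℤ))) -
      av (fun w : Fin N × (τ → Fin B) =>
        Φ (((w.1 : ℕ) : ℤ) + (r.1.val : ℕ)) (fun v => ((w.2 v : ℕ) : ℤ) + ((r.2 v).val : ℕ)))| ≤
      2 * (Q : ℝ) * (1 / N + Fintype.card τ / B) := by
    intro r
    rw [av_equiv (Equiv.prodCongr (rot (r.1.val : ℕ)) (Equiv.piCongrRight fun v => rot ((r.2 v).val : ℕ)))
      (fun w : Fin N × (τ → Fin B) => Φ ((w.1 : ℕ) : ℤ) (fun v => ((w.2 v : ℕ) : ℤ))), ← av_sub]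
    refine (abs_av_le _).trans ?_
    calc _ ≤ av (fun w : Fin N × (τ → Fin B) => 2 * wr (r.1.val : ℕ) w.1 + ∑ v, 2 * wr ((r.2 v).val : ℕ) (w.2 v)) := by
          apply av_mono
          intro w
          have hs0 : 0 ≤ ∑ v, 2 * wr ((r.2 v).val : ℕ) (w.2 v) :=
            Finset.sum_nonneg fun v _ => mul_nonneg zero_le_two (wr_nonneg _ _)
          have hw0 := wr_nonneg ((r.1.val : ℕ) : ℤ) w.1
          have hle2 : ∀ n x n' x', |Φ n x - Φ n' x'| ≤ 2 := by
            intro n x n' x'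
            have := abs_sub (Φ n x) (Φ n' x')
            linarith [hΦ1 n x, hΦ1 n' x']
          by_cases h1 : 0 ≤ ((w.1 : ℕ) : ℤ) + (r.1.val : ℕ) ∧ ((w.1 : ℕ) : ℤ) + (r.1.val : ℕ) < N
          · by_cases h2 : ∀ v, 0 ≤ ((w.2 v : ℕ) : ℤ) + ((r.2 v).val : ℕ) ∧ ((w.2 v : ℕ) : ℤ) + ((r.2 v).val : ℕ) < B
            · have a1 := rot_val _ _ h1
              have a2 : ∀ v, _ := fun v => rot_val _ _ (h2 v)
              simp only [Equiv.prodCongr_apply, Prod.map_fst, Prod.map_snd, Equiv.piCongrRight_apply, Pi.map_apply, a1, a2,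
                sub_self, abs_zero]
              linarith
            · push Not at h2
              obtain ⟨v, hv⟩ := h2
              have h3 : wr ((r.2 v).val : ℕ) (w.2 v) = 1 := by
                unfold wr
                rw [if_neg (by intro hc; exact absurd (hv hc.1) (not_le.mpr hc.2))]
              have h4 := Finset.single_le_sum (f := fun v => 2 * wr ((r.2 v).val : ℕ) (w.2 v))
                (fun v _ => mul_nonneg zero_le_two (wr_nonneg _ _)) (Finset.mem_univ v)
              simp only [h3] at h4
              refine (hle2 _ _ _ _).trans ?_
              linarith
          · have h3 : wr (r.1.val : ℕ) w.1 = 1 := by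
              unfold wr; rw [if_neg h1]
            refine (hle2 _ _ _ _).trans ?_
            linarith
      _ = 2 * av (fun z : Fin N => wr (r.1.val : ℕ) z) + ∑ v, 2 * av (fun z : Fin B => wr ((r.2 v).val : ℕ) z) := by
          rw [av_add, av_sum, av_mul_left, av_prod]
          simp only [av_const]
          congr 1
          apply Finset.sum_congr rfl
          intro v _
          rw [av_mul_left, av_prod]
          simp only [av_const]
          rw [av_coord v (fun z => wr ((r.2 v).val : ℕ) z)]
      _ ≤ 2 * (Q / N) + ∑ v : τ, 2 * ((Q : ℝ) / B) := by
          have hval : ∀ a : ZMod Q, |(((a.val : ℕ) : ℤ) : ℝ)| ≤ Q := by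
            intro a
            push_cast
            rw [abs_of_nonneg (by positivity)]
            exact_mod_cast (ZMod.val_lt a).le
          apply add_le_add
          · refine mul_le_mul_of_nonneg_left ((av_wr _).trans ?_) zero_le_two
            gcongr; exact hval _
          · apply Finset.sum_le_sum
            intro v _
            refine mul_le_mul_of_nonneg_left ((av_wr _).trans ?_) zero_le_two
            gcongr; exact hval _
      _ = _ := by simp; ring
  have e3 : ∏ p ∈ U, av (fun n : ZMod (q p) => av (fun x : τ → ZMod (q p) => F p n x)) =
      av (fun r : ZMod Q × (τ → ZMod Q) => av (fun w : Fin N × (τ → Fin B) =>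
        Φ (((w.1 : ℕ) : ℤ) + (r.1.val : ℕ)) (fun v => ((w.2 v : ℕ) : ℤ) + ((r.2 v).val : ℕ)))) := by
    rw [av_comm]
    simp only [e1, av_const]
  have hQr : (∏ p ∈ U, (q p : ℝ)) = (Q : ℝ) := by rw [hQ]; push_cast; rfl
  rw [e0, e3, hQr, ← av_const (X := ZMod Q × (τ → ZMod Q))
    (av (fun w : Fin N × (τ → Fin B) => Φ ((w.1 : ℕ) : ℤ) (fun v => ((w.2 v : ℕ) : ℤ)))), ← av_sub]
  refine (abs_av_le _).trans (av_le_of_le (by positivity) e2)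

end
end GT

end

section

open Filter
open scoped BigOperators

namespace GT

set_option linter.unusedSectionVars false
set_option linter.unusedSimpArgs false
set_option linter.unusedVariables false
set_option linter.deprecated false

section
variable {Pr : Type} [Fintype Pr] [DecidableEq Pr] (q : Pr → ℕ)

noncomputable def hA (z : ℤ) (A : Finset Pr) : ℝ := ∏ p ∈ A, hp (q p) (z : ZMod (q p))

def RR (R : ℕ) : Finset (Finset Pr) := Finset.univ.filter fun A => ∏ p ∈ A, q p ≤ R

noncomputable def Lam (R : ℕ) (z : ℤ) : ℝ := (∑ A ∈ RR q R, hA q z A) ^ 2 / Vs q (RR q R)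

lemma empty_mem_RR {R : ℕ} (hR : 1 ≤ R) : ∅ ∈ RR q R := by simp [RR, hR]

variable [hq : ∀ p, Fact (q p).Prime]

lemma hA_abs (z : ℤ) (A : Finset Pr) : |hA q z A| ≤ 1 := by
  unfold hA
  rw [Finset.abs_prod]
  exact Finset.prod_le_one (fun _ _ => abs_nonneg _) fun p _ => hp_abs _

lemma one_le_V {R : ℕ} (hR : 1 ≤ R) : 1 ≤ Vs q (RR q R) := by
  unfold Vs
  have := Finset.single_le_sum (f := fun A : Finset Pr => ∏ p ∈ A, 1 / ((q p : ℝ) - 1)) (s := RR q R) ?_ (empty_mem_RR q hR)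
  · simpa using this
  · intro A _
    apply Finset.prod_nonneg
    intro p _
    have := p_ge_two (p := q p)
    apply div_nonneg <;> linarith

lemma prod_q_inj (hinj : Function.Injective q) (A B : Finset Pr) (h : ∏ p ∈ A, q p = ∏ p ∈ B, q p) : A = B := by
  have key : ∀ A B : Finset Pr, ∏ p ∈ A, q p = ∏ p ∈ B, q p → A ⊆ B := by
    intro A B h p hp
    have h1 : q p ∣ ∏ p ∈ B, q p := h ▸ Finset.dvd_prod_of_mem q hp
    obtain ⟨r, hr, h2⟩ := ((hq p).out.prime.dvd_finset_prod_iff q).mp h1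
    have h3 := (Nat.prime_dvd_prime_iff_eq (hq p).out (hq r).out).mp h2
    rw [hinj h3]; exact hr
  exact Finset.Subset.antisymm (key A B h) (key B A h.symm)

lemma card_RR (hinj : Function.Injective q) (R : ℕ) : (RR q R).card ≤ R := by
  have h : (RR q R).card ≤ (Finset.Icc 1 R).card := by
    apply Finset.card_le_card_of_injOn (fun A => ∏ p ∈ A, q p)
    · intro A hA
      simp only [RR, Finset.coe_filter, Finset.mem_univ, true_and, Set.mem_setOf_eq] at hA
      simp only [Finset.coe_Icc, Set.mem_Icc]
      exact ⟨Finset.prod_pos fun p _ => (hq p).out.pos, hA⟩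
    · intro A _ B _ h
      exact prod_q_inj q hinj A B h
  simpa using h

lemma Lam_nonneg {R : ℕ} (hR : 1 ≤ R) (z : ℤ) : 0 ≤ Lam q R z :=
  div_nonneg (sq_nonneg _) (by linarith [one_le_V q hR])

lemma Lam_le (hinj : Function.Injective q) {R : ℕ} (hR : 1 ≤ R) (z : ℤ) : Lam q R z ≤ (R : ℝ) ^ 2 := by
  unfold Lam
  have hV := one_le_V q hR
  have h1 : |∑ A ∈ RR q R, hA q z A| ≤ R := by
    calc |∑ A ∈ RR q R, hA q z A| ≤ ∑ A ∈ RR q R, |hA q z A| := Finset.abs_sum_le_sum_abs _ _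
      _ ≤ ∑ A ∈ RR q R, 1 := Finset.sum_le_sum fun A _ => hA_abs q z A
      _ ≤ R := by simpa using (Nat.cast_le (α := ℝ)).mpr (card_RR q hinj R)
  have h2 : (∑ A ∈ RR q R, hA q z A) ^ 2 ≤ (R : ℝ) ^ 2 := by
    rw [← sq_abs]; gcongr
  calc _ ≤ (∑ A ∈ RR q R, hA q z A) ^ 2 := div_le_self (sq_nonneg _) hV
    _ ≤ _ := h2

/-- value at integers free of sieving primes -/
lemma Lam_free {R : ℕ} (hR : 1 ≤ R) (z : ℤ) (h : ∀ p, ((z : ℤ) : ZMod (q p)) ≠ 0) : Lam q R z = Vs q (RR q R) := by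
  unfold Lam
  have hV := one_le_V q hR
  have : ∑ A ∈ RR q R, hA q z A = Vs q (RR q R) := by
    unfold Vs hA hp
    simp [h]
  rw [this, sq, mul_div_assoc, div_self (by linarith), mul_one]

section
variable {τ I : Type} [Fintype τ] [DecidableEq τ] [Fintype I] [DecidableEq I]

lemma prod_square_expand (𝓡 : Finset (Finset Pr)) (z : I → ℤ) :
    ∏ s, (∑ A ∈ 𝓡, hA q (z s) A) ^ 2 =
      ∑ A ∈ Fintype.piFinset (fun _ : I × Bool => 𝓡), ∏ i : I × Bool, hA q (z i.1) (A i) := by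
  rw [← Finset.prod_univ_sum, Fintype.prod_prod_type]
  apply Finset.prod_congr rfl
  intro s _
  simp [sq]

lemma term_eq (W b : ℤ) (c : I → τ → ℤ) (A : I × Bool → Finset Pr) (n : ℕ) (x : τ → ℕ) :
    ∏ i : I × Bool, hA q (zf W b (c i.1) (n : ℤ) (fun v => (x v : ℤ))) (A i) =
    ∏ p ∈ Finset.univ.biUnion A, ∏ i ∈ Finset.univ.filter (fun i => p ∈ A i),
      hp (q p) (zf W b (c i.1) ((n : ℕ) : ZMod (q p)) (fun v => ((x v : ℕ) : ZMod (q p)))) := by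
  unfold hA
  rw [Finset.prod_comm' (t' := Finset.univ.biUnion A) (s' := fun p => Finset.univ.filter (fun i => p ∈ A i))]
  · apply Finset.prod_congr rfl
    intro p _
    apply Finset.prod_congr rfl
    intro i _
    have := zf_map (Int.castRingHom (ZMod (q p))) W b (c i.1) (n : ℤ) (fun v => (x v : ℤ))
    simp only [eq_intCast, Int.cast_natCast] at this
    rw [this]
  · intro i p
    simp only [Finset.mem_univ, true_and, Finset.mem_biUnion, Finset.mem_filter]
    exact ⟨fun h => ⟨h, i, h⟩, fun h => h.1⟩

lemma eloc_empty (p : ℕ) [Fact p.Prime] (W b : ℤ) (c : I → τ → ℤ) : eloc p W b c ∅ = 1 := by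
  unfold eloc
  simp [av_const]

lemma prod_biUnion_le {R : ℕ} (hR : 1 ≤ R) (A : I × Bool → Finset Pr) (hA : ∀ i, A i ∈ RR q R) :
    (∏ p ∈ Finset.univ.biUnion A, (q p : ℝ)) ≤ (R : ℝ) ^ (2 * Fintype.card I) := by
  have h : ∀ s : Finset (I × Bool), ∏ p ∈ s.biUnion A, q p ≤ R ^ s.card := by
    intro s
    induction s using Finset.induction_on with
    | empty => simp
    | insert a s ha ih =>
      rw [Finset.biUnion_insert, Finset.card_insert_of_notMem ha, pow_succ']
      have h1 : ∏ p ∈ A a, q p ≤ R := by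
        have := hA a
        simpa [RR] using this
      calc ∏ p ∈ A a ∪ s.biUnion A, q p
          ≤ (∏ p ∈ A a ∪ s.biUnion A, q p) * ∏ p ∈ A a ∩ s.biUnion A, q p :=
            Nat.le_mul_of_pos_right _ (Finset.prod_pos fun p _ => (hq p).out.pos)
        _ = (∏ p ∈ A a, q p) * ∏ p ∈ s.biUnion A, q p := Finset.prod_union_inter
        _ ≤ R * R ^ s.card := Nat.mul_le_mul h1 ih
  have h2 := h Finset.univ
  simp only [Finset.card_univ, Fintype.card_prod, Fintype.card_bool] at h2
  rw [mul_comm]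
  exact_mod_cast h2

lemma LF_int (hinj : Function.Injective q) {R N B : ℕ} (hR : 1 ≤ R) (hN : 0 < N) (hB : 0 < B) (W b : ℤ)
    (hW : ∀ p, (W : ZMod (q p)) ≠ 0) (c : I → τ → ℤ)
    (hc : ∀ p, ∀ s s', s ≠ s' → ∃ v, ((c s' v - c s v : ℤ) : ZMod (q p)) ≠ 0) (C : ℝ)
    (hC : (∏ p, (1 + 1 / ((q p : ℝ) - 1))) ≤ C * Vs q (RR q R)) :
    |av (fun w : Fin N × (τ → Fin B) => ∏ s, Lam q R (zf W b (c s) ((w.1 : ℕ) : ℤ) (fun v => ((w.2 v : ℕ) : ℤ)))) - 1| ≤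
      C ^ (Fintype.card I) * (Real.exp (∑ p, 8 * 4 ^ (Fintype.card I) / (q p : ℝ) ^ 2) - 1) +
      2 * (R : ℝ) ^ (4 * Fintype.card I) * (1 / N + Fintype.card τ / B) := by
  set m := Fintype.card I with hm
  set V := Vs q (RR q R) with hVdef
  have hV : 1 ≤ V := one_le_V q hR
  have hVm : 1 ≤ V ^ m := one_le_pow₀ hV
  set P := Fintype.piFinset (fun _ : I × Bool => RR q R) with hP
  -- numerator
  set T : ℝ := av (fun w : Fin N × (τ → Fin B) => ∏ s, (∑ A ∈ RR q R, hA q (zf W b (c s) ((w.1 : ℕ) : ℤ) (fun v => ((w.2 v : ℕ) : ℤ))) A) ^ 2) with hT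
  have h1 : av (fun w : Fin N × (τ → Fin B) => ∏ s, Lam q R (zf W b (c s) ((w.1 : ℕ) : ℤ) (fun v => ((w.2 v : ℕ) : ℤ)))) = T / V ^ m := by
    rw [hT, div_eq_mul_inv, ← av_mul_right]
    congr 1; funext w
    unfold Lam
    rw [Finset.prod_div_distrib]
    simp [hm, div_eq_mul_inv, hVdef]
  set F : (I × Bool → Finset Pr) → ∀ p, ZMod (q p) → (τ → ZMod (q p)) → ℝ := fun A p n x =>
    ∏ i ∈ Finset.univ.filter (fun i => p ∈ A i), hp (q p) (zf W b (c i.1) n x) with hF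
  have h2 : T = ∑ A ∈ P, av (fun w : Fin N × (τ → Fin B) => ∏ p ∈ Finset.univ.biUnion A,
      F A p ((w.1 : ℕ) : ZMod (q p)) (fun v => ((w.2 v : ℕ) : ZMod (q p)))) := by
    rw [hT, ← av_sum]
    congr 1; funext w
    rw [prod_square_expand q (RR q R) (fun s => zf W b (c s) ((w.1 : ℕ) : ℤ) (fun v => ((w.2 v : ℕ) : ℤ)))]
    apply Finset.sum_congr rfl
    intro A _
    exact term_eq q W b c A (w.1 : ℕ) (fun v => (w.2 v : ℕ))
  set T' : ℝ := ∑ A ∈ P, ∏ p, eloc (q p) W b c (Finset.univ.filter fun i => p ∈ A i) with hT'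
  have h3 : |T' - V ^ m| ≤ (∏ p, (1 + 1 / ((q p : ℝ) - 1))) ^ m *
      (Real.exp (∑ p, 8 * 4 ^ m / (q p : ℝ) ^ 2) - 1) :=
    sum_close q (fun p => (hq p).out) (RR q R) (fun p T => eloc (q p) W b c T)
      (fun p T => loc_close (hW p) c (hc p) T)
  have h4 : |T - T'| ≤ 2 * (R : ℝ) ^ (4 * m) * (1 / N + Fintype.card τ / B) := by
    rw [h2, hT', ← Finset.sum_sub_distrib]
    have h5 : ∀ A ∈ P, |av (fun w : Fin N × (τ → Fin B) => ∏ p ∈ Finset.univ.biUnion A,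
      F A p ((w.1 : ℕ) : ZMod (q p)) (fun v => ((w.2 v : ℕ) : ZMod (q p)))) -
        ∏ p, eloc (q p) W b c (Finset.univ.filter fun i => p ∈ A i)| ≤
        2 * (R : ℝ) ^ (2 * m) * (1 / N + Fintype.card τ / B) := by
      intro A hA
      have hA' : ∀ i, A i ∈ RR q R := Fintype.mem_piFinset.mp hA
      have h6 : ∏ p, eloc (q p) W b c (Finset.univ.filter fun i => p ∈ A i) =
          ∏ p ∈ Finset.univ.biUnion A, av (fun n => av (fun x => F A p n x)) := by
        symm
        apply Finset.prod_subset (Finset.subset_univ _)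
        intro p _ hp
        have : (Finset.univ.filter fun i => p ∈ A i) = ∅ := by
          simp only [Finset.mem_biUnion, Finset.mem_univ, true_and, not_exists] at hp
          simp [Finset.filter_eq_empty_iff, hp]
        have h7 := eloc_empty (q p) W b c
        rw [← this] at h7
        exact h7
      rw [h6]
      refine (equidist q hinj (Finset.univ.biUnion A) hN hB (F A) ?_).trans ?_
      · intro p n x
        rw [hF, Finset.abs_prod]
        exact Finset.prod_le_one (fun _ _ => abs_nonneg _) fun i _ => hp_abs _
      · have := prod_biUnion_le q hR A hA'
        gcongr
    have hcard : (P.card : ℝ) ≤ (R : ℝ) ^ (2 * m) := by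
      rw [hP, Fintype.card_piFinset]
      simp only [Finset.prod_const, Finset.card_univ, Fintype.card_prod, Fintype.card_bool]
      rw [mul_comm 2 (Fintype.card I)]
      have := card_RR q hinj R
      exact_mod_cast Nat.pow_le_pow_left this _
    calc _ ≤ ∑ A ∈ P, 2 * (R : ℝ) ^ (2 * m) * (1 / N + Fintype.card τ / B) :=
          (Finset.abs_sum_le_sum_abs _ _).trans (Finset.sum_le_sum h5)
      _ = P.card * (2 * (R : ℝ) ^ (2 * m) * (1 / N + Fintype.card τ / B)) := by simp
      _ ≤ (R : ℝ) ^ (2 * m) * (2 * (R : ℝ) ^ (2 * m) * (1 / N + Fintype.card τ / B)) := by gcongr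
      _ = _ := by rw [show 4 * m = 2 * m + 2 * m by ring, pow_add]; ring
  rw [h1]
  have hV0 : 0 < V ^ m := by linarith
  have h8 : T / V ^ m - 1 = (T' - V ^ m) / V ^ m + (T - T') / V ^ m := by field_simp; ring
  rw [h8]
  refine (abs_add_le _ _).trans ?_
  rw [abs_div, abs_div, abs_of_pos hV0]
  have hE : 0 ≤ Real.exp (∑ p, 8 * 4 ^ m / (q p : ℝ) ^ 2) - 1 := by
    have : 0 ≤ ∑ p, 8 * 4 ^ m / (q p : ℝ) ^ 2 := Finset.sum_nonneg fun p _ => by positivity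
    linarith [Real.add_one_le_exp (∑ p, 8 * 4 ^ m / (q p : ℝ) ^ 2)]
  apply add_le_add
  · rw [div_le_iff₀ hV0]
    refine h3.trans ?_
    have h9 : (∏ p, (1 + 1 / ((q p : ℝ) - 1))) ^ m ≤ (C * V) ^ m := by
      apply pow_le_pow_left₀ _ hC
      apply Finset.prod_nonneg
      intro p _
      have := p_ge_two (p := q p)
      have : 0 ≤ 1 / ((q p : ℝ) - 1) := by apply div_nonneg <;> linarith
      linarith
    calc _ ≤ (C * V) ^ m * (Real.exp (∑ p, 8 * 4 ^ m / (q p : ℝ) ^ 2) - 1) := by gcongr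
      _ = _ := by rw [mul_pow]; ring
  · exact (div_le_self (abs_nonneg _) hVm).trans h4

end
end
end GT

end

section

open Filter
open scoped BigOperators

namespace GT

set_option linter.unusedSectionVars false
set_option linter.unusedSimpArgs false
set_option linter.unusedVariables false
set_option linter.deprecated false

lemma sum_log_div_le (Q : ℕ) (hQ : 1 ≤ Q) :
    ∑ p ∈ Nat.primesLE Q, Real.log p / p ≤ Real.log Q + Real.log 4 := by
  have hQ0 : (0 : ℝ) < Q := by exact_mod_cast hQ
  have h1 : ∑ p ∈ Nat.primesLE Q, ((Q / p : ℕ) : ℝ) * Real.log p ≤ Q * Real.log Q := by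
    have h2 : ∀ p, ((Q / p : ℕ) : ℝ) * Real.log p = ∑ e ∈ Finset.range Q, if p ∣ e + 1 then Real.log p else 0 := by
      intro p
      rw [← Finset.sum_filter, Finset.sum_const, Nat.card_multiples, nsmul_eq_mul]
    simp_rw [h2]
    rw [Finset.sum_comm]
    calc _ ≤ ∑ e ∈ Finset.range Q, Real.log Q := by
          apply Finset.sum_le_sum
          intro e he
          rw [← Finset.sum_filter]
          have he' : e + 1 ≤ Q := by simpa using he
          have h3 : (Nat.primesLE Q).filter (fun p => p ∣ e + 1) ⊆ (e + 1).primeFactors := by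
            intro p hp
            rw [Finset.mem_filter, Nat.mem_primesLE] at hp
            exact Nat.mem_primeFactors.mpr ⟨hp.1.2, hp.2, by omega⟩
          calc _ ≤ ∑ p ∈ (e + 1).primeFactors, Real.log p :=
                Finset.sum_le_sum_of_subset_of_nonneg h3 fun p _ _ => Real.log_natCast_nonneg p
            _ = Real.log ((∏ p ∈ (e + 1).primeFactors, p : ℕ) : ℝ) := by
                push_cast
                rw [Real.log_prod]
                intro p hp
                exact_mod_cast (Nat.prime_of_mem_primeFactors hp).ne_zero
            _ ≤ Real.log Q := by
                apply Real.log_le_log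
                · exact_mod_cast Finset.prod_pos fun p hp => (Nat.prime_of_mem_primeFactors hp).pos
                · exact_mod_cast (Nat.le_of_dvd (by omega) (Nat.prod_primeFactors_dvd (e + 1))).trans he'
      _ = Q * Real.log Q := by simp
  have h4 : ∑ p ∈ Nat.primesLE Q, Real.log p ≤ Real.log 4 * Q := by
    rw [← Chebyshev.theta_eq_sum_primesLE_log]
    exact Chebyshev.theta_le_log4_mul_x hQ0.le
  have h5 : ∑ p ∈ Nat.primesLE Q, Real.log p / p * Q ≤
      ∑ p ∈ Nat.primesLE Q, (((Q / p : ℕ) : ℝ) * Real.log p + Real.log p) := by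
    apply Finset.sum_le_sum
    intro p hp
    have hp0 : 0 < p := (Nat.prime_of_mem_primesLE hp).pos
    have h6 : (Q : ℝ) / p ≤ (Q / p : ℕ) + 1 := by
      rw [div_le_iff₀ (by exact_mod_cast hp0)]
      have := (Nat.lt_mul_div_succ Q hp0).le
      rw [mul_comm] at this
      exact_mod_cast this
    have hl := Real.log_natCast_nonneg p
    calc Real.log p / p * Q = (Q : ℝ) / p * Real.log p := by ring
      _ ≤ ((Q / p : ℕ) + 1) * Real.log p := by gcongr
      _ = _ := by ring
  rw [← Finset.sum_mul, Finset.sum_add_distrib] at h5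
  have : (∑ p ∈ Nat.primesLE Q, Real.log p / p) * Q ≤ (Real.log Q + Real.log 4) * Q := by linarith
  exact le_of_mul_le_mul_right this hQ0

noncomputable def invHom : ℕ →* ℝ where
  toFun n := (n : ℝ)⁻¹
  map_one' := by simp
  map_mul' a b := by push_cast; rw [mul_inv]

lemma euler_ge (Q : ℕ) (hQ : 1 ≤ Q) : Real.log Q ≤ ∏ p ∈ Nat.primesLE Q, (1 - (p : ℝ)⁻¹)⁻¹ := by
  have h := (EulerProduct.summable_and_hasSum_smoothNumbers_prod_primesBelow_geometric (f := invHom) (by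
    intro p hp
    have : (1 : ℝ) < p := by exact_mod_cast hp.one_lt
    simp only [invHom, MonoidHom.coe_mk, OneHom.coe_mk, norm_inv, Real.norm_natCast]
    exact inv_lt_one_of_one_lt₀ this) (Q + 1)).2
  have h1 : ∑ i ∈ (Finset.Icc 1 Q).attach, (i.1 : ℝ)⁻¹ ≤ ∏ p ∈ (Q + 1).primesBelow, (1 - invHom p)⁻¹ := by
    have emb : ∀ i : {i // i ∈ Finset.Icc 1 Q}, i.1 ∈ (Q + 1).smoothNumbers := by
      intro i
      have := Finset.mem_Icc.mp i.2
      exact Nat.mem_smoothNumbers_of_lt (by omega) (by omega)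
    set g : {i // i ∈ Finset.Icc 1 Q} ↪ (Q + 1).smoothNumbers := ⟨fun i => ⟨i.1, emb i⟩, by
      intro a b hab
      simp only [Subtype.mk.injEq] at hab
      exact Subtype.ext hab⟩ with hg
    have := sum_le_hasSum ((Finset.Icc 1 Q).attach.map g) (fun i _ => by simp [invHom]) h
    rw [Finset.sum_map] at this
    exact this
  rw [Finset.sum_attach (Finset.Icc 1 Q) (fun i => (i : ℝ)⁻¹)] at h1
  have h2 := log_add_one_le_harmonic Q
  rw [harmonic_eq_sum_Icc] at h2
  push_cast at h2
  have h3 : Real.log Q ≤ Real.log (Q + 1) := Real.log_le_log (by exact_mod_cast hQ) (by linarith)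
  exact h3.trans (h2.trans h1)

section
variable {Pr : Type} [Fintype Pr] [DecidableEq Pr] (q : Pr → ℕ) [hq : ∀ p, Fact (q p).Prime]

lemma sum_wt_mem (a : Pr → ℝ) (p : Pr) :
    (∑ A : Finset Pr, if p ∈ A then ∏ r ∈ A, a r else 0) * (1 + a p) = a p * ∏ r, (1 + a r) := by
  have h := Finset.prod_add a (fun r => if r = p then 0 else 1) Finset.univ
  rw [Finset.powerset_univ] at h
  have h1 : ∀ A : Finset Pr, (if p ∈ A then ∏ r ∈ A, a r else 0) =
      (∏ i ∈ A, a i) * ∏ i ∈ Finset.univ \ A, (if i = p then 0 else 1) := by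
    intro A
    split_ifs with hp
    · rw [Finset.prod_eq_one (s := Finset.univ \ A), mul_one]
      intro i hi
      rw [if_neg]
      rintro rfl
      simp [hp] at hi
    · rw [Finset.prod_eq_zero (s := Finset.univ \ A) (i := p), mul_zero]
      · simp [hp]
      · simp
  simp_rw [h1]
  rw [← h, ← Finset.mul_prod_erase Finset.univ _ (Finset.mem_univ p), ← Finset.mul_prod_erase Finset.univ (fun r => 1 + a r) (Finset.mem_univ p)]
  have : ∏ x ∈ Finset.univ.erase p, (a x + if x = p then 0 else 1) = ∏ x ∈ Finset.univ.erase p, (1 + a x) := by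
    apply Finset.prod_congr rfl
    intro x hx
    rw [if_neg (Finset.ne_of_mem_erase hx), add_comm]
  rw [this]
  simp
  ring

lemma half_V {L : ℝ} (hL : 0 < L) {R : ℕ} (hR : 2 * L ≤ Real.log R)
    (hsum : ∑ p, Real.log (q p) / q p ≤ L) :
    (∏ p, (1 + 1 / ((q p : ℝ) - 1))) ≤ 2 * Vs q (RR q R) := by
  set a : Pr → ℝ := fun p => 1 / ((q p : ℝ) - 1) with ha
  set P := ∏ p, (1 + a p) with hP
  have ha0 : ∀ p, 0 < a p := by
    intro p
    have := p_ge_two (p := q p)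
    rw [ha]
    exact div_pos one_pos (by linarith)
  have hwt : ∀ A : Finset Pr, 0 ≤ ∏ p ∈ A, a p := fun A => Finset.prod_nonneg fun p _ => (ha0 p).le
  have hP0 : 0 < P := Finset.prod_pos fun p _ => by linarith [ha0 p]
  have h1 : P = ∑ A : Finset Pr, ∏ p ∈ A, a p := by
    rw [hP, Finset.prod_one_add, Finset.powerset_univ]
  have h2 : ∑ A : Finset Pr, (∏ p ∈ A, a p) * ∑ p ∈ A, Real.log (q p) = P * ∑ p, Real.log (q p) / q p := by
    have : ∀ A : Finset Pr, (∏ p ∈ A, a p) * ∑ p ∈ A, Real.log (q p) =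
        ∑ p, Real.log (q p) * if p ∈ A then ∏ r ∈ A, a r else 0 := by
      intro A
      rw [Finset.mul_sum]
      simp only [mul_ite, mul_zero]
      rw [← Finset.sum_filter]
      simp [mul_comm]
    simp_rw [this]
    rw [Finset.sum_comm, Finset.mul_sum]
    apply Finset.sum_congr rfl
    intro p _
    rw [← Finset.mul_sum]
    have h3 := sum_wt_mem a p
    have h4 := p_ge_two (p := q p)
    have h5 : 1 + a p = q p * a p := by
      have h7 : (q p : ℝ) - 1 ≠ 0 := by linarith
      rw [ha]; field_simp; ring
    rw [h5, ← hP] at h3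
    have h6 : (∑ A : Finset Pr, if p ∈ A then ∏ r ∈ A, a r else 0) = P / q p := by
      rw [eq_div_iff (by linarith)]
      apply mul_right_cancel₀ (ha0 p).ne'
      linarith
    rw [h6]; ring
  have h3 : ∑ A : Finset Pr, (∏ p ∈ A, a p) ≤ Vs q (RR q R) + (∑ A : Finset Pr, (∏ p ∈ A, a p) * ∑ p ∈ A, Real.log (q p)) / (2 * L) := by
    unfold Vs RR
    rw [Finset.sum_filter, Finset.sum_div, ← Finset.sum_add_distrib]
    apply Finset.sum_le_sum
    intro A _
    have hs : 0 ≤ ∑ p ∈ A, Real.log (q p) := Finset.sum_nonneg fun p _ => Real.log_natCast_nonneg _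
    split_ifs with h
    · have := hwt A
      have : 0 ≤ (∏ p ∈ A, a p) * (∑ p ∈ A, Real.log (q p)) / (2 * L) := by positivity
      linarith
    · rw [zero_add, le_div_iff₀ (by linarith)]
      apply mul_le_mul_of_nonneg_left _ (hwt A)
      rw [← Real.log_prod (fun p _ => by exact_mod_cast (hq p).out.ne_zero)]
      refine hR.trans ?_
      rcases Nat.eq_zero_or_pos R with h0 | h0
      · rw [h0] at hR; simp at hR; linarith
      · apply Real.log_le_log (by exact_mod_cast h0)
        exact_mod_cast (not_le.mp h).le
  rw [h2, ← h1] at h3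
  have h4 : P * (∑ p, Real.log (q p) / q p) / (2 * L) ≤ P / 2 := by
    rw [div_le_div_iff₀ (by linarith) two_pos]
    nlinarith
  linarith
end

abbrev Pri (w Q : ℕ) : Type := {p : ℕ // p ∈ (Finset.Ioc w Q).filter Nat.Prime}

instance (w Q : ℕ) (p : Pri w Q) : Fact (p.1).Prime := ⟨(Finset.mem_filter.mp p.2).2⟩

lemma Pri_lt {w Q : ℕ} (p : Pri w Q) : w < p.1 ∧ p.1 ≤ Q := by
  have := (Finset.mem_filter.mp p.2).1
  simpa using this

/-- the sieve function -/
noncomputable def VV (w Q : ℕ) : ℝ := Vs (fun p : Pri w Q => p.1) (RR (fun p : Pri w Q => p.1) (Q ^ 4))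

lemma half_VV (w Q : ℕ) (hQ : 4 ≤ Q) : (∏ p : Pri w Q, (1 + 1 / ((p.1 : ℝ) - 1))) ≤ 2 * VV w Q := by
  have hQ' : (4 : ℝ) ≤ Q := by exact_mod_cast hQ
  apply half_V (fun p : Pri w Q => p.1) (L := 2 * Real.log Q)
  · have := Real.log_pos (show (1 : ℝ) < Q by linarith)
    linarith
  · push_cast
    rw [Real.log_pow]
    push_cast
    linarith
  · have h1 := sum_log_div_le Q (by omega)
    have h2 : Real.log 4 ≤ Real.log Q := Real.log_le_log (by norm_num) hQ'
    have h3 : ∑ p : Pri w Q, Real.log (p.1) / p.1 ≤ ∑ p ∈ Nat.primesLE Q, Real.log p / p := by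
      rw [Finset.sum_coe_sort ((Finset.Ioc w Q).filter Nat.Prime) (fun p => Real.log p / p)]
      apply Finset.sum_le_sum_of_subset_of_nonneg
      · intro p hp
        rw [Finset.mem_filter, Finset.mem_Ioc] at hp
        exact Nat.mem_primesLE.mpr ⟨hp.1.2, hp.2⟩
      · intro p _ _
        exact div_nonneg (Real.log_natCast_nonneg p) (Nat.cast_nonneg p)
    linarith

lemma sum_sq_Pri (w Q : ℕ) (hw : 1 ≤ w) (a : ℝ) (ha : 0 ≤ a) : ∑ p : Pri w Q, a / (p.1 : ℝ) ^ 2 ≤ a / w := by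
  rw [Finset.sum_coe_sort ((Finset.Ioc w Q).filter Nat.Prime) (fun p => a / (p : ℝ) ^ 2)]
  rcases le_total Q w with h | h
  · rw [Finset.Ioc_eq_empty (by omega)]
    simp; positivity
  have h1 := sum_Ioc_inv_sq_le_sub (α := ℝ) (k := w) (n := Q) (by omega) h
  calc _ ≤ ∑ p ∈ Finset.Ioc w Q, a / (p : ℝ) ^ 2 :=
        Finset.sum_le_sum_of_subset_of_nonneg (Finset.filter_subset _ _) fun p _ _ => by positivity
    _ = a * ∑ p ∈ Finset.Ioc w Q, ((p : ℝ) ^ 2)⁻¹ := by rw [Finset.mul_sum]; rfl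
    _ ≤ a * (w : ℝ)⁻¹ := by
        have : 0 ≤ (Q : ℝ)⁻¹ := by positivity
        gcongr
        linarith
    _ = a / w := rfl

lemma primeFactors_fact (w : ℕ) : (w.factorial).primeFactors = Nat.primesLE w := by
  ext p
  rw [Nat.mem_primeFactors, Nat.mem_primesLE]
  constructor
  · rintro ⟨h1, h2, _⟩
    exact ⟨(h1.dvd_factorial).mp h2, h1⟩
  · rintro ⟨h1, h2⟩
    exact ⟨h2, (h2.dvd_factorial).mpr h1, Nat.factorial_ne_zero w⟩

lemma VV_ge (w Q : ℕ) (hQ : 4 ≤ Q) (hw : w ≤ Q) :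
    (Nat.totient w.factorial : ℝ) / w.factorial * Real.log Q ≤ 2 * VV w Q := by
  refine le_trans ?_ (half_VV w Q hQ)
  have h1 := euler_ge Q (by omega)
  have h2 : (Nat.totient w.factorial : ℝ) / w.factorial = ∏ p ∈ Nat.primesLE w, (1 - (p : ℝ)⁻¹) := by
    have := Nat.totient_eq_mul_prod_factors w.factorial
    rw [primeFactors_fact] at this
    have h3 : (Nat.totient w.factorial : ℝ) = w.factorial * ∏ p ∈ Nat.primesLE w, (1 - (p : ℝ)⁻¹) := by
      have h8 := congrArg (fun x : ℚ => (x : ℝ)) this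
      push_cast at h8
      exact h8
    rw [h3, mul_div_cancel_left₀]
    exact_mod_cast Nat.factorial_ne_zero w
  have hpos : ∀ p ∈ Nat.primesLE Q, 0 < 1 - (p : ℝ)⁻¹ := by
    intro p hp
    have : (1 : ℝ) < p := by exact_mod_cast (Nat.prime_of_mem_primesLE hp).one_lt
    have := inv_lt_one_of_one_lt₀ this
    linarith
  have hsub : Nat.primesLE w ⊆ Nat.primesLE Q := by
    intro p hp
    rw [Nat.mem_primesLE] at hp ⊢
    exact ⟨hp.1.trans hw, hp.2⟩
  have hpw : 0 < ∏ p ∈ Nat.primesLE w, (1 - (p : ℝ)⁻¹) := Finset.prod_pos fun p hp => hpos p (hsub hp)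
  have h4 : ∏ p ∈ Nat.primesLE Q, (1 - (p : ℝ)⁻¹)⁻¹ =
      (∏ p : Pri w Q, (1 + 1 / ((p.1 : ℝ) - 1))) * ∏ p ∈ Nat.primesLE w, (1 - (p : ℝ)⁻¹)⁻¹ := by
    rw [← Finset.prod_sdiff hsub]
    congr 1
    rw [Finset.prod_coe_sort ((Finset.Ioc w Q).filter Nat.Prime) (fun p => 1 + 1 / ((p : ℝ) - 1))]
    have hS : Nat.primesLE Q \ Nat.primesLE w = (Finset.Ioc w Q).filter Nat.Prime := by
      ext p
      rw [Finset.mem_sdiff, Nat.mem_primesLE, Nat.mem_primesLE, Finset.mem_filter, Finset.mem_Ioc]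
      constructor
      · rintro ⟨⟨a, b⟩, c⟩
        exact ⟨⟨by by_contra h; exact c ⟨by omega, b⟩, a⟩, b⟩
      · rintro ⟨⟨a, b⟩, c⟩
        exact ⟨⟨b, c⟩, fun h => by omega⟩
    rw [hS]
    apply Finset.prod_congr rfl
    intro p hp
    have : (1 : ℝ) < p := by exact_mod_cast (Finset.mem_filter.mp hp).2.one_lt
    have h5 : (p : ℝ) - 1 ≠ 0 := by linarith
    have h6 : (p : ℝ) ≠ 0 := by linarith
    field_simp
    ring
  rw [h4, Finset.prod_inv_distrib, ← div_eq_mul_inv, le_div_iff₀ hpw] at h1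
  rw [h2]
  linarith
end GT

end

section

open Filter
open scoped BigOperators

namespace GT

set_option linter.unusedSectionVars false
set_option linter.unusedSimpArgs false
set_option linter.unusedVariables false
set_option linter.deprecated false

def zmE (N : ℕ) [NeZero N] : Fin N ≃ ZMod N where
  toFun i := ((i : ℕ) : ZMod N)
  invFun a := ⟨a.val, ZMod.val_lt a⟩
  left_inv i := by
    apply Fin.ext
    exact ZMod.val_cast_of_lt i.2
  right_inv a := ZMod.natCast_zmod_val a

lemma bad_count (N Δ : ℕ) : av (fun i : Fin N => if (i : ℕ) < Δ ∨ N ≤ (i : ℕ) + Δ then (1 : ℝ) else 0) ≤ 2 * Δ / N := by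
  unfold av
  rw [Fintype.card_fin, Fin.sum_univ_eq_sum_range (fun i => if i < Δ ∨ N ≤ i + Δ then (1 : ℝ) else 0) N,
    ← Finset.sum_filter, Finset.sum_const, nsmul_eq_mul, mul_one]
  gcongr
  have h1 : (Finset.range N).filter (fun i => i < Δ ∨ N ≤ i + Δ) ⊆ Finset.range Δ ∪ Finset.Ico (N - Δ) N := by
    intro i hi
    rw [Finset.mem_filter, Finset.mem_range] at hi
    rw [Finset.mem_union, Finset.mem_range, Finset.mem_Ico]
    omega
  have h2 := (Finset.card_le_card h1).trans (Finset.card_union_le _ _)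
  rw [Finset.card_range, Nat.card_Ico] at h2
  have h3 : ((Finset.range N).filter (fun i => i < Δ ∨ N ≤ i + Δ)).card ≤ 2 * Δ := by omega
  exact_mod_cast h3

/-- transfer from integers to a cyclic group -/
lemma wrap_av {N : ℕ} [NeZero N] {I Y : Type} [Fintype I] [Fintype Y] (g : ℤ → ℝ) (K : ℝ)
    (hg0 : ∀ z, 0 ≤ g z) (hgK : ∀ z, g z ≤ K) (ℓ : I → Y → ℤ) (Δ : ℕ) (hΔ : ∀ s y, |ℓ s y| ≤ Δ) :
    |av (fun n : ZMod N => av (fun y => ∏ s, g (((n + ((ℓ s y : ℤ) : ZMod N)).val : ℕ) : ℤ))) -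
      av (fun w : Fin N × Y => ∏ s, g (((w.1 : ℕ) : ℤ) + ℓ s w.2))| ≤ K ^ (Fintype.card I) * (2 * Δ / N) := by
  have hK : 0 ≤ K := (hg0 0).trans (hgK 0)
  rw [av_equiv (zmE N), av_prod, ← av_sub]
  refine (abs_av_le _).trans ?_
  refine le_trans ?_ (mul_le_mul_of_nonneg_left (bad_count N Δ) (pow_nonneg hK _))
  rw [← av_mul_left]
  apply av_mono
  intro i
  rw [← av_sub]
  have hb : ∀ z : I → ℤ, 0 ≤ ∏ s, g (z s) ∧ ∏ s, g (z s) ≤ K ^ (Fintype.card I) := by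
    intro z
    refine ⟨Finset.prod_nonneg fun s _ => hg0 _, ?_⟩
    calc ∏ s, g (z s) ≤ ∏ s : I, K := Finset.prod_le_prod (fun s _ => hg0 _) fun s _ => hgK _
      _ = _ := by simp
  refine (abs_av_le _).trans ?_
  apply av_le_of_le
  · split_ifs
    · rw [mul_one]; exact pow_nonneg hK _
    · simp
  intro y
  split_ifs with h
  · rw [mul_one]
    have h1 := hb (fun s => (((zmE N i + ((ℓ s y : ℤ) : ZMod N)).val : ℕ) : ℤ))
    have h2 := hb (fun s => ((i : ℕ) : ℤ) + ℓ s y)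
    rw [abs_le]
    constructor <;> linarith [h1.1, h1.2, h2.1, h2.2]
  · rw [mul_zero]
    push Not at h
    apply le_of_eq
    rw [abs_eq_zero, sub_eq_zero]
    apply Finset.prod_congr rfl
    intro s _
    congr 1
    have h3 := abs_le.mp (hΔ s y)
    obtain ⟨u, hu⟩ : ∃ u : ℕ, ((i : ℕ) : ℤ) + ℓ s y = u := Int.eq_ofNat_of_zero_le (by omega)
    have h4 : zmE N i + ((ℓ s y : ℤ) : ZMod N) = (u : ZMod N) := by
      have := congrArg (fun z : ℤ => (z : ZMod N)) hu
      push_cast at this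
      exact this
    rw [h4, ZMod.val_cast_of_lt (by omega), hu]

/-- the majorant -/
noncomputable def nuW (N w Q : ℕ) (b : ℤ) (n : ZMod N) : ℝ :=
  Lam (fun p : Pri w Q => p.1) (Q ^ 4) ((w.factorial : ℤ) * ((n.val : ℕ) : ℤ) + b)

lemma Pri_inj (w Q : ℕ) : Function.Injective (fun p : Pri w Q => p.1) := Subtype.val_injective

noncomputable def er (m w Q N B K : ℕ) : ℝ :=
  2 ^ m * (Real.exp (8 * 4 ^ m / w) - 1) + 2 * ((Q : ℝ) ^ 4) ^ (4 * m) * (1 / N + K / B) +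
    (((Q : ℝ) ^ 4) ^ 2) ^ m * (2 * (K * w * B : ℕ) / N)

lemma er_mono {m m' : ℕ} (h : m ≤ m') (w Q N B K : ℕ) (hQ : 1 ≤ Q) : er m w Q N B K ≤ er m' w Q N B K := by
  unfold er
  have hQ1 : (1 : ℝ) ≤ (Q : ℝ) ^ 4 := one_le_pow₀ (by exact_mod_cast hQ)
  have h1 : (1 : ℝ) ≤ ((Q : ℝ) ^ 4) ^ 2 := one_le_pow₀ hQ1
  have h3 : (4 : ℝ) ^ m ≤ 4 ^ m' := pow_le_pow_right₀ (by norm_num) h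
  have h2 : 0 ≤ Real.exp (8 * 4 ^ m / w) - 1 := by
    have : (0 : ℝ) ≤ 8 * 4 ^ m / w := by positivity
    linarith [Real.add_one_le_exp ((8 : ℝ) * 4 ^ m / w)]
  have h4 : (2 : ℝ) ^ m ≤ 2 ^ m' := pow_le_pow_right₀ (by norm_num) h
  have h5 : ((Q : ℝ) ^ 4) ^ (4 * m) ≤ ((Q : ℝ) ^ 4) ^ (4 * m') := pow_le_pow_right₀ hQ1 (by omega)
  have h6 : (((Q : ℝ) ^ 4) ^ 2) ^ m ≤ (((Q : ℝ) ^ 4) ^ 2) ^ m' := pow_le_pow_right₀ h1 h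
  gcongr

section
variable {N : ℕ} [NeZero N] {I τ : Type} [Fintype I] [DecidableEq I] [Fintype τ] [DecidableEq τ]

lemma LF_cyc {w Q B : ℕ} (hw : 1 ≤ w) (hQ : 4 ≤ Q) (hB : 0 < B) (b : ℤ) (c : I → τ → ℤ)
    (hc : ∀ s v, 2 * |c s v| ≤ w) (hinj : ∀ s s', s ≠ s' → ∃ v, c s' v ≠ c s v) :
    |av (fun n : ZMod N => av (fun x : τ → Fin B => ∏ s, nuW N w Q b
      (n + ((∑ v, c s v * (((x v : ℕ) : ℤ) + 1) : ℤ) : ZMod N)))) - 1| ≤ er (Fintype.card I) w Q N B (Fintype.card τ) := by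
  have hN : 0 < N := Nat.pos_of_ne_zero (NeZero.ne N)
  have hR : 1 ≤ Q ^ 4 := Nat.one_le_pow _ _ (by omega)
  have hw0 : (0 : ℤ) < w := by exact_mod_cast hw
  set g : ℤ → ℝ := fun z => Lam (fun p : Pri w Q => p.1) (Q ^ 4) ((w.factorial : ℤ) * z + b) with hg
  have h1 := wrap_av (N := N) g (((Q : ℝ) ^ 4) ^ 2) (fun z => Lam_nonneg _ hR _)
    (fun z => by have := Lam_le (fun p : Pri w Q => p.1) (Pri_inj w Q) hR ((w.factorial : ℤ) * z + b); push_cast at this; exact this)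
    (fun s (x : τ → Fin B) => ∑ v, c s v * (((x v : ℕ) : ℤ) + 1)) (Fintype.card τ * w * B) (by
      intro s x
      push_cast
      calc |∑ v, c s v * (((x v : ℕ) : ℤ) + 1)| ≤ ∑ v, |c s v * (((x v : ℕ) : ℤ) + 1)| := Finset.abs_sum_le_sum_abs _ _
        _ ≤ ∑ v : τ, (w : ℤ) * B := by
            apply Finset.sum_le_sum
            intro v _
            rw [abs_mul]
            have h2 := hc s v
            have h3 := abs_nonneg (c s v)
            have h4 : |((x v : ℕ) : ℤ) + 1| ≤ B := by
              have := (x v).2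
              rw [abs_of_nonneg (by positivity)]
              omega
            apply mul_le_mul (by linarith) h4 (abs_nonneg _) hw0.le
        _ = _ := by simp [mul_assoc])
  have h2 := LF_int (fun p : Pri w Q => p.1) (Pri_inj w Q) hR hN hB (w.factorial : ℤ) b (by
      intro p h
      have hp := (inferInstance : Fact (p.1).Prime).out
      rw [Int.cast_natCast, ZMod.natCast_eq_zero_iff] at h
      have := (hp.dvd_factorial).mp h
      have := Pri_lt p
      omega) c (by
      intro p s s' hne
      obtain ⟨v, hv⟩ := hinj s s' hne
      refine ⟨v, ?_⟩
      intro h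
      rw [ZMod.intCast_zmod_eq_zero_iff_dvd] at h
      have h3 : c s' v - c s v ≠ 0 := sub_ne_zero.mpr hv
      have h4 := Int.le_of_dvd (abs_pos.mpr h3) ((dvd_abs _ _).mpr h)
      have h5 := abs_sub (c s' v) (c s v)
      have h6 := hc s v
      have h7 := hc s' v
      have h8 := (Pri_lt p).1
      have h9 : (w : ℤ) < (p.1 : ℕ) := by exact_mod_cast h8
      linarith) 2 (half_VV w Q hQ)
  have h3 := sum_sq_Pri w Q hw (8 * 4 ^ (Fintype.card I)) (by positivity)
  have h4 : Real.exp (∑ p : Pri w Q, 8 * 4 ^ (Fintype.card I) / (p.1 : ℝ) ^ 2) ≤ Real.exp (8 * 4 ^ (Fintype.card I) / w) :=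
    Real.exp_le_exp.mpr h3
  have h5 : (2 : ℝ) ^ (Fintype.card I) * (Real.exp (∑ p : Pri w Q, 8 * 4 ^ (Fintype.card I) / (p.1 : ℝ) ^ 2) - 1) ≤
    2 ^ (Fintype.card I) * (Real.exp (8 * 4 ^ (Fintype.card I) / w) - 1) := by gcongr
  have h6 : av (fun w' : Fin N × (τ → Fin B) => ∏ s, g (((w'.1 : ℕ) : ℤ) + ∑ v, c s v * (((w'.2 v : ℕ) : ℤ) + 1))) =
     av (fun w' : Fin N × (τ → Fin B) => ∏ s, Lam (fun p : Pri w Q => p.1) (Q ^ 4) (zf (w.factorial : ℤ) b (c s) ((w'.1 : ℕ) : ℤ) (fun v => ((w'.2 v : ℕ) : ℤ)))) := by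
    simp only [hg, zf, Int.cast_id]
  rw [← h6] at h2
  unfold er
  push_cast at h1 h2 ⊢
  have h7 := abs_sub_le (av (fun n : ZMod N => av (fun x : τ → Fin B => ∏ s, nuW N w Q b
      (n + ((∑ v, c s v * (((x v : ℕ) : ℤ) + 1) : ℤ) : ZMod N)))))
      (av (fun w' : Fin N × (τ → Fin B) => ∏ s, g (((w'.1 : ℕ) : ℤ) + ∑ v, c s v * (((w'.2 v : ℕ) : ℤ) + 1)))) 1
  push_cast at h7
  have h8 : ∀ n : ZMod N, nuW N w Q b n = g ((n.val : ℕ) : ℤ) := fun n => rfl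
  simp only [h8] at h7 ⊢
  linarith

end

def dbl (ι X : Type) : (ι × Bool → X) ≃ (ι → X) × (ι → X) where
  toFun z := (fun l => z (l, false), fun l => z (l, true))
  invFun p := fun v => if v.2 then p.2 v.1 else p.1 v.1
  left_inv z := by
    funext ⟨l, β⟩
    cases β <;> simp
  right_inv p := by simp

section
variable {N : ℕ} [NeZero N] {I ι : Type} [Fintype I] [DecidableEq I] [Fintype ι] [DecidableEq ι]

lemma LF_dbl {w Q B : ℕ} (hw : 1 ≤ w) (hQ : 4 ≤ Q) (hB : 0 < B) (b : ℤ) (a : I → ι → ℤ) (t : I → Finset ι)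
    (ha : ∀ s l, 2 * |a s l| ≤ w)
    (hinj : ∀ s s', (∀ v : ι × Bool, (if (v.1 ∈ t s' ↔ v.2 = true) then a s' v.1 else 0) =
      (if (v.1 ∈ t s ↔ v.2 = true) then a s v.1 else 0)) → s = s') :
    |EE (fun (n : ZMod N) (x y : ι → Fin B) => ∏ s, nuW N w Q b
      (n + ((∑ l, a s l * ((((t s).piecewise y x l : Fin B) : ℕ) + 1) : ℤ) : ZMod N))) - 1|
      ≤ er (Fintype.card I) w Q N B (Fintype.card ι * 2) := by
  have h := LF_cyc (N := N) hw hQ hB b (fun s (v : ι × Bool) => if (v.1 ∈ t s ↔ v.2 = true) then a s v.1 else 0) (by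
    intro s v
    split_ifs
    · exact ha s v.1
    · simp) (by
    intro s s' hne
    by_contra hcon
    push Not at hcon
    exact hne (hinj s s' hcon))
  rw [Fintype.card_prod, Fintype.card_bool] at h
  have e : EE (fun (n : ZMod N) (x y : ι → Fin B) => ∏ s, nuW N w Q b
      (n + ((∑ l, a s l * ((((t s).piecewise y x l : Fin B) : ℕ) + 1) : ℤ) : ZMod N))) =
      av (fun n : ZMod N => av (fun x : ι × Bool → Fin B => ∏ s, nuW N w Q b
      (n + ((∑ v, (if (v.1 ∈ t s ↔ v.2 = true) then a s v.1 else 0) * (((x v : ℕ) : ℤ) + 1) : ℤ) : ZMod N)))) := by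
    unfold EE
    rw [av_prod]
    congr 1; funext n
    rw [av_equiv (dbl ι (Fin B))]
    congr 1; funext x
    apply Finset.prod_congr rfl
    intro s _
    congr 3
    rw [Fintype.sum_prod_type]
    apply Finset.sum_congr rfl
    intro l _
    rw [Fintype.sum_bool]
    by_cases hl : l ∈ t s
    · simp [hl, dbl, Finset.piecewise_eq_of_mem]
    · simp [hl, dbl, Finset.piecewise_eq_of_notMem]
  rw [e]
  exact h
end

end GT

end

section

open Filter
open scoped BigOperators

namespace GT

set_option linter.unusedSectionVars false
set_option linter.unusedSimpArgs false
set_option linter.unusedVariables false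
set_option linter.deprecated false

def mbar (κ : ℕ) : ℕ := (κ + 1) * 2 ^ (κ + 1)

lemma nuW_LF {N : ℕ} [NeZero N] (κ : ℕ) {w Q M : ℕ} (hw : 2 * (κ + 1).factorial ≤ w) (hQ : 4 ≤ Q) (hM : 0 < M) (b : ℤ)
    (ε : ℝ) (hε : er (mbar κ) w Q N M ((κ + 1) * 2) ≤ ε) :
    LF (fun (i : Fin (κ + 1)) (n : ZMod N) (x : Fin (κ + 1) → Fin M) => nuW N w Q b (n + ((psi i x : ℤ) : ZMod N))) ε := by
  intro S hS
  have hf := Nat.self_le_factorial (κ + 1)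
  have h := LF_dbl (N := N) (I := {s : Fin (κ + 1) × Finset (Fin (κ + 1)) // s.2 ∈ S s.1}) (w := w) (Q := Q) (B := M)
    (by omega) hQ hM b (fun s (l : Fin (κ + 1)) => ((l : ℕ) : ℤ) - ((s.1.1 : ℕ) : ℤ)) (fun s => s.1.2) (by
      intro s l
      have h1 := l.2
      have h2 := s.1.1.2
      have : |((l : ℕ) : ℤ) - ((s.1.1 : ℕ) : ℤ)| ≤ κ + 1 := by
        rw [abs_le]; constructor <;> omega
      have h3 : ((2 * (κ + 1) : ℕ) : ℤ) ≤ w := by exact_mod_cast le_trans (by omega) hw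
      push_cast at h3
      linarith) (by
      rintro ⟨⟨i, t⟩, hs⟩ ⟨⟨i', t'⟩, hs'⟩ hv
      have hit := hS i t hs
      have hit' := hS i' t' hs'
      dsimp only at hv
      have hii : i = i' := by
        by_contra hne
        have hne' : ((i : ℕ) : ℤ) - ((i' : ℕ) : ℤ) ≠ 0 := by
          intro h0
          apply hne
          apply Fin.ext
          omega
        by_cases hm : i ∈ t'
        · have := hv (i, true)
          simp [hm, hit] at this
          exact hne' (by simpa using this)
        · have := hv (i, false)
          simp [hm, hit] at this
          exact hne' (by simpa using this)
      subst hii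
      have htt : t = t' := by
        ext l
        by_cases hl : l = i
        · subst hl; simp [hit, hit']
        · have hne' : ((l : ℕ) : ℤ) - ((i : ℕ) : ℤ) ≠ 0 := by
            intro h0
            apply hl
            apply Fin.ext
            omega
          have := hv (l, true)
          simp only [iff_true] at this
          by_cases h1 : l ∈ t <;> by_cases h2 : l ∈ t' <;> simp only [h1, h2, if_true, if_false] at this ⊢
          · exact absurd this.symm hne'
          · exact absurd this hne'
      subst htt
      rfl)
  have hcard : Fintype.card {s : Fin (κ + 1) × Finset (Fin (κ + 1)) // s.2 ∈ S s.1} ≤ mbar κ := by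
    refine (Fintype.card_subtype_le _).trans ?_
    simp [mbar]
  rw [Fintype.card_fin] at h
  have h2 := (h.trans (er_mono hcard w Q N M ((κ + 1) * 2) (by omega))).trans hε
  have e : ∀ (n : ZMod N) (x y : Fin (κ + 1) → Fin M), ∏ i, ∏ t ∈ S i, nuW N w Q b (n + ((psi i (t.piecewise y x) : ℤ) : ZMod N)) =
      ∏ s : {s : Fin (κ + 1) × Finset (Fin (κ + 1)) // s.2 ∈ S s.1}, nuW N w Q b
      (n + ((∑ l : Fin (κ + 1), (((l : ℕ) : ℤ) - ((s.1.1 : ℕ) : ℤ)) * (((s.1.2.piecewise y x l : Fin M) : ℕ) + 1) : ℤ) : ZMod N)) := by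
    intro n x y
    rw [← Finset.prod_subtype (p := fun s : Fin (κ + 1) × Finset (Fin (κ + 1)) => s.2 ∈ S s.1) (Finset.univ.filter fun s : Fin (κ + 1) × Finset (Fin (κ + 1)) => s.2 ∈ S s.1) (by simp)
      (fun s => nuW N w Q b (n + ((∑ l : Fin (κ + 1), (((l : ℕ) : ℤ) - ((s.1 : ℕ) : ℤ)) * (((s.2.piecewise y x l : Fin M) : ℕ) + 1) : ℤ) : ZMod N)))]
    rw [Finset.prod_filter, Fintype.prod_prod_type]
    apply Finset.prod_congr rfl
    intro i _
    rw [← Finset.prod_filter]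
    simp [psi]
  simp_rw [e]
  exact h2

lemma nuW_LF2 {N : ℕ} [NeZero N] (κ : ℕ) {w Q H : ℕ} (hw : 2 * (κ + 1).factorial ≤ w) (hQ : 4 ≤ Q) (hH : 0 < H) (b : ℤ)
    (ε : ℝ) (hε : er (mbar κ) w Q N H (κ * 2) ≤ ε) : LF2 κ H (nuW N w Q b) ε := by
  intro S
  have hf : κ.factorial ≤ (κ + 1).factorial := Nat.factorial_le (by omega)
  have hpos : 0 < κ.factorial := Nat.factorial_pos κ
  have h := LF_dbl (N := N) (I := {t : Finset (Fin κ) // t ∈ S}) (w := w) (Q := Q) (B := H)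
    (by omega) hQ hH b (fun s l => (κ.factorial : ℤ)) (fun s => s.1) (by
      intro s l
      rw [abs_of_nonneg (by positivity)]
      exact_mod_cast le_trans (by omega) hw) (by
      rintro ⟨t, hs⟩ ⟨t', hs'⟩ hv
      dsimp only at hv
      have hne : (κ.factorial : ℤ) ≠ 0 := by exact_mod_cast hpos.ne'
      have htt : t = t' := by
        ext l
        have := hv (l, true)
        simp only [iff_true] at this
        by_cases h1 : l ∈ t <;> by_cases h2 : l ∈ t' <;> simp only [h1, h2, if_true, if_false] at this ⊢
        · exact absurd this.symm hne
        · exact absurd this hne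
      subst htt
      rfl)
  have hcard : Fintype.card {t : Finset (Fin κ) // t ∈ S} ≤ mbar κ := by
    refine (Fintype.card_subtype_le _).trans ?_
    simp only [Fintype.card_finset, Fintype.card_fin, mbar]
    calc 2 ^ κ ≤ 2 ^ (κ + 1) := Nat.pow_le_pow_right (by omega) (by omega)
      _ ≤ (κ + 1) * 2 ^ (κ + 1) := Nat.le_mul_of_pos_left _ (by omega)
  rw [Fintype.card_fin] at h
  have h2 := (h.trans (er_mono hcard w Q N H (κ * 2) (by omega))).trans hε
  have e : ∀ (n : ZMod N) (x y : Fin κ → Fin H), ∏ t ∈ S, nuW N w Q b (n + ((shf (t.piecewise y x) : ℤ) : ZMod N)) =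
      ∏ s : {t : Finset (Fin κ) // t ∈ S}, nuW N w Q b
      (n + ((∑ l, (κ.factorial : ℤ) * (((s.1.piecewise y x l : Fin H) : ℕ) + 1) : ℤ) : ZMod N)) := by
    intro n x y
    rw [Finset.prod_coe_sort S (fun t => nuW N w Q b
      (n + ((∑ l, (κ.factorial : ℤ) * (((t.piecewise y x l : Fin H) : ℕ) + 1) : ℤ) : ZMod N)))]
    rfl
  simp_rw [e]
  exact h2

end GT

end

section

open Filter
open scoped BigOperators

namespace GT

set_option linter.unusedSectionVars false
set_option linter.unusedSimpArgs false
set_option linter.unusedVariables false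
set_option linter.deprecated false

lemma psi_lin {κ M : ℕ} (j : Fin (κ + 1)) (x : Fin (κ + 1) → Fin M) :
    psi j x = psi 0 x - ((j : ℕ) : ℤ) * ∑ i, (((x i : ℕ) : ℤ) + 1) := by
  unfold psi
  rw [Finset.mul_sum, ← Finset.sum_sub_distrib]
  apply Finset.sum_congr rfl
  intro i _
  simp
  ring

lemma final_AP {N : ℕ} [NeZero N] {κ M W b : ℕ} (hM : 2 * (κ + 1) ^ 2 * M ≤ N) (hW : 0 < W) (E : Set ℕ)
    (n : ZMod N) (x : Fin (κ + 1) → Fin M)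
    (h : ∀ j, W * (n + ((psi j x : ℤ) : ZMod N)).val + b ∈ E ∧ 2 * (n + ((psi j x : ℤ) : ZMod N)).val < N) :
    ∃ x ∈ E, ∃ d : ℤ, d ≠ 0 ∧ ∀ j : ℕ, j < κ + 1 → ∃ e ∈ E, (e : ℤ) = (x : ℤ) + (j : ℤ) * d := by
  set S : ℤ := ∑ i, (((x i : ℕ) : ℤ) + 1) with hS
  have hS1 : 1 ≤ S := by
    rw [hS]
    have := Finset.single_le_sum (f := fun i => ((x i : ℕ) : ℤ) + 1) (s := Finset.univ) (fun i _ => by positivity) (Finset.mem_univ 0)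
    refine le_trans ?_ this
    simp
  have hS2 : S ≤ (κ + 1) * M := by
    rw [hS]
    calc _ ≤ ∑ i : Fin (κ + 1), (M : ℤ) := Finset.sum_le_sum fun i _ => by
          have := (x i).2
          omega
      _ = _ := by simp
  set a : Fin (κ + 1) → ℕ := fun j => (n + ((psi j x : ℤ) : ZMod N)).val with ha
  have key : ∀ j : Fin (κ + 1), (a j : ℤ) = a 0 - ((j : ℕ) : ℤ) * S := by
    intro j
    have h1 : (((a j : ℤ) - (a 0 - ((j : ℕ) : ℤ) * S) : ℤ) : ZMod N) = 0 := by
      push_cast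
      simp only [ha]
      rw [ZMod.natCast_zmod_val, ZMod.natCast_zmod_val, psi_lin j x, ← hS]
      push_cast
      ring
    rw [ZMod.intCast_zmod_eq_zero_iff_dvd] at h1
    have h2 := (h j).2
    have h3 := (h 0).2
    have h4 : ((j : ℕ) : ℤ) * S ≤ (κ + 1) * ((κ + 1) * M) := by
      have : ((j : ℕ) : ℤ) ≤ κ + 1 := by have := j.2; omega
      apply mul_le_mul this hS2 (by linarith) (by positivity)
    have h4' : 0 ≤ ((j : ℕ) : ℤ) * S := by positivity
    have h5 : 2 * ((κ : ℤ) + 1) ^ 2 * M ≤ N := by exact_mod_cast hM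
    have h6 : (a j : ℤ) - (a 0 - ((j : ℕ) : ℤ) * S) = 0 := by
      apply Int.eq_zero_of_abs_lt_dvd h1
      have h7 : 2 * (a j : ℤ) < N := by exact_mod_cast h2
      have h8 : 2 * (a 0 : ℤ) < N := by exact_mod_cast h3
      have h9 : (0 : ℤ) ≤ a j := by positivity
      have h10 : (0 : ℤ) ≤ a 0 := by positivity
      have h11 : ((κ : ℤ) + 1) * ((κ + 1) * M) = ((κ : ℤ) + 1) ^ 2 * M := by ring
      rw [abs_lt]
      constructor <;> nlinarith
    linarith
  refine ⟨W * a 0 + b, (h 0).1, -(W * S), ?_, ?_⟩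
  · have : (0 : ℤ) < W := by exact_mod_cast hW
    have : 0 < W * S := by positivity
    linarith
  · intro j hj
    refine ⟨W * a ⟨j, hj⟩ + b, (h ⟨j, hj⟩).1, ?_⟩
    have := key ⟨j, hj⟩
    push_cast
    rw [this]
    ring

lemma er_bound {m w Q N B K W : ℕ} {θ : ℝ} (hθ : 0 < θ) (hQ : 1 ≤ Q) (hW : 0 < W)
    (hB1 : θ * (Q : ℝ) ^ (16 * m + 1) ≤ B) (hB2 : (B : ℝ) ≤ (Q : ℝ) ^ (16 * m + 1))
    (hN : (Q : ℝ) ^ (24 * m + 2) / W ≤ N) :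
    er m w Q N B K ≤ 2 ^ m * (Real.exp (8 * 4 ^ m / w) - 1) + (2 * (W + K / θ) + 2 * K * w * W) / Q := by
  have hQ1 : (1 : ℝ) ≤ Q := by exact_mod_cast hQ
  have hQ0 : (0 : ℝ) < Q := by linarith
  have hW0 : (0 : ℝ) < W := by exact_mod_cast hW
  have hN0 : (0 : ℝ) < N := lt_of_lt_of_le (by positivity) hN
  have hB0 : (0 : ℝ) < B := lt_of_lt_of_le (by positivity) hB1
  have h1 : 1 / (N : ℝ) ≤ W / (Q : ℝ) ^ (24 * m + 2) := by
    rw [div_le_div_iff₀ hN0 (by positivity)]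
    rw [div_le_iff₀ hW0] at hN
    linarith
  have h2 : (K : ℝ) / B ≤ K / (θ * (Q : ℝ) ^ (16 * m + 1)) := by gcongr
  have h3 : ((Q : ℝ) ^ 4) ^ (4 * m) * (1 / N) ≤ W / Q := by
    calc ((Q : ℝ) ^ 4) ^ (4 * m) * (1 / N) ≤ (Q : ℝ) ^ (24 * m + 1) * (W / (Q : ℝ) ^ (24 * m + 2)) := by
          apply mul_le_mul _ h1 (by positivity) (by positivity)
          rw [← pow_mul]
          exact pow_le_pow_right₀ hQ1 (by omega)
      _ = W / Q := by
          rw [show 24 * m + 2 = 24 * m + 1 + 1 by ring, pow_succ _ (24 * m + 1)]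
          field_simp
  have h4 : ((Q : ℝ) ^ 4) ^ (4 * m) * (K / B) ≤ K / θ / Q := by
    calc ((Q : ℝ) ^ 4) ^ (4 * m) * (K / B) ≤ (Q : ℝ) ^ (16 * m) * (K / (θ * (Q : ℝ) ^ (16 * m + 1))) := by
          rw [← pow_mul, show 4 * (4 * m) = 16 * m by ring]
          gcongr
      _ = _ := by
          rw [pow_succ]
          field_simp
  have h5 : (((Q : ℝ) ^ 4) ^ 2) ^ m * (2 * ((K * w * B : ℕ) : ℝ) / N) ≤ 2 * K * w * W / Q := by
    push_cast
    calc (((Q : ℝ) ^ 4) ^ 2) ^ m * (2 * (K * w * B) / N)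
        = (Q : ℝ) ^ (8 * m) * (2 * (K * w * B)) * (1 / N) := by
          rw [← pow_mul, ← pow_mul, show 4 * 2 * m = 8 * m by ring]; ring
      _ ≤ (Q : ℝ) ^ (8 * m) * (2 * (K * w * (Q : ℝ) ^ (16 * m + 1))) * (W / (Q : ℝ) ^ (24 * m + 2)) := by
          gcongr
      _ = _ := by
          rw [show 24 * m + 2 = 8 * m + (16 * m + 1) + 1 by ring, pow_succ _ (8 * m + (16 * m + 1)), pow_add _ (8 * m)]
          field_simp
  unfold er
  have h6 : (2 * ((W : ℝ) + K / θ) + 2 * K * w * W) / Q = 2 * (W / Q) + 2 * (K / θ / Q) + 2 * K * w * W / Q := by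
    field_simp
  rw [h6]
  have h7 : 2 * ((Q : ℝ) ^ 4) ^ (4 * m) * (1 / N + K / B) = 2 * (((Q : ℝ) ^ 4) ^ (4 * m) * (1 / N)) + 2 * (((Q : ℝ) ^ 4) ^ (4 * m) * (K / B)) := by ring
  rw [h7]
  linarith

lemma exists_root (D X : ℕ) (hD : 1 ≤ D) : ∃ Q : ℕ, Q ^ D ≤ X ∧ X < (Q + 1) ^ D := by
  refine ⟨Nat.findGreatest (fun q => q ^ D ≤ X) X, ?_, ?_⟩
  · exact Nat.findGreatest_spec (P := fun q => q ^ D ≤ X) (m := 0) (by omega) (by simp [show D ≠ 0 by omega])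
  · by_contra h
    push Not at h
    have h1 : Nat.findGreatest (fun q => q ^ D ≤ X) X + 1 ≤ X :=
      (Nat.le_self_pow (by omega) _).trans h
    have := Nat.le_findGreatest (P := fun q => q ^ D ≤ X) h1 h
    omega

lemma pi_lower (X : ℕ) (hX : 1000 ≤ X) : (X : ℝ) / (2 * Real.log X) ≤ Nat.primeCounting X := by
  have hX' : (1000 : ℝ) ≤ X := by exact_mod_cast hX
  have hl : 0 < Real.log X := Real.log_pos (by linarith)
  refine le_trans ?_ (Chebyshev.pi_ge X)
  rw [div_le_div_iff₀ (by linarith) hl]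
  have h1 : Real.log (X + 1) ≤ X / 100 + 100 := by
    have h2 := Real.log_le_sub_one_of_pos (show (0 : ℝ) < (X + 1) / 100 by positivity)
    rw [Real.log_div (by positivity) (by norm_num)] at h2
    have h3 := Real.log_le_sub_one_of_pos (show (0 : ℝ) < 100 by norm_num)
    linarith
  have h4 := Real.log_two_gt_d9
  have h5 : (X : ℝ) ≤ 2 * (X * Real.log 2 - Real.log (X + 1)) := by nlinarith
  nlinarith

lemma pigeon_res {w Q : ℕ} (hw : 1 ≤ w) (hwQ : w ≤ Q) (A : Finset ℕ) (hA : ∀ e ∈ A, e.Prime ∧ Q < e) :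
    ∃ b, b < w.factorial ∧ (A.card : ℝ) ≤ (Nat.totient w.factorial : ℝ) * (A.filter fun e => e % w.factorial = b).card := by
  set W := w.factorial with hW
  have hW0 : 0 < W := Nat.factorial_pos w
  set T := (Finset.range W).filter (fun a => W.Coprime a) with hT
  have hTc : T.card = Nat.totient W := (Nat.totient_eq_card_coprime W).symm
  have hmaps : ∀ e ∈ A, e % W ∈ T := by
    intro e he
    obtain ⟨h1, h2⟩ := hA e he
    rw [hT, Finset.mem_filter, Finset.mem_range]
    refine ⟨Nat.mod_lt _ hW0, ?_⟩
    rw [Nat.coprime_comm, Nat.Coprime, ← Nat.gcd_rec, ← Nat.Coprime]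
    rw [Nat.coprime_comm, h1.coprime_iff_not_dvd, hW, h1.dvd_factorial]
    omega
  have hcard := Finset.card_eq_sum_card_fiberwise hmaps
  have hTne : T.Nonempty := by
    rw [← Finset.card_pos, hTc]
    exact Nat.totient_pos.mpr hW0
  obtain ⟨b, hb, hmax⟩ := Finset.exists_max_image T (fun b => (A.filter fun e => e % W = b).card) hTne
  refine ⟨b, Finset.mem_range.mp (Finset.mem_filter.mp hb).1, ?_⟩
  have : A.card ≤ Nat.totient W * (A.filter fun e => e % W = b).card := by
    rw [hcard, ← hTc]
    calc _ ≤ ∑ b' ∈ T, (A.filter fun e => e % W = b).card := Finset.sum_le_sum hmax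
      _ = _ := by simp
  exact_mod_cast this

end GT

end

section

open Filter
open scoped BigOperators

namespace GT

set_option linter.unusedSectionVars false
set_option linter.unusedSimpArgs false
set_option linter.unusedVariables false
set_option linter.deprecated false

open Classical in
/-- The normalised indicator of the set `E` along a residue class modulo `w!`. -/
noncomputable def fE (E : Set ℕ) (N w Q X b : ℕ) (n : ZMod N) : ℝ :=
  if (w.factorial * n.val + b ∈ E ∧ Q < w.factorial * n.val + b ∧ w.factorial * n.val + b ≤ X) then VV w Q else 0

lemma VV_nonneg' (w Q : ℕ) (hQ : 4 ≤ Q) : 0 ≤ VV w Q := by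
  have h := half_VV w Q hQ
  have : 0 ≤ ∏ p : Pri w Q, (1 + 1 / ((p.1 : ℝ) - 1)) := by
    apply Finset.prod_nonneg
    intro p _
    have hp : (2 : ℝ) ≤ (p.1 : ℝ) := by exact_mod_cast (Fact.out : Nat.Prime p.1).two_le
    have : 0 < (p.1 : ℝ) - 1 := by linarith
    positivity
  linarith

lemma fE_nonneg (E : Set ℕ) (N w Q X b : ℕ) (hQ : 4 ≤ Q) (n : ZMod N) : 0 ≤ fE E N w Q X b n := by
  unfold fE
  split_ifs
  · exact VV_nonneg' w Q hQ
  · exact le_rfl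

lemma fE_le (E : Set ℕ) (hE : E ⊆ {p : ℕ | p.Prime}) (N w Q X b : ℕ) (hQ : 4 ≤ Q) (n : ZMod N) :
    fE E N w Q X b n ≤ nuW N w Q b n := by
  have hR : 1 ≤ Q ^ 4 := Nat.one_le_pow _ _ (by omega)
  unfold fE
  split_ifs with h
  · unfold nuW VV
    rw [Lam_free _ hR]
    intro p hp
    have h1 : ((w.factorial * n.val + b : ℕ) : ZMod p.1) = 0 := by
      rw [← hp]; push_cast; rfl
    rw [ZMod.natCast_eq_zero_iff] at h1
    have h2 := hE h.1
    have h3 := (Nat.prime_dvd_prime_iff_eq (Fact.out : Nat.Prime p.1) h2).1 h1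
    have h4 := (Pri_lt p).2
    have h5 := h.2.1
    omega
  · exact Lam_nonneg _ hR _

lemma fE_av (E : Set ℕ) (N w Q X b : ℕ) [NeZero N] (hQ : 4 ≤ Q) (hN : X / w.factorial < N)
    (A : Finset ℕ) (hA : ∀ e ∈ A, e ∈ E ∧ Q < e ∧ e ≤ X ∧ e % w.factorial = b) :
    VV w Q * A.card / N ≤ av (fE E N w Q X b) := by
  classical
  unfold av
  rw [ZMod.card]
  have hN0 : (0 : ℝ) < N := by exact_mod_cast Nat.pos_of_ne_zero (NeZero.ne N)
  apply div_le_div_of_nonneg_right _ hN0.le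
  have hval : ∀ e ∈ A, ((e / w.factorial : ℕ) : ZMod N).val = e / w.factorial := by
    intro e he
    apply ZMod.val_cast_of_lt
    exact lt_of_le_of_lt (Nat.div_le_div_right (hA e he).2.2.1) hN
  have hrec : ∀ e ∈ A, w.factorial * ((e / w.factorial : ℕ) : ZMod N).val + b = e := by
    intro e he
    rw [hval e he, ← (hA e he).2.2.2]
    exact Nat.div_add_mod e _
  have hinj : Set.InjOn (fun e : ℕ => ((e / w.factorial : ℕ) : ZMod N)) (A : Set ℕ) := by
    intro e he e' he' hee
    rw [← hrec e he, ← hrec e' he']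
    simp only at hee
    rw [hee]
  calc VV w Q * A.card = ∑ n ∈ A.image (fun e : ℕ => ((e / w.factorial : ℕ) : ZMod N)), fE E N w Q X b n := by
        rw [Finset.sum_image hinj]
        rw [Finset.sum_congr rfl (g := fun _ => VV w Q)]
        · simp [mul_comm]
        · intro e he
          unfold fE
          rw [hrec e he, if_pos]
          exact ⟨(hA e he).1, (hA e he).2.1, (hA e he).2.2.1⟩
    _ ≤ _ := Finset.sum_le_sum_of_subset_of_nonneg (Finset.subset_univ _) fun n _ _ => fE_nonneg E N w Q X b hQ n

lemma log_comp {D X Q : ℕ} (hX : 1 ≤ X) (hQ : 2 ≤ Q) (h : X < (Q + 1) ^ D) :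
    Real.log X ≤ 2 * D * Real.log Q := by
  have hQ' : (2 : ℝ) ≤ Q := by exact_mod_cast hQ
  have h1 : (X : ℝ) ≤ (Q : ℝ) ^ (2 * D) := by
    have : X ≤ (Q ^ 2) ^ D := h.le.trans (Nat.pow_le_pow_left (by nlinarith) D)
    rw [pow_mul]
    exact_mod_cast this
  have h2 := Real.log_le_log (by exact_mod_cast hX) h1
  rw [Real.log_pow] at h2
  push_cast at h2
  exact h2

lemma dens_arith {V φ W lQ lX X a g N δ D : ℝ} (hφ : 0 ≤ φ) (hW : 0 < W) (hlQ : 0 < lQ) (hlX : 0 < lX) (hX : 0 < X)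
    (hg : 0 ≤ g) (hN : 0 < N) (hδ : 0 < δ) (hD : 0 < D)
    (h1 : a ≤ φ * g) (h2 : φ / W * lQ ≤ 2 * V) (h3 : N ≤ 4 * X / W) (h4 : δ * X / (4 * lX) ≤ a)
    (h5 : lX ≤ 2 * D * lQ) : δ / (64 * D) ≤ V * g / N := by
  have e1 : a * lQ / W ≤ 2 * (V * g) := by
    calc a * lQ / W ≤ (φ * g) * lQ / W := by gcongr
      _ = (φ / W * lQ) * g := by ring
      _ ≤ (2 * V) * g := by gcongr
      _ = _ := by ring
  have e2 : δ * X / (8 * D) ≤ a * lQ := by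
    have : δ * X / (4 * lX) * lQ ≤ a * lQ := by gcongr
    refine le_trans ?_ this
    rw [div_mul_eq_mul_div, div_le_div_iff₀ (by positivity) (by positivity)]
    have : δ * X * lX ≤ δ * X * (2 * D * lQ) := by gcongr
    nlinarith
  have e3 : δ * X / (8 * D) / W ≤ 2 * (V * g) := le_trans (by gcongr) e1
  rw [le_div_iff₀ hN]
  calc δ / (64 * D) * N ≤ δ / (64 * D) * (4 * X / W) := by gcongr
    _ = (δ * X / (8 * D) / W) / 2 := by field_simp; ring
    _ ≤ _ := by linarith

lemma exists_w (m : ℕ) (n0 : ℕ) {ε : ℝ} (hε : 0 < ε) :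
    ∃ w : ℕ, n0 ≤ w ∧ 2 ^ m * (Real.exp (8 * 4 ^ m / w) - 1) ≤ ε := by
  have h1 : Tendsto (fun w : ℕ => (2 : ℝ) ^ m * (Real.exp (8 * 4 ^ m / (w : ℝ)) - 1)) atTop (nhds (2 ^ m * (Real.exp 0 - 1))) := by
    apply Tendsto.const_mul
    apply Tendsto.sub_const
    apply (Real.continuous_exp.tendsto 0).comp
    exact tendsto_const_div_atTop_nhds_zero_nat _
  simp only [Real.exp_zero, sub_self, mul_zero] at h1
  obtain ⟨w, hw1, hw2⟩ := ((eventually_ge_atTop n0).and (h1.eventually (gt_mem_nhds hε))).exists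
  exact ⟨w, hw1, hw2.le⟩

end GT

end

section

open Filter
open scoped BigOperators

namespace GT

set_option linter.unusedSectionVars false
set_option linter.unusedSimpArgs false
set_option linter.unusedVariables false
set_option linter.deprecated false

set_option maxHeartbeats 2000000 in
open Classical in
lemma main_AP (κ : ℕ) (δ : ℝ) (hδ : 0 < δ) : ∃ X0 : ℕ, ∀ X, X0 ≤ X → ∀ E : Set ℕ, E ⊆ {p : ℕ | p.Prime} →
    δ * (Nat.primeCounting X : ℝ) ≤ ((Finset.Icc 1 X).filter (fun e => e ∈ E)).card →
    ∃ x ∈ E, ∃ d : ℤ, d ≠ 0 ∧ ∀ j : ℕ, j < κ + 1 → ∃ e ∈ E, (e : ℤ) = (x : ℤ) + (j : ℤ) * d := by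
  set m := mbar κ with hm
  have hm1 : 1 ≤ m := by rw [hm]; unfold mbar; exact Nat.one_le_iff_ne_zero.2 (by positivity)
  obtain ⟨D, hD⟩ : ∃ D, D = 24 * m + 2 := ⟨_, rfl⟩
  have hD0 : (0 : ℝ) < D := by rw [hD]; positivity
  obtain ⟨ε, hε, η, hη, c, hc, M0, hM0, htr⟩ := transfer κ (δ / (64 * D)) (by positivity)
  obtain ⟨w, hw, hwε⟩ := exists_w m (2 * (κ + 1).factorial) (half_pos hε)
  have hw1 : 1 ≤ w := by have := Nat.factorial_pos (κ + 1); omega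
  obtain ⟨W, hW⟩ : ∃ W, W = w.factorial := ⟨_, rfl⟩
  have hW0 : 0 < W := by rw [hW]; exact Nat.factorial_pos w
  have hW0' : (0 : ℝ) < W := by exact_mod_cast hW0
  set η1 : ℝ := min η 1 with hη1
  have hη1p : 0 < η1 := lt_min hη one_pos
  have hη1l : η1 ≤ 1 := min_le_right _ _
  set er1 : ℝ := 2 * (W + (((κ + 1) * 2 : ℕ) : ℝ) / 1) + 2 * (((κ + 1) * 2 : ℕ) : ℝ) * w * W with her1
  set er2 : ℝ := 2 * (W + ((κ * 2 : ℕ) : ℝ) / (η1 / 2)) + 2 * ((κ * 2 : ℕ) : ℝ) * w * W with her2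
  set Q0 : ℕ := 1000 + w + M0 + 2 * (κ + 1) ^ 2 * W + ⌈er1 / (ε / 2)⌉₊ + ⌈er2 / (ε / 2)⌉₊ + ⌈8 * D / δ⌉₊ + ⌈2 / η1⌉₊ + W with hQ0
  refine ⟨Q0 ^ D, fun X hX E hE hcard => ?_⟩
  obtain ⟨Q, hQX, hXQ⟩ := exists_root D X (by omega)
  have hQQ : Q0 ≤ Q := by
    by_contra h
    push Not at h
    have := Nat.pow_le_pow_left (show Q + 1 ≤ Q0 by omega) D
    omega
  have q1 : 1000 ≤ Q := by omega
  have q2 : w ≤ Q := by omega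
  have q3 : M0 ≤ Q := by omega
  have q4 : 2 * (κ + 1) ^ 2 * W ≤ Q := by omega
  have hceil : ∀ r : ℝ, ⌈r⌉₊ ≤ Q → r ≤ Q := fun r h => (Nat.le_ceil r).trans (by exact_mod_cast h)
  have q5 : er1 / (ε / 2) ≤ Q := hceil _ (by omega)
  have q6 : er2 / (ε / 2) ≤ Q := hceil _ (by omega)
  have q7 : 8 * D / δ ≤ (Q : ℝ) := hceil _ (by omega)
  have q8 : 2 / η1 ≤ (Q : ℝ) := hceil _ (by omega)
  have q9 : W ≤ Q := by omega
  have hQr : (1000 : ℝ) ≤ Q := by exact_mod_cast q1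
  have hQp : (0 : ℝ) < Q := by linarith
  have hQ3X : Q ^ 3 ≤ X := (Nat.pow_le_pow_right (by omega) (by omega)).trans hQX
  have hQleX : Q ≤ X := (Nat.le_self_pow (by norm_num) Q).trans hQ3X
  have hXr : (1000 : ℝ) ≤ X := by exact_mod_cast (q1.trans hQleX)
  have hXp : (0 : ℝ) < X := by linarith
  have hlX : 0 < Real.log X := Real.log_pos (by linarith)
  have hlQ : 0 < Real.log Q := Real.log_pos (by linarith)
  have hlog := log_comp (D := D) (by omega) (by omega) hXQ
  -- the modulus
  obtain ⟨Y, hY⟩ : ∃ Y, Y = X / W := ⟨_, rfl⟩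
  obtain ⟨N, hN⟩ : ∃ N, N = 2 * (Y + 1) := ⟨_, rfl⟩
  have : NeZero N := ⟨by omega⟩
  have hXW : X < W * (Y + 1) := by
    rw [hY]
    exact Nat.lt_mul_div_succ X hW0
  have hNlow : (2 : ℝ) * (X / W) ≤ N := by
    have : (X : ℝ) ≤ W * (Y + 1) := by exact_mod_cast hXW.le
    have h2 : (X : ℝ) / W ≤ Y + 1 := by
      rw [div_le_iff₀ hW0']; linarith
    rw [hN]; push_cast; linarith
  have hNup : (N : ℝ) ≤ 4 * X / W := by
    have h1 : (Y : ℝ) ≤ X / W := by rw [hY]; exact Nat.cast_div_le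
    have h2 : (1 : ℝ) ≤ X / W := by
      rw [le_div_iff₀ hW0', one_mul]
      exact_mod_cast q9.trans hQleX
    rw [hN]; push_cast
    rw [mul_div_assoc]; linarith
  have hN0 : (0 : ℝ) < N := by exact_mod_cast Nat.pos_of_ne_zero (NeZero.ne N)
  have hNQ : (Q : ℝ) ^ (24 * m + 2) / W ≤ N := by
    have h1 : (Q : ℝ) ^ (24 * m + 2) ≤ X := by rw [← hD]; exact_mod_cast hQX
    have h2 : (Q : ℝ) ^ (24 * m + 2) / W ≤ X / W := by gcongr
    have h3 : (0 : ℝ) ≤ X / W := by positivity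
    linarith
  -- the scale
  obtain ⟨M, hM⟩ : ∃ M, M = Q ^ (16 * m + 1) := ⟨_, rfl⟩
  have hQM : Q ≤ M := by rw [hM]; exact Nat.le_self_pow (by omega) Q
  have hMr : (M : ℝ) = (Q : ℝ) ^ (16 * m + 1) := by rw [hM]; push_cast; rfl
  have hMN : 2 * (κ + 1) ^ 2 * M ≤ N := by
    have h1 : W * (2 * (κ + 1) ^ 2 * M) ≤ X := by
      calc W * (2 * (κ + 1) ^ 2 * M) = (2 * (κ + 1) ^ 2 * W) * M := by ring
        _ ≤ Q * M := Nat.mul_le_mul_right _ q4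
        _ = Q ^ (16 * m + 2) := by rw [hM]; ring
        _ ≤ Q ^ D := Nat.pow_le_pow_right (by omega) (by omega)
        _ ≤ X := hQX
    have h2 : 2 * (κ + 1) ^ 2 * M < Y + 1 := lt_of_mul_lt_mul_left (lt_of_le_of_lt h1 hXW) (Nat.zero_le W)
    omega
  obtain ⟨H, hH⟩ : ∃ H, H = ⌊η1 * M⌋₊ := ⟨_, rfl⟩
  have hQMr : (Q : ℝ) ≤ M := by exact_mod_cast hQM
  have hηM : 2 ≤ η1 * M := by
    have h1 : 2 / η1 ≤ M := q8.trans hQMr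
    rw [div_le_iff₀ hη1p] at h1
    linarith
  have hHle : (H : ℝ) ≤ η1 * M := by rw [hH]; exact Nat.floor_le (by positivity)
  have hHge : η1 / 2 * M ≤ H := by
    have := Nat.lt_floor_add_one (η1 * (M : ℝ))
    rw [← hH] at this
    linarith
  have hH0 : 0 < H := by
    have : (0 : ℝ) < H := lt_of_lt_of_le (by linarith) hHge
    exact_mod_cast this
  have hHη : (H : ℝ) ≤ η * M := hHle.trans (by gcongr; exact min_le_left _ _)
  have hMp : (0 : ℝ) ≤ M := by positivity
  have hHM : (H : ℝ) ≤ M := hHle.trans (by nlinarith)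
  -- the dense set
  set A : Finset ℕ := (Finset.Icc 1 X).filter (fun e => e ∈ E ∧ Q < e) with hA
  have hAcard : (((Finset.Icc 1 X).filter (fun e => e ∈ E)).card : ℝ) ≤ A.card + Q := by
    have h1 : (Finset.Icc 1 X).filter (fun e => e ∈ E) ⊆ A ∪ Finset.Icc 1 Q := by
      intro e he
      simp only [hA, Finset.mem_filter, Finset.mem_union, Finset.mem_Icc] at he ⊢
      by_cases hq : Q < e
      · left; exact ⟨he.1, he.2, hq⟩
      · right; omega
    have h2 := (Finset.card_le_card h1).trans (Finset.card_union_le _ _)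
    simp only [Nat.card_Icc, Nat.add_sub_cancel] at h2
    exact_mod_cast h2
  have hAlow : δ * X / (4 * Real.log X) ≤ A.card := by
    have h1 := pi_lower X (q1.trans hQleX)
    have h2 : δ * (X / (2 * Real.log X)) ≤ δ * (Nat.primeCounting X : ℝ) := by gcongr
    have h3 : (Q : ℝ) ≤ δ * X / (4 * Real.log X) := by
      rw [le_div_iff₀ (by positivity)]
      have h4 : Real.log Q ≤ Q := (Real.log_le_sub_one_of_pos hQp).trans (by linarith)
      have h5 : Real.log X ≤ 2 * D * Q := hlog.trans (by gcongr)
      have h6 : 8 * (D : ℝ) ≤ δ * Q := by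
        rw [div_le_iff₀ hδ] at q7; linarith
      have h7 : (Q : ℝ) ^ 3 ≤ X := by exact_mod_cast hQ3X
      calc (Q : ℝ) * (4 * Real.log X) ≤ Q * (4 * (2 * D * Q)) := by gcongr
        _ = (8 * D) * Q ^ 2 := by ring
        _ ≤ (δ * Q) * Q ^ 2 := by gcongr
        _ = δ * Q ^ 3 := by ring
        _ ≤ δ * X := by gcongr
    have h8 : δ * (X / (2 * Real.log X)) = δ * X / (4 * Real.log X) + δ * X / (4 * Real.log X) := by
      field_simp; ring
    linarith
  obtain ⟨b, hb, hbA⟩ := pigeon_res hw1 q2 A (by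
    intro e he
    simp only [hA, Finset.mem_filter, Finset.mem_Icc] at he
    exact ⟨hE he.2.1, he.2.2⟩)
  have hXN : X / w.factorial < N := by rw [← hW, ← hY]; omega
  have hav0 := fE_av E N w Q X b (by omega) hXN (A.filter fun e => e % w.factorial = b) (by
    intro e he
    simp only [hA, Finset.mem_filter, Finset.mem_Icc] at he
    exact ⟨he.1.2.1, he.1.2.2, he.1.1.2, he.2⟩)
  have hVV := VV_ge w Q (by omega) q2
  rw [← hW] at hVV hbA
  rw [← hW] at hav0
  have hav : δ / (64 * D) ≤ av (fE E N w Q X b) := by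
    refine le_trans ?_ hav0
    exact dens_arith (by positivity) hW0' hlQ hlX hXp (by positivity) hN0 hδ hD0 hbA hVV hNup hAlow hlog
  have ee : ∀ r : ℝ, r / (ε / 2) ≤ Q → r / Q ≤ ε / 2 := by
    intro r hr
    rw [div_le_iff₀ (by positivity)] at hr
    rw [div_le_iff₀ hQp]; linarith
  have hLF := nuW_LF (N := N) κ (M := M) hw (show 4 ≤ Q by omega) (by omega) (b : ℤ) ε (by
    have := er_bound (m := m) (w := w) (Q := Q) (N := N) (B := M) (K := (κ + 1) * 2) (W := W) one_pos (by omega) hW0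
      (by rw [hMr, one_mul]) hMr.le hNQ
    have h2 := ee _ q5
    rw [← hm]
    rw [← her1] at this
    exact this.trans ((add_le_add hwε h2).trans (add_halves ε).le))
  have hLF2 := nuW_LF2 (N := N) κ hw (show 4 ≤ Q by omega) hH0 (b : ℤ) ε (by
    have := er_bound (m := m) (w := w) (Q := Q) (N := N) (B := H) (K := κ * 2) (W := W) (half_pos hη1p) (by omega) hW0
      (by rw [← hMr]; exact hHge) (by rw [← hMr]; exact hHM) hNQ
    have h2 := ee _ q6
    rw [← hm]
    rw [← her2] at this
    exact this.trans ((add_le_add hwε h2).trans (add_halves ε).le))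
  have hfin := htr (ZMod N) (nuW N w Q b) (fE E N w Q X b) M H (fE_nonneg E N w Q X b (by omega))
    (fE_le E hE N w Q X b (by omega)) hav (q3.trans hQM) hH0 hHη hLF hLF2
  have hpos : 0 < E2 (fun (n : ZMod N) (x : Fin (κ + 1) → Fin M) => ∏ j, fE E N w Q X b (n + ((psi j x : ℤ) : ZMod N))) :=
    lt_of_lt_of_le hc hfin
  unfold E2 at hpos
  obtain ⟨p, hp⟩ := av_pos_exists hpos
  refine final_AP (W := W) (b := b) hMN hW0 E p.1 p.2 fun j => ?_
  have hj : fE E N w Q X b (p.1 + ((psi j p.2 : ℤ) : ZMod N)) ≠ 0 :=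
    Finset.prod_ne_zero_iff.1 hp.ne' j (Finset.mem_univ j)
  unfold fE at hj
  have hj2 := (ite_ne_right_iff.1 hj).1
  rw [← hW] at hj2
  refine ⟨hj2.1, ?_⟩
  have h1 : (p.1 + ((psi j p.2 : ℤ) : ZMod N)).val ≤ Y := by
    rw [hY, Nat.le_div_iff_mul_le hW0, mul_comm]
    omega
  omega

lemma card_inter_Icc (E : Set ℕ) (X : ℕ) [DecidablePred (fun e => e ∈ E)] :
    Nat.card ↥(E ∩ Set.Icc 1 X) = ((Finset.Icc 1 X).filter (fun e => e ∈ E)).card := by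
  have : E ∩ Set.Icc 1 X = (((Finset.Icc 1 X).filter (fun e => e ∈ E) : Finset ℕ) : Set ℕ) := by
    ext e; simp only [Set.mem_inter_iff, Set.mem_Icc, Finset.coe_filter, Finset.mem_Icc, Set.mem_setOf_eq]; tauto
  rw [this, Nat.card_coe_set_eq, Set.ncard_coe_finset]

lemma card_primes_Icc (X : ℕ) :
    Nat.card ↥({p : ℕ | p.Prime} ∩ Set.Icc 1 X) = Nat.primeCounting X := by
  classical
  rw [card_inter_Icc, Nat.primeCounting, Nat.primeCounting', Nat.count_eq_card_filter_range]
  congr 1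
  ext e
  simp only [Finset.mem_filter, Finset.mem_Icc, Finset.mem_range, Set.mem_setOf_eq]
  constructor
  · rintro ⟨h1, h2⟩; exact ⟨by omega, h2⟩
  · rintro ⟨h1, h2⟩; exact ⟨⟨h2.one_lt.le, by omega⟩, h2⟩

lemma freq_AP (E : Set ℕ) (hE : E ⊆ {p : ℕ | p.Prime})
    (hpos : 0 < limsup (fun N : ℕ =>
    (Nat.card ↥(E ∩ Set.Icc 1 N) : ℝ) /
      (Nat.card ↥({p : ℕ | p.Prime} ∩ Set.Icc 1 N) : ℝ)) atTop) (κ : ℕ) :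
    ∃ x ∈ E, ∃ d : ℤ, d ≠ 0 ∧
      ∀ j : ℕ, j < κ + 1 → ∃ e ∈ E, (e : ℤ) = (x : ℤ) + (j : ℤ) * d := by
  classical
  obtain ⟨δ, hδ, hlt⟩ := exists_between hpos
  have hfreq := Filter.frequently_lt_of_lt_limsup (by
    refine isCoboundedUnder_le_of_le atTop (x := 0) ?_
    intro N; positivity) hlt
  obtain ⟨X0, hX0⟩ := main_AP κ δ hδ
  obtain ⟨X, hX, hX2⟩ := (Filter.frequently_atTop.1 hfreq) X0
  apply hX0 X hX E hE
  rw [card_inter_Icc, card_primes_Icc] at hX2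
  rcases Nat.eq_zero_or_pos (Nat.primeCounting X) with h0 | h0
  · rw [h0]; simp
  · rw [lt_div_iff₀ (by exact_mod_cast h0)] at hX2
    convert hX2.le

end GT

end

/-- **The Green–Tao theorem**: a subset of the primes of positive relative upper density
contains, for every `k ≥ 3`, a non-trivial `k`-term arithmetic progression. -/
theorem green_tao (E : Set ℕ) (hE : E ⊆ {p : ℕ | p.Prime})
    (hpos : 0 < relUpperDensity E) (k : ℕ) (hk : 3 ≤ k) :
    ∃ x ∈ E, ∃ d : ℤ, d ≠ 0 ∧
      ∀ j : ℕ, j < k → ∃ e ∈ E, (e : ℤ) = (x : ℤ) + (j : ℤ) * d := by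
  obtain ⟨κ, rfl⟩ : ∃ κ, k = κ + 1 := ⟨k - 1, by omega⟩
  exact GT.freq_AP E hE hpos κ
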